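/- Fix integers s ≥ 2, n_i > 0 and d_i > 0 for 1 ≤ i ≤ s; set n = n_1 + ⋯ + n_s and r = −1 + ∏ C(d_i+n_i, d_i). Let X ⊂ ℙ^r be the Segre–Veronese embedding of ℙ^{n_1} × ⋯ × ℙ^{n_s} of multidegree (d_1,…,d_s), over an algebraically closed field of characteristic 0. Assume dim σ_{k+n−1}(X) = (k+n−1)(n+1)−1 < r, and assume that either (i) d_i > 1 for all i, or (ii) for every i with d_i = 1 there exists j ≠ i with d_j = 1 and n_i = n_j. Then X is not weakly j-defective, and hence is j-identifiable, for every j ≤ k. -/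

import Mathlib

noncomputable section

namespace ContactLoci

variable {K : Type*} [Field K] {ι : Type*} [Fintype ι]

/-- Projective space over `K` with homogeneous coordinates indexed by `ι`. -/
abbrev PP (K : Type*) [Field K] (ι : Type*) : Type _ :=
  Projectivization K (ι → K)

/-- The affine cone over a set of projective points. -/
def coneOf (S : Set (PP K ι)) : Set (ι → K) :=
  ⋃ x ∈ S, (x.submodule : Set (ι → K))

/-- The linear span, in the underlying vector space, of the cone over `S`. -/
def vspan (S : Set (PP K ι)) : Submodule K (ι → K) :=
  Submodule.span K (coneOf S)

/-- The projective linear span of a set of projective points. -/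
def projSpan (S : Set (PP K ι)) : Set (PP K ι) :=
  {x | x.submodule ≤ vspan S}

/-- The projective dimension of the linear span of `S` (`-1` for `S = ∅`). -/
def projDim (S : Set (PP K ι)) : ℤ :=
  (Module.finrank K (vspan S) : ℤ) - 1

/-- A set of projective points is non-degenerate if its linear span is everything. -/
def Nondegenerate (S : Set (PP K ι)) : Prop :=
  vspan S = ⊤

/-- The common zero locus in projective space of a set of polynomials. -/
def zeroLocus (S : Set (MvPolynomial ι K)) : Set (PP K ι) :=
  {x | ∀ f ∈ S, ∀ v ∈ x.submodule, MvPolynomial.eval v f = 0}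

/-- Zariski-closed subsets of projective space: common zero loci of sets of
homogeneous polynomials. -/
def IsZClosed (X : Set (PP K ι)) : Prop :=
  ∃ S : Set (MvPolynomial ι K), (∀ f ∈ S, ∃ d : ℕ, f.IsHomogeneous d) ∧ X = zeroLocus S

/-- Zariski closure. -/
def zclosure (S : Set (PP K ι)) : Set (PP K ι) :=
  ⋂₀ {Y | IsZClosed Y ∧ S ⊆ Y}

/-- Irreducibility with respect to the Zariski topology. -/
def IsZIrreducible (S : Set (PP K ι)) : Prop :=
  S.Nonempty ∧ ∀ Y Z : Set (PP K ι), IsZClosed Y → IsZClosed Z → S ⊆ Y ∪ Z → S ⊆ Y ∨ S ⊆ Z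

/-- An integral projective variety: a Zariski-closed irreducible subset. -/
def IsIntegralVariety (X : Set (PP K ι)) : Prop :=
  IsZClosed X ∧ IsZIrreducible X

/-- `C` is an irreducible component of `S`: a maximal irreducible subset of `S`. -/
def IsZIrredComponent (S C : Set (PP K ι)) : Prop :=
  IsZIrreducible C ∧ C ⊆ S ∧ ∀ D : Set (PP K ι), IsZIrreducible D → D ⊆ S → C ⊆ D → C = D

/-- The dimension of a set: the Krull dimension of the poset of irreducible
Zariski-closed subsets of its Zariski closure (`⊥` for the empty set). -/
def zdim (S : Set (PP K ι)) : WithBot ℕ∞ :=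
  Order.krullDim ({Y : Set (PP K ι) // IsZClosed Y ∧ IsZIrreducible Y ∧ Y ⊆ zclosure S})

/-- A property holds at a general point of `X`: it holds away from a proper
Zariski-closed subset. -/
def HoldsGenerically (X : Set (PP K ι)) (P : PP K ι → Prop) : Prop :=
  ∃ Y : Set (PP K ι), IsZClosed Y ∧ ¬X ⊆ Y ∧ ∀ x ∈ X \ Y, P x

/-- Zero locus of multihomogeneous polynomials in a self-product of projective space. -/
def multiZeroLocus {m : ℕ} (S : Set (MvPolynomial (Fin m × ι) K)) :
    Set (Fin m → PP K ι) :=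
  {u | ∀ f ∈ S, ∀ v : Fin m → ι → K, (∀ i, v i ∈ (u i).submodule) →
    MvPolynomial.eval (fun p => v p.1 p.2) f = 0}

/-- Zariski-closed subsets of the `m`-fold self-product of projective space. -/
def IsMultiZClosed {m : ℕ} (T : Set (Fin m → PP K ι)) : Prop :=
  ∃ S : Set (MvPolynomial (Fin m × ι) K),
    (∀ f ∈ S, ∀ i : Fin m, ∃ d : ℕ,
      MvPolynomial.IsWeightedHomogeneous (fun p : Fin m × ι => if p.1 = i then 1 else 0) f d) ∧
    T = multiZeroLocus S

/-- A property holds for a general `m`-tuple of points of `X`. -/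
def HoldsForGeneralTuples (X : Set (PP K ι)) (m : ℕ) (P : (Fin m → PP K ι) → Prop) : Prop :=
  ∃ T : Set (Fin m → PP K ι), IsMultiZClosed T ∧
    (∃ u : Fin m → PP K ι, (∀ i, u i ∈ X) ∧ u ∉ T) ∧
    ∀ u : Fin m → PP K ι, (∀ i, u i ∈ X) → u ∉ T → P u

/-- The homogeneous vanishing ideal of `X` (as a set of homogeneous polynomials). -/
def homogVanishingIdeal (X : Set (PP K ι)) : Set (MvPolynomial ι K) :=
  {f | (∃ d : ℕ, f.IsHomogeneous d) ∧ ∀ x ∈ X, ∀ v ∈ x.submodule, MvPolynomial.eval v f = 0}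

/-- The embedded (projective) tangent space of `X` at `x`. -/
def embTangentSpace (X : Set (PP K ι)) (x : PP K ι) : Set (PP K ι) :=
  {y | ∀ f ∈ homogVanishingIdeal X,
    ∑ i : ι, y.rep i * MvPolynomial.eval x.rep (MvPolynomial.pderiv i f) = 0}

/-- Smooth points of `X`. -/
def IsSmoothPoint (X : Set (PP K ι)) (x : PP K ι) : Prop :=
  x ∈ X ∧ zdim (embTangentSpace X x) = zdim X

/-- `M_A`: the linear span of the tangent spaces of `X` at the points of `A`. -/
def tangentSpan (X A : Set (PP K ι)) : Set (PP K ι) :=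
  projSpan (⋃ a ∈ A, embTangentSpace X a)

/-- The locus of smooth points of `X` at which `M_A` is tangent to `X`. -/
def tangencyLocus (X A : Set (PP K ι)) : Set (PP K ι) :=
  {x | IsSmoothPoint X x ∧ embTangentSpace X x ⊆ tangentSpan X A}

/-- The tangential contact locus of `X` at `A`: the closure of the union of the
irreducible components of the tangency locus meeting `A`. -/
def contactLocus (X A : Set (PP K ι)) : Set (PP K ι) :=
  zclosure (⋃ C ∈ {C : Set (PP K ι) |
    IsZIrredComponent (tangencyLocus X A) C ∧ (C ∩ A).Nonempty}, C)

/-- `X` is weakly `k`-defective: the tangential contact locus at `k` general points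
has positive dimension. -/
def WeaklyDefective (X : Set (PP K ι)) (k : ℕ) : Prop :=
  HoldsForGeneralTuples X k fun u => 0 < zdim (contactLocus X (Set.range u))

/-- The `k`-th secant variety of `X`. -/
def secant (k : ℕ) (X : Set (PP K ι)) : Set (PP K ι) :=
  zclosure {q | ∃ S : Finset (PP K ι), ↑S ⊆ X ∧ S.card = k ∧ q ∈ projSpan (S : Set (PP K ι))}

/-- The `X`-rank of a point. -/
def xrank (X : Set (PP K ι)) (q : PP K ι) : ℕ :=
  sInf {k | ∃ S : Finset (PP K ι), ↑S ⊆ X ∧ S.card = k ∧ q ∈ projSpan (S : Set (PP K ι))}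

/-- `𝒮(q,X)`: the set of minimal `X`-decompositions of `q`. -/
def decompositions (X : Set (PP K ι)) (q : PP K ι) : Set (Finset (PP K ι)) :=
  {S | ↑S ⊆ X ∧ S.card = xrank X q ∧ q ∈ projSpan (S : Set (PP K ι))}

/-- `X` is `k`-identifiable: a general point of `σ_k(X)` has a unique minimal
decomposition. -/
def Identifiable (X : Set (PP K ι)) (k : ℕ) : Prop :=
  HoldsGenerically (secant k X) fun q => ∃! S : Finset (PP K ι), S ∈ decompositions X q

/-- `α` is the `k`-th secant degree of `X`. -/
def HasSecantDegree (X : Set (PP K ι)) (k α : ℕ) : Prop :=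
  HoldsGenerically (secant k X) fun q => (decompositions X q).ncard = α

/-- Projective linear subspaces. -/
def IsProjLinear (L : Set (PP K ι)) : Prop :=
  L = projSpan L

/-- Lines in projective space. -/
def IsLine (L : Set (PP K ι)) : Prop :=
  IsProjLinear L ∧ Module.finrank K (vspan L) = 2

/-- `X` is uniruled by lines: through a general point of `X` there is a line
contained in `X`. -/
def UniruledByLines (X : Set (PP K ι)) : Prop :=
  HoldsGenerically X fun x => ∃ L : Set (PP K ι), IsLine L ∧ x ∈ L ∧ L ⊆ X

/-- The join of two sets in projective space. -/
def join (A B : Set (PP K ι)) : Set (PP K ι) :=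
  zclosure (⋃ a ∈ A, ⋃ b ∈ B, projSpan {a, b})

/-- The linear space `M` is tangent to `X` along `W`. -/
def TangentAlong (M X W : Set (PP K ι)) : Prop :=
  ∀ x ∈ W, IsSmoothPoint X x → embTangentSpace X x ⊆ M

/-- `S` has exactly `m` irreducible components, all of them projective linear
subspaces, and these components are linearly independent. -/
def ComponentsAreIndepLinear (S : Set (PP K ι)) (m : ℕ) : Prop :=
  ∃ C : Fin m → Set (PP K ι), Function.Injective C ∧
    (∀ D : Set (PP K ι), IsZIrredComponent S D ↔ ∃ i, D = C i) ∧
    (∀ i, IsProjLinear (C i)) ∧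
    Module.finrank K (vspan S) = ∑ i, Module.finrank K (vspan (C i))


/-- The Segre variety: the image of `ℙ^{n 1} × ⋯ × ℙ^{n s}` under the Segre
embedding, given by the complete linear system `|O(1,…,1)|`. -/
def segreVariety (K : Type*) [Field K] (s : ℕ) (n : Fin s → ℕ) :
    Set (PP K (∀ i : Fin s, Fin (n i + 1))) :=
  {x | ∃ u : ∀ i : Fin s, Fin (n i + 1) → K,
    x.submodule = Submodule.span K
      ({fun t => ∏ i, u i (t i)} : Set ((∀ i : Fin s, Fin (n i + 1)) → K))}

/-- The projection of `L ⊆ Segre` to the `i`-th factor is a single point, i.e. `L`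
lies in a single fiber of the `i`-th projection. -/
def SegreFactorIsPoint (K : Type*) [Field K] (s : ℕ) (n : Fin s → ℕ) (i : Fin s)
    (L : Set (PP K (∀ j : Fin s, Fin (n j + 1)))) : Prop :=
  ∃ w : Fin (n i + 1) → K, w ≠ 0 ∧ ∀ x ∈ L,
    ∃ u : ∀ j : Fin s, Fin (n j + 1) → K,
      x.submodule = Submodule.span K
        ({fun t => ∏ j, u j (t j)} : Set ((∀ j : Fin s, Fin (n j + 1)) → K)) ∧
      u i ∈ Submodule.span K ({w} : Set (Fin (n i + 1) → K))

/-- Index type for the Segre–Veronese embedding of multidegree `d`: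
multi-indices of degree `d i` in the homogeneous variables of the `i`-th factor. -/
abbrev svIndex (s : ℕ) (n d : Fin s → ℕ) : Type :=
  ∀ i : Fin s, {w : Fin (n i + 1) → Fin (d i + 1) // ∑ j, (w j : ℕ) = d i}

/-- The Segre–Veronese variety of multidegree `d`: the image of
`ℙ^{n 1} × ⋯ × ℙ^{n s}` under the embedding by `|L_1^{d 1} ⊗ ⋯ ⊗ L_s^{d s}|`. -/
def segreVeroneseVariety (K : Type*) [Field K] (s : ℕ) (n d : Fin s → ℕ) :
    Set (PP K (svIndex s n d)) :=
  {x | ∃ u : ∀ i : Fin s, Fin (n i + 1) → K,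
    x.submodule = Submodule.span K
      ({fun t => ∏ i, ∏ j, u i j ^ ((t i).1 j : ℕ)} : Set (svIndex s n d → K))}

/-- The vector of the moments of degree `≤ d` of the one-dimensional Gaussian
distribution with mean `μ` and variance `t`. -/
def gaussMomentVec (K : Type*) [Field K] (d : ℕ) (μ t : K) : Fin (d + 1) → K := fun i =>
  ∑ j ∈ Finset.range ((i : ℕ) / 2 + 1),
    ((Nat.choose (i : ℕ) (2 * j) * Nat.doubleFactorial (2 * j - 1) : ℕ) : K) *
      t ^ j * μ ^ ((i : ℕ) - 2 * j)

/-- The Gaussian moment variety `𝒢_{1,d} ⊆ ℙ^d`. -/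
def gaussianMomentVariety (K : Type*) [Field K] (d : ℕ) : Set (PP K (Fin (d + 1))) :=
  zclosure {x | ∃ μ t : K,
    x.submodule = Submodule.span K ({gaussMomentVec K d μ t} : Set (Fin (d + 1) → K))}

/-- Zariski-closed families of `m`-tuples of coefficient vectors of linear forms. -/
def IsAffineClosedFamily {m : ℕ} (T : Set (Fin m → ι → K)) : Prop :=
  ∃ S : Set (MvPolynomial (Fin m × ι) K),
    T = {h | ∀ f ∈ S, MvPolynomial.eval (fun p => h p.1 p.2) f = 0}

/-- The linear subspace cut out by the `m` linear forms with coefficient vectors `h`. -/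
def linearSlice {m : ℕ} (h : Fin m → ι → K) : Set (PP K ι) :=
  {x | ∀ j : Fin m, ∑ i : ι, h j i * x.rep i = 0}

/-- `x` lies on the hyperplane with coefficient vector `f`. -/
def inHyperplane (f : ι → K) (x : PP K ι) : Prop :=
  ∑ i : ι, f i * x.rep i = 0

/-- `X ⊆ ℙ^r` (of dimension `n`, `r + 1 = card ι`) is very strange: for a general
codimension-`n` linear subspace `M`, some `r - n + 2` points of `X ∩ M` lie in a
hyperplane of `M`, i.e. in a linear subspace of projective dimension `r - n - 1`. -/
def VeryStrange (n : ℕ) (X : Set (PP K ι)) : Prop :=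
  ∃ T : Set (Fin n → ι → K), IsAffineClosedFamily T ∧ (∃ h, h ∉ T) ∧
    ∀ h : Fin n → ι → K, h ∉ T →
      ∃ A : Finset (PP K ι), ↑A ⊆ X ∩ linearSlice h ∧
        A.card = Fintype.card ι + 1 - n ∧
        Module.finrank K (vspan (A : Set (PP K ι))) ≤ Fintype.card ι - 1 - n


namespace SVP


theorem ker_nilp {R S : Type*} [CommRing R] [CommRing S] (f : R →+* S)
    (h : ∀ a b, f a = 0 → f b = 0 → a * b = 0) : IsNilpotent (RingHom.ker f) := by
  refine ⟨2, ?_⟩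
  rw [pow_two, Ideal.zero_eq_bot, eq_bot_iff, Ideal.mul_le]
  intro a ha b hb
  exact h a b ha hb

theorem der_of_etale {K A L : Type*} [Field K] [Field L] [CommRing A] [Algebra K A] [Algebra K L]
    [Algebra A L] [IsScalarTower K A L] [Algebra.FormallyEtale A L] 
    (g : A →ₐ[K] TrivSqZeroExt L L) (hg : ∀ p, (g p).fst = algebraMap A L p) :
    ∃ δ : Derivation K L L, ∀ p : A, δ (algebraMap A L p) = (g p).snd := by
  let _ : Algebra A (TrivSqZeroExt L L) := g.toRingHom.toAlgebra
  have hgB : ∀ p : A, algebraMap A (TrivSqZeroExt L L) p = g p := fun p => rfl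
  let πA : TrivSqZeroExt L L →ₐ[A] L :=
    { TrivSqZeroExt.fstHom K L L with commutes' := fun p => hg p }
  have hπA : ∀ x, πA x = x.fst := fun x => rfl
  have hsurj : Function.Surjective πA := fun x => ⟨TrivSqZeroExt.inl x, rfl⟩
  have hnil : IsNilpotent (RingHom.ker (πA : TrivSqZeroExt L L →+* L)) := by
    refine ker_nilp (πA : TrivSqZeroExt L L →+* L) (fun a b ha hb => ?_)
    have ha' : a.fst = 0 := ha
    have hb' : b.fst = 0 := hb
    refine TrivSqZeroExt.ext ?_ ?_
    · rw [TrivSqZeroExt.fst_mul, ha', zero_mul, TrivSqZeroExt.fst_zero]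
    · rw [TrivSqZeroExt.snd_mul, ha', hb', zero_smul, MulOpposite.op_zero, zero_smul, add_zero, TrivSqZeroExt.snd_zero]
  let ℓ : L →ₐ[A] TrivSqZeroExt L L :=
    Algebra.FormallySmooth.liftOfSurjective (AlgHom.id A L) πA hsurj hnil
  have hℓ : ∀ x, (ℓ x).fst = x := fun x =>
    Algebra.FormallySmooth.liftOfSurjective_apply (AlgHom.id A L) πA hsurj hnil x
  have hℓA : ∀ p, ℓ (algebraMap A L p) = g p := fun p => by rw [AlgHom.commutes, hgB]
  have hℓK : ∀ r : K, ℓ (algebraMap K L r) = algebraMap K _ r := fun p => by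
    rw [IsScalarTower.algebraMap_apply K A L, hℓA, AlgHom.commutes]
  let δ : L →ₗ[K] L :=
    { toFun := fun x => (ℓ x).snd
      map_add' := fun x y => by rw [map_add, TrivSqZeroExt.snd_add]
      map_smul' := fun r x => by
        rw [Algebra.smul_def, map_mul, hℓK, ← Algebra.smul_def, TrivSqZeroExt.snd_smul]; rfl }
  refine ⟨Derivation.mk' δ (fun a b => ?_), fun p => ?_⟩
  · change (ℓ (a * b)).snd = a • (ℓ b).snd + b • (ℓ a).snd
    rw [map_mul, TrivSqZeroExt.snd_mul, hℓ, hℓ]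
    rw [op_smul_eq_smul]
  · change (ℓ (algebraMap A L p)).snd = _
    rw [hℓA]

open MvPolynomial in
theorem exists_der {K L κ : Type*} [Field K] [Field L] [Algebra K L] [CharZero K]
    (v : κ → L) (hv : AlgebraicIndependent K v) (c : κ → L) :
    ∃ δ : Derivation K L L, ∀ i, δ (v i) = c i := by
  classical
  obtain ⟨s, hs, hB⟩ := exists_isTranscendenceBasis_superset (R := K) (A := L)
    (s := Set.range v) ((algebraicIndependent_subtype_range hv.injective).2 hv)
  have hc : ∃ c' : s → L, ∀ i, c' ⟨v i, hs ⟨i, rfl⟩⟩ = c i := by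
    refine ⟨fun x => if h : ∃ i, v i = x then c h.choose else 0, fun i => ?_⟩
    have h : ∃ i', v i' = v i := ⟨i, rfl⟩
    simp only [h, dif_pos]
    congr 1
    exact hv.injective h.choose_spec
  obtain ⟨c', hc'⟩ := hc
  let f : MvPolynomial s K →ₐ[K] L := aeval (fun x : s => (x : L))
  have hf : Function.Injective f := hB.1
  let _ : Algebra (MvPolynomial s K) L := f.toRingHom.toAlgebra
  have halg : ∀ p : MvPolynomial s K, algebraMap (MvPolynomial s K) L p = f p := fun p => rfl
  have : IsScalarTower K (MvPolynomial s K) L := IsScalarTower.of_algebraMap_eq (fun r => by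
    rw [halg]; simp [f])
  have : FaithfulSMul (MvPolynomial s K) L :=
    (faithfulSMul_iff_algebraMap_injective (MvPolynomial s K) L).2 hf
  let _ : Algebra (FractionRing (MvPolynomial s K)) L :=
    FractionRing.liftAlgebra (MvPolynomial s K) L
  have : Algebra.IsAlgebraic (MvPolynomial s K) L := by
    have h1 := hB.isAlgebraic
    constructor
    intro a
    obtain ⟨p, hp0, hp⟩ := h1.1 a
    let e := hB.1.aevalEquiv
    refine ⟨p.map e.symm.toRingEquiv.toRingHom, ?_, ?_⟩
    · exact (Polynomial.map_ne_zero_iff e.symm.injective).2 hp0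
    · rw [Polynomial.aeval_def, Polynomial.eval₂_map]
      rw [Polynomial.aeval_def] at hp
      rw [← hp]
      congr 1
      ext x
      obtain ⟨y, rfl⟩ := e.surjective x
      have : ((e y : Algebra.adjoin K (Set.range ((↑) : s → L))) : L) = f y := by
        simp [e, f]
      simp only [RingHom.comp_apply]
      change f (e.symm (e y)) = ((e y : Algebra.adjoin K (Set.range ((↑) : s → L))) : L)
      rw [e.symm_apply_apply, this]
  have : Algebra.IsAlgebraic (FractionRing (MvPolynomial s K)) L :=
    (IsFractionRing.comap_isAlgebraic_iff (A := MvPolynomial s K)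
      (K := FractionRing (MvPolynomial s K)) (C := L)).1 inferInstance
  have : CharZero (FractionRing (MvPolynomial s K)) := 
    charZero_of_injective_algebraMap (R := K)
      (algebraMap K (FractionRing (MvPolynomial s K))).injective
  have : Algebra.FormallyEtale (FractionRing (MvPolynomial s K)) L :=
    Algebra.FormallyEtale.of_isSeparable _ _
  have : Algebra.FormallyEtale (MvPolynomial s K) (FractionRing (MvPolynomial s K)) :=
    Algebra.FormallyEtale.of_isLocalization (nonZeroDivisors (MvPolynomial s K))
  have : Algebra.FormallyEtale (MvPolynomial s K) L :=
    Algebra.FormallyEtale.comp (MvPolynomial s K) (FractionRing (MvPolynomial s K)) L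
  let g : MvPolynomial s K →ₐ[K] TrivSqZeroExt L L :=
    aeval (fun x : s => TrivSqZeroExt.inl (x : L) + TrivSqZeroExt.inr (c' x))
  have hgX : ∀ x, g (X x) = TrivSqZeroExt.inl (x : L) + TrivSqZeroExt.inr (c' x) := fun x =>
    aeval_X _ _
  have hg : ∀ p, (g p).fst = algebraMap (MvPolynomial s K) L p := by
    intro p
    have : (TrivSqZeroExt.fstHom K L L).comp g = f := by
      apply MvPolynomial.algHom_ext
      intro i
      rw [AlgHom.comp_apply, hgX]
      rw [show f (X i) = i from aeval_X _ _]
      rw [TrivSqZeroExt.fstHom_apply, TrivSqZeroExt.fst_add, TrivSqZeroExt.fst_inl,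
        TrivSqZeroExt.fst_inr, add_zero]
    exact DFunLike.congr_fun this p
  obtain ⟨δ, hδ⟩ := der_of_etale g hg
  refine ⟨δ, fun i => ?_⟩
  have h1 := hδ (X ⟨v i, hs ⟨i, rfl⟩⟩)
  rw [hgX, halg, show f (X _) = _ from aeval_X _ _] at h1
  rw [TrivSqZeroExt.snd_add, TrivSqZeroExt.snd_inl, TrivSqZeroExt.snd_inr, zero_add, hc'] at h1
  exact h1


open MvPolynomial in
theorem der_aeval {K F κ : Type*} [CommRing K] [CommRing F] [Algebra K F] [Fintype κ]
    (q : κ → F) (δ : Derivation K F F) (G : MvPolynomial κ K) :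
    δ (aeval q G) = ∑ a, aeval q (pderiv a G) * δ (q a) := by
  classical
  induction G using MvPolynomial.induction_on with
  | C a => simp
  | add p q hp hq => simp [hp, hq, add_mul, Finset.sum_add_distrib]
  | mul_X p i hp =>
    simp only [map_mul, Derivation.leibniz, aeval_X, hp, smul_eq_mul, map_add, pderiv_X, add_mul,
      Finset.sum_add_distrib]
    congr 1
    · rw [Finset.sum_eq_single i] <;> simp +contextual [Pi.single_apply]
    · simp [Finset.mul_sum, mul_assoc]

open MvPolynomial in
theorem algInd_of_der {K F κ : Type*} [Field K] [CommRing F] [Nontrivial F] [Algebra K F]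
    [CharZero K] [Fintype κ]
    [DecidableEq κ] (q : κ → F) (δ : κ → Derivation K F F)
    (h : ∀ p r, δ p (q r) = if p = r then 1 else 0) : AlgebraicIndependent K q := by
  rw [algebraicIndependent_iff]
  have key : ∀ n : ℕ, ∀ G : MvPolynomial κ K, (∀ m, coeff m G ≠ 0 → m.degree ≤ n) →
      aeval q G = 0 → G = 0 := by
    intro n
    induction n with
    | zero =>
      intro G hG h0
      have : G = C (coeff 0 G) := by
        ext m
        rw [coeff_C]
        split_ifs with hm
        · rw [← hm]
        · by_contra hne
          have := hG m hne
          rw [Nat.le_zero, Finsupp.degree_eq_zero_iff] at this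
          exact hm this.symm
      rw [this] at h0 ⊢
      rw [aeval_C] at h0
      rw [(map_eq_zero_iff _ (algebraMap K F).injective).1 h0, C_0]
    | succ n ih =>
      intro G hG h0
      have h1 : ∀ p, pderiv p G = 0 := by
        intro p
        apply ih
        · intro m hm
          rw [coeff_pderiv] at hm
          have := hG _ (left_ne_zero_of_mul hm)
          rw [map_add] at this
          simpa using this
        · have h2 := der_aeval q (δ p) G
          rw [h0, map_zero] at h2
          simpa [h] using h2.symm
      apply ih G _ h0
      intro m hm
      by_cases hm0 : m = 0
      · simp [hm0]
      obtain ⟨p, hp⟩ := Finsupp.ne_iff.1 hm0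
      exfalso
      have h3 := congrArg (coeff (m - Finsupp.single p 1)) (h1 p)
      rw [coeff_pderiv, tsub_add_cancel_of_le (by
        rw [Finsupp.single_le_iff]; simp at hp; omega)] at h3
      rw [coeff_zero, mul_eq_zero] at h3
      rcases h3 with h3 | h3
      · exact hm h3
      · exact Nat.cast_add_one_ne_zero _ h3
  intro G hG
  exact key G.totalDegree G (fun m hm => by
    have := le_totalDegree (mem_support_iff.2 hm)
    rw [Finsupp.degree_apply]; exact this) hG

open MvPolynomial in
theorem chain_indep {K B : Type*} [Field K] [CommRing B] [Algebra K B] (p : ℕ → Ideal B) (R : ℕ)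
    (hp : ∀ i ≤ R, (p i).IsPrime) (hlt : ∀ i < R, p (i + 1) < p i) :
    ∃ f : Fin R → B, ∀ G : MvPolynomial (Fin R) K, aeval f G ∈ p R → G = 0 := by
  induction R with
  | zero =>
    refine ⟨Fin.elim0, fun G hG => ?_⟩
    obtain ⟨c, rfl⟩ := C_surjective (Fin 0) G
    rw [aeval_C] at hG
    by_contra hc
    have hc' : c ≠ 0 := fun h => hc (by simp [h])
    refine (hp 0 le_rfl).ne_top (Ideal.eq_top_of_isUnit_mem _ hG ?_)
    exact (IsUnit.mk0 c hc').map _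
  | succ R ih =>
    obtain ⟨f, hf⟩ := ih (fun i hi => hp i (by omega)) (fun i hi => hlt i (by omega))
    obtain ⟨g, hg, hg'⟩ := Set.exists_of_ssubset (hlt R (by omega))
    have hP := hp (R + 1) le_rfl
    refine ⟨Fin.cons g f, ?_⟩
    have key : ∀ n : ℕ, ∀ Q : Polynomial (MvPolynomial (Fin R) K), Q.natDegree ≤ n →
        Polynomial.eval₂ (aeval f : MvPolynomial (Fin R) K →ₐ[K] B).toRingHom g Q ∈ p (R + 1) →
          Q = 0 := by
      have h0 : ∀ Q : Polynomial (MvPolynomial (Fin R) K), 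
        Polynomial.eval₂ (aeval f : MvPolynomial (Fin R) K →ₐ[K] B).toRingHom g Q ∈ p (R + 1) →
          Q.coeff 0 = 0 := by
        intro Q hQ
        apply hf
        have h1 := (hlt R (by omega)).le hQ
        rw [← Polynomial.divX_mul_X_add Q, Polynomial.eval₂_add, Polynomial.eval₂_mul,
          Polynomial.eval₂_X, Polynomial.eval₂_C] at h1
        exact (Ideal.add_mem_iff_right _ (Ideal.mul_mem_left _ _ hg)).1 h1
      intro n
      induction n with
      | zero =>
        intro Q hn hQ
        rw [Polynomial.eq_C_of_natDegree_le_zero hn, h0 Q hQ, Polynomial.C_0]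
      | succ n ih2 =>
        intro Q hn hQ
        have h1 := h0 Q hQ
        have h2 : Q = Q.divX * Polynomial.X := by
          conv_lhs => rw [← Polynomial.divX_mul_X_add Q, h1, Polynomial.C_0, add_zero]
        rw [h2, Polynomial.eval₂_mul, Polynomial.eval₂_X] at hQ
        have h3 := ih2 Q.divX (by rw [Polynomial.natDegree_divX_eq_natDegree_tsub_one]; omega)
          ((hP.mem_or_mem hQ).resolve_right hg')
        rw [h2, h3, zero_mul]
    intro G hG
    have h1 : aeval (Fin.cons g f : Fin (R + 1) → B) G = Polynomial.eval₂
        (aeval f : MvPolynomial (Fin R) K →ₐ[K] B).toRingHom g (finSuccEquiv K R G) := by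
      have h2 : (aeval (Fin.cons g f : Fin (R + 1) → B)).toRingHom = (Polynomial.eval₂RingHom
        (aeval f : MvPolynomial (Fin R) K →ₐ[K] B).toRingHom g).comp
          (finSuccEquiv K R).toRingEquiv.toRingHom := by
        apply MvPolynomial.ringHom_ext
        · intro r
          simp [finSuccEquiv_apply]
        · intro i
          refine Fin.cases ?_ (fun i => ?_) i <;> simp [finSuccEquiv_apply]
      exact DFunLike.congr_fun h2 G
    rw [h1] at hG
    have := key _ _ le_rfl hG
    simpa using this

theorem exists_minor {F κ ι : Type*} [Field F] [Fintype κ] [DecidableEq κ] 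
    (w : κ → ι → F) (hw : LinearIndependent F w) :
    ∃ f : κ → ι, (Matrix.of fun k k' => w k (f k')).det ≠ 0 := by
  obtain ⟨κ', a, ha, hspan, hli⟩ := exists_linearIndependent' F (fun (a : ι) (k : κ) => w k a)
  have htop : Submodule.span F (Set.range (fun (a : ι) (k : κ) => w k a)) = ⊤ := by
    by_contra hne
    obtain ⟨φ, hφ, hle⟩ := Submodule.exists_le_ker_of_lt_top _ (lt_top_iff_ne_top.2 hne)
    apply hφ
    rw [Fintype.linearIndependent_iff] at hw
    have h1 : ∀ a, φ (fun k => w k a) = 0 := fun a => hle (Submodule.subset_span ⟨a, rfl⟩)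
    have h2 := hw (fun k => φ (Pi.single k 1)) (by
      ext a
      rw [Pi.zero_apply, ← h1 a, LinearMap.pi_apply_eq_sum_univ φ, Finset.sum_apply]
      refine Finset.sum_congr rfl (fun k _ => ?_)
      rw [Pi.smul_apply, smul_eq_mul, smul_eq_mul, mul_comm]
      congr 2
      ext k'
      simp [Pi.single_apply, eq_comm])
    apply LinearMap.pi_ext'
    intro k
    ext
    simpa using h2 k
  rw [htop] at hspan
  let b := Module.Basis.mk hli hspan.ge
  let e : κ ≃ κ' := (Pi.basisFun F κ).indexEquiv b
  refine ⟨a ∘ e, ?_⟩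
  have h := hli.comp e e.injective
  have := Matrix.linearIndependent_cols_iff_isUnit
    (A := Matrix.of fun k k' => w k ((a ∘ e) k'))
  rw [← isUnit_iff_ne_zero, ← Matrix.isUnit_iff_isUnit_det]
  exact this.1 h

theorem li_of_minor {F κ ι : Type*} [Field F] [Fintype κ] [DecidableEq κ] 
    (w : κ → ι → F) (f : κ → ι) (hf : (Matrix.of fun k k' => w k (f k')).det ≠ 0) :
    LinearIndependent F w := by
  rw [← isUnit_iff_ne_zero, ← Matrix.isUnit_iff_isUnit_det,
    ← Matrix.linearIndependent_rows_iff_isUnit] at hf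
  exact LinearIndependent.of_comp (LinearMap.funLeft F F f) hf



/-- combinatorial data of a toric parametrization -/
structure TD (σ τ I : Type) [Fintype σ] [Fintype τ] [DecidableEq τ] where
  E : I → σ → ℕ
  ρ : τ → σ
  Z : σ → Option τ → ℤ
  hZ : ∀ a s, (E a s : ℤ) = Z s none + ∑ p, Z s (some p) * E a (ρ p)
  e0 : I
  e : τ → I
  he0 : ∀ p, E e0 (ρ p) = 0
  he : ∀ p r, E (e p) (ρ r) = if p = r then 1 else 0
  emix : ∀ p, ∃ p' a, p ≠ p' ∧
    ∀ r, E a (ρ r) = (if p = r then 1 else 0) + (if p' = r then 1 else 0)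
  ind : ∀ a, a = e0 ∨ ∃ p a', ∀ s, E a s + E e0 s = E a' s + E (e p) s
  W : σ → ℕ
  D : ℕ
  hD : 0 < D
  hW : ∀ a, ∑ s, W s * E a s = D
  enz : ∀ s, ∃ a, E a s ≠ 0
  inj : Function.Injective E

section toric
variable {σ τ I : Type} [Fintype σ] [Fintype τ] [DecidableEq τ]
  (T : TD σ τ I)

def TD.b : Option τ → I → ℕ
  | none, _ => 1
  | some p, a => T.E a (T.ρ p)

def TD.xm {A : Type*} [CommRing A] (u : σ → A) (a : I) : A := ∏ s, u s ^ T.E a s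

def TD.lam {F : Type*} [CommRing F] (c : Option τ → F) (a : I) : F :=
  ∑ g, c g * (T.b g a : F)

variable {F : Type*} [CommRing F]

theorem TD.lam_eq (c : Option τ → F) (a : I) :
    T.lam c a = c none + ∑ p, c (some p) * (T.E a (T.ρ p) : F) := by
  simp [TD.lam, Fintype.sum_option, TD.b]

theorem TD.lam_e0 (c : Option τ → F) : T.lam c T.e0 = c none := by
  simp [TD.lam_eq, T.he0]

theorem TD.lam_e (c : Option τ → F) (p : τ) : T.lam c (T.e p) = c none + c (some p) := by
  simp [TD.lam_eq, T.he]

theorem TD.lam_add (c c' : Option τ → F) (a : I) :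
    T.lam (c + c') a = T.lam c a + T.lam c' a := by
  simp [TD.lam, add_mul, Finset.sum_add_distrib]

theorem TD.lam_smul (r : F) (c : Option τ → F) (a : I) :
    T.lam (r • c) a = r * T.lam c a := by
  simp only [TD.lam, Finset.mul_sum, mul_assoc, Pi.smul_apply, smul_eq_mul]

theorem TD.lam_sub (c c' : Option τ → F) (a : I) :
    T.lam (c - c') a = T.lam c a - T.lam c' a := by
  simp [TD.lam, sub_mul, Finset.sum_sub_distrib]

theorem TD.lam_zero (a : I) : T.lam (0 : Option τ → F) a = 0 := by
  simp [TD.lam]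

theorem TD.lam_single (g : Option τ) (a : I) :
    T.lam (Pi.single g (1 : F)) a = T.b g a := by
  classical
  simp [TD.lam, Pi.single_apply]

theorem TD.lam_inj {c : Option τ → F} (h : ∀ a, T.lam c a = 0) : c = 0 := by
  have h0 := h T.e0
  rw [T.lam_e0] at h0
  ext (_ | p)
  · exact h0
  · have := h (T.e p)
    rw [T.lam_e, h0, zero_add] at this
    exact this

theorem TD.exists_lam (g : σ → F) : ∃ c, ∀ a, T.lam c a = ∑ s, (T.E a s : F) * g s := by
  refine ⟨fun r => ∑ s, (T.Z s r : F) * g s, fun a => ?_⟩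
  have h : ∀ s, (T.E a s : F) = T.Z s none + ∑ p, (T.Z s (some p) : F) * (T.E a (T.ρ p) : F) := by
    intro s
    have := congrArg (Int.cast : ℤ → F) (T.hZ a s)
    push_cast at this
    exact this
  have h2 : ∑ s, (T.E a s : F) * g s = ∑ s, (T.Z s none + ∑ p, (T.Z s (some p) : F) *
    (T.E a (T.ρ p) : F)) * g s := Finset.sum_congr rfl (fun s _ => congrArg (· * g s) (h s))
  rw [TD.lam_eq, h2]
  simp only [add_mul, Finset.sum_add_distrib]
  congr 1
  simp only [Finset.sum_mul]
  rw [Finset.sum_comm]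
  refine Finset.sum_congr rfl fun s _ => Finset.sum_congr rfl fun p _ => by ring

theorem der_pow_dlog {K F : Type*} [CommRing K] [Field F] [Algebra K F] (δ : Derivation K F F)
    (u : F) (n : ℕ) : δ (u ^ n) = u ^ n * (n * (δ u / u)) := by
  rcases eq_or_ne u 0 with rfl | hu
  · rcases Nat.eq_zero_or_pos n with rfl | hn
    · simp
    · simp [hn.ne']
  · rw [Derivation.leibniz_pow]
    rcases n with _ | n
    · simp
    · simp only [Nat.add_sub_cancel, smul_eq_mul, nsmul_eq_mul]
      field_simp
      ring

theorem der_prod_dlog {K F ι : Type*} [CommRing K] [Field F] [Algebra K F] (δ : Derivation K F F)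
    (S : Finset ι) (f g : ι → F) (h : ∀ i, δ (f i) = f i * g i) :
    δ (∏ i ∈ S, f i) = (∏ i ∈ S, f i) * ∑ i ∈ S, g i := by
  classical
  induction S using Finset.induction_on with
  | empty => simp
  | insert a S ha ih =>
    rw [Finset.prod_insert ha, Finset.sum_insert ha, Derivation.leibniz, ih, h]
    simp only [smul_eq_mul]; ring

theorem TD.der_xm_eq {K F : Type*} [CommRing K] [Field F] [Algebra K F] (δ : Derivation K F F)
    (u : σ → F) (a : I) :
    δ (T.xm u a) = T.xm u a * ∑ s, (T.E a s : F) * (δ (u s) / u s) :=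
  der_prod_dlog δ _ _ _ (fun _ => der_pow_dlog δ _ _)

theorem TD.der_xm {K F : Type*} [CommRing K] [Field F] [Algebra K F] (δ : Derivation K F F)
    (u : σ → F) : ∃ c, ∀ a, δ (T.xm u a) = T.xm u a * T.lam c a := by
  obtain ⟨c, hc⟩ := T.exists_lam (fun s => δ (u s) / u s)
  exact ⟨c, fun a => by rw [hc, T.der_xm_eq]⟩

theorem TD.der_lam {K : Type*} [CommRing K] [Algebra K F] (δ : Derivation K F F)
    (c : Option τ → F) (a : I) : δ (T.lam c a) = T.lam (fun g => δ (c g)) a := by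
  simp [TD.lam, mul_comm]

/-- the stabilizer of the affine functions is the constants -/
theorem TD.const_of_stab {v : Option τ → F}
    (h : ∀ g, ∃ c, ∀ a, T.lam v a * T.b g a = T.lam c a) (p : τ) : v (some p) = 0 := by
  obtain ⟨p', a, hne, ha⟩ := T.emix p
  obtain ⟨c, hc⟩ := h (some p')
  have h1 := hc T.e0
  have h2 := hc (T.e p)
  have h3 := hc (T.e p')
  have h4 := hc a
  have l4 : ∀ c : Option τ → F, T.lam c a = c none + c (some p) + c (some p') := by
    intro c
    simp [TD.lam_eq, ha, mul_add, Finset.sum_add_distrib, add_assoc]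
  rw [l4, l4] at h4
  rw [T.lam_e0, T.lam_e0] at h1
  rw [T.lam_e, T.lam_e] at h2 h3
  simp only [TD.b, T.he0, T.he, ha, if_neg hne, if_neg hne.symm, if_true] at h1 h2 h3 h4
  push_cast at h1 h2 h3 h4
  linear_combination h4 + h1 - h2 - h3

variable {ι : Type} [Fintype ι]

/-- the parametrization of the sum of tangent spaces -/
def TD.mu {F : Type*} [CommRing F] (x : ι → I → F) : (ι → Option τ → F) →ₗ[F] (I → F) where
  toFun c a := ∑ l, x l a * T.lam (c l) a
  map_add' c c' := by ext a; simp [T.lam_add, mul_add, Finset.sum_add_distrib]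
  map_smul' r c := by
    ext a
    simp only [Pi.smul_apply, T.lam_smul, RingHom.id_apply, smul_eq_mul, Finset.mul_sum]
    exact Finset.sum_congr rfl (fun _ _ => by ring)

theorem TD.mu_apply (x : ι → I → F) (c : ι → Option τ → F) (a : I) :
    T.mu x c a = ∑ l, x l a * T.lam (c l) a := rfl

/-- directness -/
def TD.LI (x : ι → I → F) : Prop := Function.Injective (T.mu x)

theorem TD.LI.eq_zero {T : TD σ τ I} {x : ι → I → F} (h : T.LI x) {c : ι → Option τ → F}
    (hc : ∀ a, ∑ l, x l a * T.lam (c l) a = 0) : c = 0 := 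
  h (by rw [map_zero]; ext a; exact hc a)

/-- the sum of tangent spaces -/
def TD.M (x : ι → I → F) : Submodule F (I → F) := LinearMap.range (T.mu x)

theorem TD.mem_M (x : ι → I → F) (y : I → F) :
    y ∈ T.M x ↔ ∃ c : ι → Option τ → F, ∀ a, y a = ∑ l, x l a * T.lam (c l) a := by
  constructor
  · rintro ⟨c, rfl⟩; exact ⟨c, fun a => rfl⟩
  · rintro ⟨c, hc⟩; exact ⟨c, by ext a; rw [hc]; rfl⟩

theorem TD.mul_lam_mem_M [DecidableEq ι] (x : ι → I → F) (l : ι) (c : Option τ → F) :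
    (fun a => x l a * T.lam c a) ∈ T.M x := by
  rw [T.mem_M]
  refine ⟨Pi.single l c, fun a => ?_⟩
  rw [Finset.sum_eq_single l]
  · simp
  · intro b _ hb; simp [hb, T.lam_zero]
  · simp

/-- no tangency direction -/
def TD.NT (x : ι → I → F) (l0 : ι) : Prop :=
  ∀ v : Option τ → F, (∀ g, (fun a => x l0 a * T.lam v a * T.b g a) ∈ T.M x) →
    ∀ p, v (some p) = 0

end toric


section generic
variable {σ τ I : Type} [Fintype σ] [Fintype τ] [DecidableEq τ]
  (T : TD σ τ I) {ι : Type} [Fintype ι] [DecidableEq ι]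
  {F : Type*} [Field F]

def TD.DS (x : ι → I → F) (l0 : ι) (S : Finset ι) : Submodule F (Option τ → F) where
  carrier := {v | ∀ g, ∃ c : ι → Option τ → F, (∀ l ∉ S, c l = 0) ∧
    ∀ a, x l0 a * T.lam v a * T.b g a = ∑ l, x l a * T.lam (c l) a}
  zero_mem' g := ⟨0, fun _ _ => rfl, fun a => by simp [T.lam_zero]⟩
  add_mem' := by
    intro v w hv hw g
    obtain ⟨c, hc, h⟩ := hv g
    obtain ⟨c', hc', h'⟩ := hw g
    refine ⟨c + c', fun l hl => by simp [hc l hl, hc' l hl], fun a => ?_⟩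
    simp only [Pi.add_apply, T.lam_add, mul_add, add_mul, Finset.sum_add_distrib, h, h']
  smul_mem' := by
    intro r v hv g
    obtain ⟨c, hc, h⟩ := hv g
    refine ⟨r • c, fun l hl => by simp [hc l hl], fun a => ?_⟩
    simp only [Pi.smul_apply, T.lam_smul]
    rw [show x l0 a * (r * T.lam v a) * T.b g a = r * (x l0 a * T.lam v a * T.b g a) by ring, h,
      Finset.mul_sum]
    exact Finset.sum_congr rfl (fun _ _ => by ring)

theorem TD.mem_DS {x : ι → I → F} {l0 : ι} {S : Finset ι} {v : Option τ → F} :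
    v ∈ T.DS x l0 S ↔ ∀ g, ∃ c : ι → Option τ → F, (∀ l ∉ S, c l = 0) ∧
    ∀ a, x l0 a * T.lam v a * T.b g a = ∑ l, x l a * T.lam (c l) a := Iff.rfl

theorem TD.DS_mono {x : ι → I → F} {l0 : ι} {S S' : Finset ι} (h : S ⊆ S') :
    T.DS x l0 S ≤ T.DS x l0 S' := by
  intro v hv g
  obtain ⟨c, hc, h'⟩ := hv g
  exact ⟨c, fun l hl => hc l (fun h'' => hl (h h'')), h'⟩

theorem TD.DS_single {x : ι → I → F} {l0 : ι} (hx : ∀ a, x l0 a ≠ 0) {v : Option τ → F} 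
    (hv : v ∈ T.DS x l0 {l0}) (p : τ) : v (some p) = 0 := by
  refine T.const_of_stab (fun g => ?_) p
  obtain ⟨c, hc, h⟩ := hv g
  refine ⟨c l0, fun a => ?_⟩
  have := h a
  rw [Finset.sum_eq_single l0 (fun b _ hb => by
    rw [hc b (by simpa using hb), T.lam_zero, mul_zero]) (by simp), mul_assoc] at this
  exact mul_left_cancel₀ (hx a) this

theorem TD.const_mem_DS {x : ι → I → F} {l0 : ι} {S : Finset ι} (hl : l0 ∈ S) {v : Option τ → F}
    (hv : ∀ p, v (some p) = 0) : v ∈ T.DS x l0 S := by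
  intro g
  refine ⟨Pi.single l0 (v none • Pi.single g 1), fun l hl' => ?_, fun a => ?_⟩
  · rw [Pi.single_eq_of_ne]; rintro rfl; exact hl' hl
  · rw [Finset.sum_eq_single l0 (fun b _ hb => by
      rw [Pi.single_eq_of_ne hb, T.lam_zero, mul_zero]) (by simp), Pi.single_eq_same, T.lam_smul,
      T.lam_single, T.lam_eq]
    simp [hv, mul_assoc]

theorem finrank_const_le (V : Submodule F (Option τ → F)) (h : ∀ v ∈ V, ∀ p, v (some p) = 0) :
    Module.finrank F V ≤ 1 := by
  have : V ≤ Submodule.span F {(Pi.single none 1 : Option τ → F)} := by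
    intro v hv
    rw [Submodule.mem_span_singleton]
    refine ⟨v none, ?_⟩
    ext (_ | p)
    · simp
    · simp [h v hv]
  refine (Submodule.finrank_mono this).trans ?_
  exact (finrank_span_le_card _).trans (by simp)

theorem TD.dim_DS {x : ι → I → F} (hLI : T.LI x) {l0 : ι} (hx : ∀ a, x l0 a ≠ 0) (j : ℕ)
    (hj : 1 ≤ j)
    (h : ∀ S, l0 ∈ S → S.card = j → ¬ (∀ v ∈ T.DS x l0 S, ∀ p, v (some p) = 0)) :
    ∀ n S, l0 ∈ S → S.card = j + n → n + 2 ≤ Module.finrank F (T.DS x l0 S) := by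
  intro n
  induction n with
  | zero =>
    intro S hl hS
    have h1 := h S hl hS
    push Not at h1
    obtain ⟨v, hv, p, hp⟩ := h1
    have hlt : Submodule.span F {(Pi.single none 1 : Option τ → F)} < T.DS x l0 S := by
      refine lt_of_le_of_ne ?_ ?_
      · rw [Submodule.span_singleton_le_iff_mem]
        exact T.const_mem_DS hl (fun p => by simp)
      · intro heq
        rw [← heq, Submodule.mem_span_singleton] at hv
        obtain ⟨r, rfl⟩ := hv
        simp at hp
    have := Submodule.finrank_lt_finrank_of_lt hlt
    rw [finrank_span_singleton (by
      intro h0; have := congrFun h0 none; simp at this)] at this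
    omega
  | succ n ih =>
    intro S hl hS
    by_cases hb : ∃ b ∈ S, b ≠ l0 ∧ T.DS x l0 (S.erase b) ≠ T.DS x l0 S
    · obtain ⟨b, hbS, hbl, hne⟩ := hb
      have h1 := ih (S.erase b) (Finset.mem_erase.2 ⟨hbl.symm, hl⟩) (by
        rw [Finset.card_erase_of_mem hbS]; omega)
      have := Submodule.finrank_lt_finrank_of_lt
        (lt_of_le_of_ne (T.DS_mono (Finset.erase_subset b S)) hne)
      omega
    · exfalso
      push Not at hb
      have h2 : ∀ v ∈ T.DS x l0 S, ∀ p, v (some p) = 0 := by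
        intro v hv
        apply T.DS_single hx
        intro g
        obtain ⟨c, hc, hc'⟩ := hv g
        refine ⟨c, fun l hll => ?_, hc'⟩
        by_cases hlS : l ∈ S
        · have hv' := hv
          rw [← hb l hlS (by simpa using hll)] at hv'
          obtain ⟨c2, hc2, hc2'⟩ := hv' g
          have : c = c2 := hLI (by ext a; rw [T.mu_apply, T.mu_apply, ← hc', ← hc2'])
          rw [this]; exact hc2 l (by simp)
        · exact hc l hlS
      have h3 := finrank_const_le _ h2
      obtain ⟨b, hbS, hbl⟩ : ∃ b ∈ S, b ≠ l0 := by
        by_contra hcon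
        push Not at hcon
        have : S.card ≤ 1 := Finset.card_le_one.2 (fun a ha b hb => by rw [hcon a ha, hcon b hb])
        omega
      have h1 := ih (S.erase b) (Finset.mem_erase.2 ⟨hbl.symm, hl⟩) (by
        rw [Finset.card_erase_of_mem hbS]; omega)
      rw [hb b hbS hbl] at h1
      omega

theorem TD.M_top {K : Type*} [Field K] [CharZero K] [Algebra K F] [Fintype I] 
    (u : ι → σ → F) (hu : AlgebraicIndependent K (fun p : ι × σ => u p.1 p.2)) (l0 : ι)
    (h : T.DS (fun l => T.xm (u l)) l0 Finset.univ = ⊤) : T.M (fun l => T.xm (u l)) = ⊤ := by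
  classical
  set x : ι → I → F := fun l => T.xm (u l) with hx
  have : CharZero F := charZero_of_injective_algebraMap (algebraMap K F).injective
  have hu0 : ∀ l s, u l s ≠ 0 := fun l s => hu.ne_zero (l, s)
  have hx0 : ∀ a, x l0 a ≠ 0 := fun a => Finset.prod_ne_zero_iff.2 (fun s _ => pow_ne_zero _ (hu0 _ _))
  have hD : ∀ v w : Option τ → F, (fun a => x l0 a * T.lam v a * T.lam w a) ∈ T.M x := by
    intro v w
    have h1 : v ∈ T.DS x l0 Finset.univ := by rw [h]; trivial
    have h2 : (fun a => x l0 a * T.lam v a * T.lam w a) =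
        ∑ g, w g • (fun a => x l0 a * T.lam v a * T.b g a) := by
      ext a
      rw [Finset.sum_apply, show T.lam w a = ∑ g, w g * (T.b g a : F) from rfl, Finset.mul_sum]
      exact Finset.sum_congr rfl (fun g _ => by simp only [Pi.smul_apply, smul_eq_mul]; ring)
    rw [h2]
    refine Submodule.sum_mem _ (fun g _ => Submodule.smul_mem _ _ ?_)
    obtain ⟨c, -, hc⟩ := h1 g
    exact (T.mem_M _ _).2 ⟨c, hc⟩
  have hθ : ∀ s, ∃ θ : Derivation K F F, ∀ l a, θ (x l a) = if l = l0 then x l a * T.E a s else 0 := by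
    intro s
    obtain ⟨θ, hθ⟩ := exists_der _ hu (fun p => if p = (l0, s) then u l0 s else 0)
    refine ⟨θ, fun l a => ?_⟩
    rw [hx, T.der_xm_eq]
    have h1 : ∀ s', θ (u l s') = if (l, s') = (l0, s) then u l0 s else 0 := fun s' => hθ (l, s')
    simp only [h1]
    split_ifs with hl
    · subst hl
      congr 1
      rw [Finset.sum_eq_single s]
      · simp [hu0]
      · intro s' _ hs'; simp [hs']
      · simp
    · simp [hl]
  -- multiplication by exponents
  have hmul : ∀ (f : I → ℤ) (s : σ), (fun a => x l0 a * (f a : F)) ∈ T.M x →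
      (fun a => x l0 a * ((f a * T.E a s : ℤ) : F)) ∈ T.M x := by
    intro f s hf
    obtain ⟨θ, hθ⟩ := hθ s
    obtain ⟨c, hc⟩ := (T.mem_M _ _).1 hf
    obtain ⟨w, hw⟩ := T.exists_lam (Pi.single s (1 : F))
    have hw' : ∀ a, T.lam w a = T.E a s := fun a => by rw [hw]; simp [Pi.single_apply]
    have h1 : (fun a => x l0 a * ((f a * T.E a s : ℤ) : F)) =
        T.mu x (fun l g => θ (c l g)) + (fun a => x l0 a * T.lam (c l0) a * T.lam w a) := by
      ext a
      have h2 := congrArg θ (hc a)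
      rw [Derivation.leibniz, map_sum] at h2
      simp only [Derivation.leibniz, hθ, if_true, Derivation.map_intCast, smul_zero, mul_zero, zero_add,
        T.der_lam, smul_eq_mul, Finset.sum_add_distrib] at h2
      rw [Pi.add_apply, T.mu_apply, hw']
      push_cast
      rw [show x l0 a * ((f a : F) * T.E a s) = f a * (x l0 a * T.E a s) by ring, h2]
      congr 1
      rw [Finset.sum_eq_single l0] <;> simp +contextual
      ring
    rw [h1]
    exact Submodule.add_mem _ ⟨_, rfl⟩ (hD _ _)
  rw [eq_top_iff]
  have hind : ∀ a0, (Pi.single a0 1 : I → F) ∈ T.M x := by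
    intro a0
    have hsep : ∀ b, ∃ s, b ≠ a0 → T.E b s ≠ T.E a0 s := by
      intro b
      by_cases hb : b = a0
      · obtain ⟨s, _⟩ : ∃ s : σ, True := by
          by_contra hcon
          push Not at hcon
          have := T.hW a0
          rw [Finset.sum_eq_zero (fun s _ => absurd trivial (by simpa using hcon s))] at this
          have := T.hD; omega
        exact ⟨s, fun h => absurd hb h⟩
      · obtain ⟨s, hs⟩ := Function.ne_iff.1 (fun h => hb (T.inj h))
        exact ⟨s, fun _ => hs⟩
    choose sp hsp using hsep
    have hprod : ∀ S : Finset I, (fun a => x l0 a *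
        ((∏ b ∈ S, ((T.E a (sp b) : ℤ) - T.E b (sp b)) : ℤ) : F)) ∈ T.M x := by
      intro S
      induction S using Finset.induction_on with
      | empty =>
        have := T.mul_lam_mem_M x l0 (Pi.single none 1)
        simpa [T.lam_single, TD.b] using this
      | insert b S hb ih =>
        have h1 := hmul _ (sp b) ih
        have h2 := Submodule.smul_mem _ (T.E b (sp b) : F) ih
        have h3 := Submodule.sub_mem _ h1 h2
        convert h3 using 1
        ext a
        rw [Finset.prod_insert hb]
        simp only [Pi.sub_apply, Pi.smul_apply, smul_eq_mul]
        push_cast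
        ring
    have h1 := hprod (Finset.univ.erase a0)
    set P : I → ℤ := fun a => ∏ b ∈ Finset.univ.erase a0, ((T.E a (sp b) : ℤ) - T.E b (sp b)) with hP
    have hP0 : P a0 ≠ 0 := by
      refine Finset.prod_ne_zero_iff.2 (fun b hb => ?_)
      have := hsp b (Finset.ne_of_mem_erase hb)
      rw [sub_ne_zero]; exact_mod_cast this.symm
    have hP1 : ∀ a, a ≠ a0 → P a = 0 := fun a ha =>
      Finset.prod_eq_zero (Finset.mem_erase.2 ⟨ha, Finset.mem_univ a⟩) (sub_self _)
    have hne : x l0 a0 * (P a0 : F) ≠ 0 := mul_ne_zero (hx0 a0) (by exact_mod_cast hP0)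
    have h2 := Submodule.smul_mem _ (x l0 a0 * (P a0 : F))⁻¹ h1
    convert h2 using 1
    ext a
    by_cases ha : a = a0
    · subst ha
      simp only [Pi.smul_apply, smul_eq_mul, Pi.single_eq_same]
      exact (inv_mul_cancel₀ hne).symm
    · have := hP1 a ha
      change ∏ b ∈ Finset.univ.erase a0, ((T.E a (sp b) : ℤ) - T.E b (sp b)) = 0 at this
      simp only [Pi.smul_apply, smul_eq_mul, Pi.single_eq_of_ne ha]
      rw [this]; simp
  intro y _
  rw [pi_eq_sum_univ' y]
  exact Submodule.sum_mem _ (fun a _ => Submodule.smul_mem _ _ (hind a))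

theorem TD.exists_S {K : Type*} [Field K] [CharZero K] [Algebra K F] [Fintype I] 
    (u : ι → σ → F) (hu : AlgebraicIndependent K (fun p : ι × σ => u p.1 p.2)) (l0 : ι)
    (hLI : T.LI (fun l => T.xm (u l)))
    (j : ℕ) (hj : 1 ≤ j) (hjι : Fintype.card ι + 1 = j + Fintype.card τ)
    (hτ : 0 < Fintype.card τ)
    (hcard : Fintype.card ι * (Fintype.card τ + 1) < Fintype.card I) :
    ∃ S : Finset ι, l0 ∈ S ∧ S.card = j ∧
      ∀ v ∈ T.DS (fun l => T.xm (u l)) l0 S, ∀ p, v (some p) = 0 := by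
  by_contra hcon
  push Not at hcon
  have hu0 : ∀ l s, u l s ≠ 0 := fun l s => hu.ne_zero (l, s)
  have h1 := T.dim_DS hLI (l0 := l0) 
    (fun a => Finset.prod_ne_zero_iff.2 (fun s _ => pow_ne_zero _ (hu0 _ _))) j hj
    (fun S h1 h2 h3 => by
      obtain ⟨v, hv, p, hp⟩ := hcon S h1 h2
      exact hp (h3 v hv p)) (Fintype.card τ - 1) Finset.univ (Finset.mem_univ _)
      (by rw [Finset.card_univ]; omega)
  have h2 := T.M_top u hu l0 (Submodule.eq_top_of_finrank_eq (by
    refine le_antisymm (Submodule.finrank_le _) ?_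
    refine le_trans ?_ h1
    rw [Module.finrank_fintype_fun_eq_card, Fintype.card_option]; omega))
  have h3 := LinearMap.finrank_range_le (T.mu (fun l => T.xm (u l)))
  change Module.finrank F (T.M (fun l => T.xm (u l))) ≤ _ at h3
  rw [h2, finrank_top, Module.finrank_pi_fintype F (M := fun _ : ι => Option τ → F)] at h3
  simp [Module.finrank_fintype_fun_eq_card, Fintype.card_option] at h3
  omega

end generic


section transfer
theorem tr1 {P F κ J : Type*} [CommRing P] [Field F] [Fintype κ] [DecidableEq κ] (φ : P →+* F)
    (w : κ → J → P) (h : LinearIndependent F (fun k i => φ (w k i))) :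
    ∃ f : κ → J, (Matrix.of fun k k' => w k (f k')).det ≠ 0 := by
  obtain ⟨f, hf⟩ := exists_minor _ h
  refine ⟨f, fun h0 => hf ?_⟩
  have := RingHom.map_det φ (Matrix.of fun k k' => w k (f k'))
  rw [h0, map_zero] at this
  exact this.symm

theorem tr2 {P F κ J : Type*} [CommRing P] [Field F] [Fintype κ] [DecidableEq κ] (φ : P →+* F)
    (w : κ → J → P) (f : κ → J) (h : φ (Matrix.of fun k k' => w k (f k')).det ≠ 0) :
    LinearIndependent F (fun k i => φ (w k i)) := by
  refine li_of_minor _ f ?_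
  rw [RingHom.map_det] at h
  exact h

variable {σ τ I : Type} [Fintype σ] [Fintype τ] [DecidableEq τ]
  (T : TD σ τ I) {ι : Type} [Fintype ι] [DecidableEq ι]

def TD.lifam {A : Type*} [CommRing A] (x : ι → I → A) : ι × Option τ → I → A :=
  fun q a => x q.1 a * T.b q.2 a

def TD.ntfam {A : Type*} [CommRing A] (x : ι → I → A) (l0 : ι) :
    τ ⊕ (Option τ × ι × Option τ) → Option τ × I → A
  | Sum.inl p, q => x l0 q.2 * T.E q.2 (T.ρ p) * T.b q.1 q.2
  | Sum.inr r, q => if q.1 = r.1 then x r.2.1 q.2 * T.b r.2.2 q.2 else 0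

theorem TD.lifam_map {A A' : Type*} [CommRing A] [CommRing A'] (φ : A →+* A') (x : ι → I → A) :
    (fun k i => φ (T.lifam x k i)) = T.lifam (fun l a => φ (x l a)) := by
  ext k i; simp [TD.lifam]

theorem TD.ntfam_map {A A' : Type*} [CommRing A] [CommRing A'] (φ : A →+* A') (x : ι → I → A)
    (l0 : ι) :
    (fun k i => φ (T.ntfam x l0 k i)) = T.ntfam (fun l a => φ (x l a)) l0 := by
  ext k i
  rcases k with p | r
  · simp [TD.ntfam]
  · simp only [TD.ntfam]; split_ifs <;> simp

theorem TD.xm_map {A A' : Type*} [CommRing A] [CommRing A'] (φ : A →+* A') (u : σ → A) (a : I) :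
    φ (T.xm u a) = T.xm (fun s => φ (u s)) a := by
  simp [TD.xm]

variable {F : Type*} [Field F]

theorem TD.lifam_iff (x : ι → I → F) : LinearIndependent F (T.lifam x) ↔ T.LI x := by
  have key : ∀ c : ι × Option τ → F, ∑ q, c q • T.lifam x q = T.mu x (fun l g => c (l, g)) := by
    intro c
    ext a
    rw [T.mu_apply, Finset.sum_apply, Fintype.sum_prod_type]
    refine Finset.sum_congr rfl (fun l _ => ?_)
    rw [TD.lam, Finset.mul_sum]
    refine Finset.sum_congr rfl (fun g _ => ?_)
    simp only [TD.lifam, Pi.smul_apply, smul_eq_mul]; ring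
  rw [Fintype.linearIndependent_iff]
  simp only [key]
  constructor
  · intro h
    refine (injective_iff_map_eq_zero _).2 (fun c hc => ?_)
    have := h (fun q => c q.1 q.2) hc
    ext l g; exact this (l, g)
  · intro h c hc i
    have := (injective_iff_map_eq_zero _).1 h _ hc
    exact congrFun (congrFun this i.1) i.2

theorem TD.ntfam_iff (x : ι → I → F) (l0 : ι) :
    LinearIndependent F (T.ntfam x l0) ↔ T.LI x ∧ T.NT x l0 := by
  have key : ∀ (c : τ ⊕ (Option τ × ι × Option τ) → F) (g : Option τ) (a : I),
      (∑ q, c q • T.ntfam x l0 q) (g, a) =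
        x l0 a * T.lam (fun o => o.elim 0 (fun p => c (Sum.inl p))) a * T.b g a +
        T.mu x (fun l h => c (Sum.inr (g, l, h))) a := by
    intro c g a
    rw [Finset.sum_apply, Fintype.sum_sum_type]
    congr 1
    · rw [T.lam_eq, Option.elim_none, zero_add, Finset.mul_sum, Finset.sum_mul]
      refine Finset.sum_congr rfl (fun p _ => ?_)
      simp only [TD.ntfam, Pi.smul_apply, smul_eq_mul, Option.elim_some]; ring
    · rw [Fintype.sum_prod_type, Finset.sum_eq_single g]
      · rw [T.mu_apply, Fintype.sum_prod_type]
        refine Finset.sum_congr rfl (fun l _ => ?_)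
        rw [TD.lam, Finset.mul_sum]
        refine Finset.sum_congr rfl (fun h _ => ?_)
        simp only [TD.ntfam, Pi.smul_apply, smul_eq_mul, if_true]; ring
      · intro g' _ hg'
        refine Finset.sum_eq_zero (fun r _ => ?_)
        simp [TD.ntfam, hg'.symm]
      · simp
  rw [Fintype.linearIndependent_iff]
  constructor
  · intro h
    constructor
    · refine (injective_iff_map_eq_zero _).2 (fun c hc => ?_)
      have := h (Sum.elim 0 (fun r => if r.1 = none then c r.2.1 r.2.2 else 0)) (by
        ext ⟨g, a⟩
        rw [key]
        have h1 : (fun o : Option τ => o.elim (0 : F) (fun p => (Sum.elim (0 : τ → F)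
          (fun r : Option τ × ι × Option τ => if r.1 = none then c r.2.1 r.2.2 else 0))
            (Sum.inl p))) = 0 := by
          ext (_ | p) <;> simp
        rw [h1, T.lam_zero]
        by_cases hg : g = none
        · simp [hg]
          exact congrFun hc a
        · simp [hg]
          exact congrFun (map_zero (T.mu x)) a)
      ext l g
      simpa using this (Sum.inr (none, l, g))
    · intro v hv
      set v' : Option τ → F := fun o => o.elim 0 (fun p => v (some p)) with hv'
      have h1 : ∀ g, ∃ c, ∀ a, x l0 a * T.lam v' a * T.b g a = T.mu x c a := by
        intro g
        obtain ⟨c, hc⟩ := (T.mem_M _ _).1 (hv g)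
        refine ⟨c - Pi.single l0 (v none • Pi.single g 1), fun a => ?_⟩
        rw [map_sub, Pi.sub_apply]
        have h2 : T.mu x (Pi.single l0 (v none • Pi.single g 1)) a = x l0 a * (v none * T.b g a) := by
          rw [T.mu_apply, Finset.sum_eq_single l0 (fun b _ hb => by
            rw [Pi.single_eq_of_ne hb, T.lam_zero, mul_zero]) (by simp), Pi.single_eq_same,
            T.lam_smul, T.lam_single]
        rw [h2, T.mu_apply, ← hc]
        have h3 : T.lam v' a = T.lam v a - v none := by
          rw [T.lam_eq, T.lam_eq]; simp [hv']
        rw [h3]; ring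
      choose c hc using h1
      intro p
      have := h (Sum.elim (fun p => v (some p)) (fun r => - c r.1 r.2.1 r.2.2)) (by
        ext ⟨g, a⟩
        rw [key]
        have h4 : T.mu x (fun l h => Sum.elim (fun p => v (some p))
          (fun r : Option τ × ι × Option τ => - c r.1 r.2.1 r.2.2) (Sum.inr (g, l, h))) a =
            - T.mu x (c g) a := by
          rw [← Pi.neg_apply, ← map_neg]; rfl
        rw [h4, ← hc]
        exact add_neg_cancel _) (Sum.inl p)
      simpa using this
  · rintro ⟨hLI, hNT⟩ c hc
    have h0 : ∀ g a, x l0 a * T.lam (fun o => o.elim 0 (fun p => c (Sum.inl p))) a * T.b g a +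
        T.mu x (fun l h => c (Sum.inr (g, l, h))) a = 0 := by
      intro g a
      rw [← key, hc]; rfl
    have h1 := hNT (fun o => o.elim 0 (fun p => c (Sum.inl p))) (fun g => by
      have h2 : (fun a => x l0 a * T.lam (fun o => o.elim 0 (fun p => c (Sum.inl p))) a * T.b g a)
        = T.mu x (- (fun l h => c (Sum.inr (g, l, h)))) := by
        ext a
        rw [map_neg, Pi.neg_apply]
        exact eq_neg_of_add_eq_zero_left (h0 g a)
      rw [h2]; exact ⟨_, rfl⟩)
    have h2 : ∀ p, c (Sum.inl p) = 0 := fun p => by simpa using h1 p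
    have h3 : (fun o : Option τ => o.elim (0 : F) (fun p => c (Sum.inl p))) = 0 := by
      ext (_ | p) <;> simp [h2]
    rintro (p | ⟨g, l, h⟩)
    · exact h2 p
    · have h4 := (injective_iff_map_eq_zero _).1 hLI (fun l h => c (Sum.inr (g, l, h))) (by
        ext a
        have := h0 g a
        rw [h3, T.lam_zero] at this
        simpa using this)
      exact congrFun (congrFun h4 l) h

theorem TD.LI_comp {x : ι → I → F} (h : T.LI x) {ι' : Type} [Fintype ι'] [DecidableEq ι']
    (f : ι' → ι) (hf : Function.Injective f) : T.LI (fun l => x (f l)) := by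
  rw [← T.lifam_iff] at h ⊢
  exact h.comp (fun q : ι' × Option τ => (f q.1, q.2)) (fun a b hab => by
    simp only [Prod.mk.injEq] at hab
    exact Prod.ext (hf hab.1) hab.2)

theorem TD.M_scale (x : ι → I → F) (c : ι → F) (hc : ∀ l, c l ≠ 0) :
    T.M (fun l a => c l * x l a) = T.M x := by
  ext y
  rw [T.mem_M, T.mem_M]
  constructor
  · rintro ⟨w, hw⟩
    refine ⟨fun l => c l • w l, fun a => ?_⟩
    rw [hw]
    exact Finset.sum_congr rfl (fun l _ => by rw [T.lam_smul]; ring)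
  · rintro ⟨w, hw⟩
    refine ⟨fun l => (c l)⁻¹ • w l, fun a => ?_⟩
    rw [hw]
    exact Finset.sum_congr rfl (fun l _ => by rw [T.lam_smul]; field_simp [hc l])

theorem TD.NT_scale {x : ι → I → F} {l0 : ι} (h : T.NT x l0) (c : ι → F) (hc : ∀ l, c l ≠ 0) :
    T.NT (fun l a => c l * x l a) l0 := by
  intro v hv p
  refine h v (fun g => ?_) p
  have := hv g
  rw [T.M_scale x c hc] at this
  have h2 := Submodule.smul_mem _ (c l0)⁻¹ this
  convert h2 using 1
  ext a
  simp only [Pi.smul_apply, smul_eq_mul]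
  field_simp [hc l0]

theorem TD.LI_scale {x : ι → I → F} (h : T.LI x) (c : ι → F) (hc : ∀ l, c l ≠ 0) :
    T.LI (fun l a => c l * x l a) := by
  rw [← T.lifam_iff] at h ⊢
  have := h.units_smul (fun q : ι × Option τ => Units.mk0 (c q.1) (hc q.1))
  convert this using 1
  ext q a
  simp [TD.lifam, Units.smul_def, mul_assoc]

def TD.nm {A : Type*} [CommRing A] (t : τ → A) (a : I) : A := ∏ p, t p ^ T.E a (T.ρ p)

theorem TD.nm_map {A A' : Type*} [CommRing A] [CommRing A'] (φ : A →+* A') (t : τ → A) (a : I) :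
    φ (T.nm t a) = T.nm (fun s => φ (t s)) a := by
  simp [TD.nm]

theorem TD.nm_of_rel (y : I → F) (h0 : y T.e0 ≠ 0)
    (h : ∀ a p a', (∀ s, T.E a s + T.E T.e0 s = T.E a' s + T.E (T.e p) s) →
      y a * y T.e0 = y a' * y (T.e p)) (a : I) :
    y a = y T.e0 * T.nm (fun p => y (T.e p) / y T.e0) a := by
  have key : ∀ n a, ∑ p, T.E a (T.ρ p) = n → y a = y T.e0 * T.nm (fun p => y (T.e p) / y T.e0) a := by
    intro n
    induction n with
    | zero =>
      intro a ha
      have h1 : ∀ p, T.E a (T.ρ p) = 0 := by simpa using ha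
      rcases T.ind a with rfl | ⟨p, a', hp⟩
      · simp [TD.nm, h1]
      · have := hp (T.ρ p)
        rw [h1, T.he0, T.he, if_pos rfl] at this
        omega
    | succ n ih =>
      intro a ha
      rcases T.ind a with rfl | ⟨p, a', hp⟩
      · simp [T.he0] at ha
      · have h1 : ∀ r, T.E a (T.ρ r) = T.E a' (T.ρ r) + if p = r then 1 else 0 := by
          intro r
          have := hp (T.ρ r)
          rwa [T.he0, T.he, add_zero] at this
        have h2 := ih a' (by
          have : ∑ r, T.E a (T.ρ r) = ∑ r, T.E a' (T.ρ r) + 1 := by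
            simp [h1, Finset.sum_add_distrib]
          omega)
        have h3 : T.nm (fun p => y (T.e p) / y T.e0) a =
            T.nm (fun p => y (T.e p) / y T.e0) a' * (y (T.e p) / y T.e0) := by
          simp only [TD.nm, h1, pow_add, Finset.prod_mul_distrib, pow_ite, pow_one, pow_zero]
          simp
        rw [h3, ← mul_assoc, ← h2]
        have := h a p a' hp
        field_simp
        exact this
  exact key _ a rfl

theorem TD.xm_rel {A : Type*} [CommRing A] (u : σ → A) (a b a' b' : I) 
    (h : ∀ s, T.E a s + T.E b s = T.E a' s + T.E b' s) :
    T.xm u a * T.xm u b = T.xm u a' * T.xm u b' := by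
  simp only [TD.xm, ← Finset.prod_mul_distrib, ← pow_add, h]

theorem TD.xm_nm (u : σ → F) (hu : ∀ s, u s ≠ 0) (a : I) :
    T.xm u a = T.xm u T.e0 * T.nm (fun p => T.xm u (T.e p) / T.xm u T.e0) a :=
  T.nm_of_rel _ (Finset.prod_ne_zero_iff.2 (fun s _ => pow_ne_zero _ (hu _)))
    (fun a p a' h => T.xm_rel u _ _ _ _ h) a

end transfer


section gen
open MvPolynomial
variable {σ τ I : Type} [Fintype σ] [Fintype τ] [DecidableEq τ] (T : TD σ τ I) 

/-- the universal points -/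
def TD.ux (K : Type*) [Field K] (ι : Type) (l : ι) : I → MvPolynomial (ι × σ) K :=
  T.xm (fun s => X (l, s))

def TD.Gen (K : Type*) [Field K] (m : ℕ) : Prop :=
  ∃ f : Fin m × Option τ → I,
    (Matrix.of fun k k' => T.lifam (T.ux K (Fin m)) k (f k')).det ≠ 0

def TD.GenNT (K : Type*) [Field K] (m : ℕ) (l0 : Fin m) : Prop :=
  ∃ f : τ ⊕ (Option τ × Fin m × Option τ) → Option τ × I,
    (Matrix.of fun k k' => T.ntfam (T.ux K (Fin m)) l0 k (f k')).det ≠ 0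

theorem TD.ux_map {K : Type*} [Field K] {F : Type*} [CommRing F] [Algebra K F]
    {ι : Type} (u : ι → σ → F) (l : ι) (a : I) :
    (aeval (fun q : ι × σ => u q.1 q.2) : _ →ₐ[K] F).toRingHom (T.ux K ι l a) = T.xm (u l) a := by
  rw [TD.ux, T.xm_map]; simp

variable {K : Type*} [Field K] {F : Type*} [Field F] [Algebra K F] 

theorem TD.gen_of {m : ℕ} (u : Fin m → σ → F) (h : T.LI (fun l => T.xm (u l))) : T.Gen K m := by
  refine tr1 (aeval (fun q : Fin m × σ => u q.1 q.2) : _ →ₐ[K] F).toRingHom _ ?_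
  rw [T.lifam_map]
  simp only [T.ux_map]
  exact (T.lifam_iff _).2 h

theorem TD.gen_li {m : ℕ} (h : T.Gen K m) (u : Fin m → σ → F) 
    (hu : AlgebraicIndependent K (fun p : Fin m × σ => u p.1 p.2)) :
    T.LI (fun l => T.xm (u l)) := by
  obtain ⟨f, hf⟩ := h
  have h1 := tr2 (aeval (fun q : Fin m × σ => u q.1 q.2) : _ →ₐ[K] F).toRingHom
    (T.lifam (T.ux K (Fin m))) f (fun h0 => hf (hu (by simpa using h0)))
  rw [T.lifam_map] at h1
  simp only [T.ux_map] at h1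
  exact (T.lifam_iff _).1 h1

theorem TD.genNT_of {m : ℕ} {l0 : Fin m} (u : Fin m → σ → F) (h : T.LI (fun l => T.xm (u l)))
    (h' : T.NT (fun l => T.xm (u l)) l0) : T.GenNT K m l0 := by
  refine tr1 (aeval (fun q : Fin m × σ => u q.1 q.2) : _ →ₐ[K] F).toRingHom _ ?_
  rw [T.ntfam_map]
  simp only [T.ux_map]
  exact (T.ntfam_iff _ _).2 ⟨h, h'⟩

theorem TD.genNT_nt {m : ℕ} {l0 : Fin m} (h : T.GenNT K m l0) (u : Fin m → σ → F) 
    (hu : AlgebraicIndependent K (fun p : Fin m × σ => u p.1 p.2)) :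
    T.LI (fun l => T.xm (u l)) ∧ T.NT (fun l => T.xm (u l)) l0 := by
  obtain ⟨f, hf⟩ := h
  have h1 := tr2 (aeval (fun q : Fin m × σ => u q.1 q.2) : _ →ₐ[K] F).toRingHom
    (T.ntfam (T.ux K (Fin m)) l0) f (fun h0 => hf (hu (by simpa using h0)))
  rw [T.ntfam_map] at h1
  simp only [T.ux_map] at h1
  exact (T.ntfam_iff _ _).1 h1

/-- the generic field and points -/
abbrev GF (K : Type*) [Field K] (m : ℕ) (σ : Type) : Type _ :=
  FractionRing (MvPolynomial (Fin m × σ) K)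

def gu (K : Type*) [Field K] (m : ℕ) (σ : Type) (l : Fin m) (s : σ) : GF K m σ :=
  algebraMap (MvPolynomial (Fin m × σ) K) _ (X (l, s))

theorem gu_eq (K : Type*) [Field K] (m : ℕ) (σ : Type) (G : MvPolynomial (Fin m × σ) K) :
    aeval (fun p : Fin m × σ => gu K m σ p.1 p.2) G = algebraMap _ (GF K m σ) G := by
  have : (aeval (fun p : Fin m × σ => gu K m σ p.1 p.2) : _ →ₐ[K] GF K m σ) = 
    (IsScalarTower.toAlgHom K (MvPolynomial (Fin m × σ) K) (GF K m σ)) := by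
    apply MvPolynomial.algHom_ext
    intro i
    simp [gu]
  rw [this]; rfl

theorem gu_ind (K : Type*) [Field K] (m : ℕ) (σ : Type) :
    AlgebraicIndependent K (fun p : Fin m × σ => gu K m σ p.1 p.2) := by
  intro a b hab
  rw [gu_eq, gu_eq] at hab
  exact IsFractionRing.injective _ _ hab

theorem TD.gen_mono {m m' : ℕ} (h : m' ≤ m) (hm : T.Gen K m) : T.Gen K m' :=
  T.gen_of (K := K) (fun l => gu K m σ (Fin.castLE h l))
    (T.LI_comp (T.gen_li hm (gu K m σ) (gu_ind K m σ)) (Fin.castLE h) (Fin.castLE_injective h))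

theorem exists_fin_param {m j : ℕ} (S : Finset (Fin m)) (hS : S.card = j) (L : Fin m) (hL : L ∈ S)
    (l0 : Fin j) : ∃ f : Fin j → Fin m, Function.Injective f ∧ f l0 = L ∧ ∀ i, f i ∈ S := by
  let e : Fin j ≃ S := (finCongr hS.symm).trans S.equivFin.symm
  let e' := (Equiv.swap l0 (e.symm ⟨L, hL⟩)).trans e
  refine ⟨fun i => (e' i : Fin m), fun a b hab => e'.injective (Subtype.ext hab), ?_,
    fun i => (e' i).2⟩
  simp [e']

theorem TD.genNT [Fintype I] [CharZero K] {m j : ℕ} (hm : T.Gen K m) (hj : 1 ≤ j)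
    (hjm : m + 1 = j + Fintype.card τ) (hτ : 0 < Fintype.card τ)
    (hcard : m * (Fintype.card τ + 1) < Fintype.card I) (l0 : Fin j) : T.GenNT K j l0 := by
  have hLI := T.gen_li hm (gu K m σ) (gu_ind K m σ)
  let L0 : Fin m := ⟨0, by omega⟩
  obtain ⟨S, hS, hSj, hv⟩ := T.exists_S (gu K m σ) (gu_ind K m σ) L0 hLI j hj (by simpa using hjm) hτ
    (by simpa using hcard)
  obtain ⟨f, hf, hf0, hfS⟩ := exists_fin_param S hSj L0 hS l0
  refine T.genNT_of (K := K) (fun l => gu K m σ (f l)) (T.LI_comp hLI f hf) (fun v h => ?_)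
  refine hv v (fun g => ?_)
  obtain ⟨c, hc⟩ := (T.mem_M _ _).1 (h g)
  refine ⟨fun l => ∑ i, if f i = l then c i else 0, fun l hl => ?_, fun a => ?_⟩
  · refine Finset.sum_eq_zero (fun i _ => if_neg ?_)
    rintro rfl; exact hl (hfS i)
  · have := hc a
    simp only [hf0] at this
    rw [this]
    symm
    classical
    rw [← Finset.sum_subset (Finset.subset_univ (Finset.univ.image f)),
      Finset.sum_image hf.injOn]
    · refine Finset.sum_congr rfl (fun i _ => ?_)
      congr 2
      dsimp only
      rw [Finset.sum_eq_single i] <;> simp +contextual [hf.eq_iff]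
    · intro l _ hl
      dsimp only
      rw [Finset.sum_eq_zero, T.lam_zero, mul_zero]
      intro i _
      rw [if_neg]
      rintro rfl; exact hl (Finset.mem_image_of_mem _ (Finset.mem_univ _))

/-- normalized version -/
theorem TD.genNT_nm {m : ℕ} {l0 : Fin m} (h : T.GenNT K m l0) (t : Fin m → τ → F) 
    (ht : AlgebraicIndependent K (fun p : Fin m × τ => t p.1 p.2)) :
    T.NT (fun l => T.nm (t l)) l0 := by
  obtain ⟨h1, h2⟩ := T.genNT_nt h (gu K m σ) (gu_ind K m σ)
  have hu0 : ∀ l s, gu K m σ l s ≠ 0 := fun l s => (gu_ind K m σ).ne_zero (l, s)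
  have hx0 : ∀ l, T.xm (gu K m σ l) T.e0 ≠ 0 := fun l => 
    Finset.prod_ne_zero_iff.2 (fun s _ => pow_ne_zero _ (hu0 _ _))
  set t' : Fin m → τ → GF K m σ := fun l p => T.xm (gu K m σ l) (T.e p) / T.xm (gu K m σ l) T.e0
    with ht'
  have he : (fun l => T.nm (t' l)) =
      (fun l a => (T.xm (gu K m σ l) T.e0)⁻¹ * T.xm (gu K m σ l) a) := by
    ext l a
    rw [T.xm_nm _ (hu0 l) a, ht']
    field_simp [hx0 l]
  have h3 := T.LI_scale h1 _ (fun l => inv_ne_zero (hx0 l))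
  have h4 := T.NT_scale h2 _ (fun l => inv_ne_zero (hx0 l))
  rw [← he] at h3 h4
  have hmap : ∀ {F : Type _} [Field F] [Algebra K F] (t : Fin m → τ → F),
    (fun l a => (aeval (fun q : Fin m × τ => t q.1 q.2) : _ →ₐ[K] F).toRingHom
      (T.nm (fun p => X (l, p)) a)) = (fun l => T.nm (t l)) := by
    intro F _ _ t
    ext l a
    rw [T.nm_map]; simp
  obtain ⟨f, hf⟩ := tr1 (aeval (fun q : Fin m × τ => t' q.1 q.2) : _ →ₐ[K] _).toRingHom
    (T.ntfam (fun l : Fin m => T.nm (fun p => X (l, p))) l0) (by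
      rw [T.ntfam_map, hmap]
      exact (T.ntfam_iff _ _).2 ⟨h3, h4⟩)
  have h5 := tr2 (aeval (fun q : Fin m × τ => t q.1 q.2) : _ →ₐ[K] F).toRingHom
    (T.ntfam (fun l : Fin m => T.nm (fun p => X (l, p))) l0) f
      (fun h0 => hf (ht (by simpa using h0)))
  rw [T.ntfam_map] at h5
  have h6 : (fun l a => (aeval (fun q : Fin m × τ => t q.1 q.2) : _ →ₐ[K] F).toRingHom
      (T.nm (fun p => X (l, p)) a)) = (fun l => T.nm (t l)) := by
    ext l a
    rw [T.nm_map]; simp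
  rw [h6] at h5
  exact ((T.ntfam_iff _ _).1 h5).2

end gen


section key
open MvPolynomial
variable {σ τ I : Type} [Fintype σ] [Fintype τ] [DecidableEq τ] [Fintype I] (T : TD σ τ I) 
variable {K : Type*} [Field K] [CharZero K] {F : Type*} [Field F] [Algebra K F] {j : ℕ}

def TD.Sm {A : Type*} [CommRing A] (u : Fin j → σ → A) (a : I) : A := ∑ l, T.xm (u l) a

/-- the sum of the points has full transcendence degree -/
def TD.AI (_T : TD σ τ I) (K : Type*) [Field K] {F : Type*} [Field F] [Algebra K F] (j : ℕ)
    (q : I → F) : Prop :=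
  ∃ g : Fin j × Option τ → MvPolynomial I K, AlgebraicIndependent K (fun r => aeval q (g r))

theorem TD.key0 (u : Fin j → σ → F) (h : T.AI K j (T.Sm u)) :
    T.LI (fun l => T.xm (u l)) ∧ ∀ c : Fin j → Option τ → F, ∃ δ : Derivation K F F,
      ∀ l a, δ (T.xm (u l) a) = T.xm (u l) a * T.lam (c l) a := by
  classical
  obtain ⟨g, hg⟩ := h
  have h1 : ∀ r, ∃ δ : Derivation K F F, ∀ r', δ (aeval (T.Sm u) (g r')) = if r = r' then 1 else 0 :=
    fun r => exists_der _ hg _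
  choose δ hδ using h1
  have h2 : ∀ r l, ∃ c : Option τ → F, ∀ a, δ r (T.xm (u l) a) = T.xm (u l) a * T.lam c a :=
    fun r l => T.der_xm (δ r) (u l)
  choose c hc using h2
  have h3 : ∀ r a, δ r (T.Sm u a) = T.mu (fun l => T.xm (u l)) (c r) a := by
    intro r a
    rw [T.mu_apply, TD.Sm, map_sum]
    exact Finset.sum_congr rfl fun l _ => hc r l a
  have key : ∀ α : Fin j × Option τ → F, T.mu (fun l => T.xm (u l)) (∑ r, α r • c r) = 0 → α = 0 := by
    intro α h0
    ext r'
    have : ∑ a, aeval (T.Sm u) (pderiv a (g r')) *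
        T.mu (fun l => T.xm (u l)) (∑ r, α r • c r) a = 0 := by simp [h0]
    rw [map_sum] at this
    simp only [map_smul, Finset.sum_apply, Pi.smul_apply, ← h3, smul_eq_mul, Finset.mul_sum] at this
    rw [Finset.sum_comm] at this
    have h4 : ∀ r, ∑ a, aeval (T.Sm u) (pderiv a (g r')) * (α r * δ r (T.Sm u a)) =
        α r * if r = r' then 1 else 0 := by
      intro r
      rw [← hδ, der_aeval, Finset.mul_sum]
      exact Finset.sum_congr rfl fun _ _ => by ring
    simp only [h4] at this
    simpa using this
  have hli : LinearIndependent F c := by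
    rw [Fintype.linearIndependent_iff]
    intro α h0
    have := key α (by rw [h0, map_zero])
    simp [this]
  have hspan : ⊤ ≤ Submodule.span F (Set.range c) := by
    rw [hli.span_eq_top_of_card_eq_finrank']
    simp [Module.finrank_pi_fintype, Module.finrank_fintype_fun_eq_card]
  have hex : ∀ d : Fin j → Option τ → F, ∃ α : Fin j × Option τ → F, ∑ r, α r • c r = d := by
    intro d
    exact (Submodule.mem_span_range_iff_exists_fun F).1 (hspan Submodule.mem_top)
  constructor
  · rw [TD.LI, ← LinearMap.ker_eq_bot, LinearMap.ker_eq_bot']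
    intro d hd
    obtain ⟨α, rfl⟩ := hex d
    rw [key α hd]; simp
  · intro d
    obtain ⟨α, rfl⟩ := hex d
    refine ⟨∑ r, α r • δ r, fun l a => ?_⟩
    have : (∑ r, α r • δ r : Derivation K F F) (T.xm (u l) a) = ∑ r, α r * δ r (T.xm (u l) a) := by
      rw [← Derivation.coeFnAddMonoidHom_apply, map_sum]
      simp
    rw [this]
    simp only [hc, TD.lam, Finset.sum_apply, Pi.smul_apply, smul_eq_mul, Finset.mul_sum, Finset.sum_mul]
    rw [Finset.sum_comm]
    exact Finset.sum_congr rfl fun _ _ => Finset.sum_congr rfl fun _ _ => by ring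

theorem TD.LI_ne (u : Fin j → σ → F) [CharZero F] (h : T.LI (fun l => T.xm (u l))) (l : Fin j) (s : σ) :
    u l s ≠ 0 := by
  classical
  intro h0
  obtain ⟨c, hc⟩ := T.exists_lam (Pi.single s (1 : F))
  have h1 : ∀ a, T.xm (u l) a * T.lam c a = 0 := by
    intro a
    rw [hc]
    by_cases ha : T.E a s = 0
    · rw [Finset.sum_eq_single s]
      · simp [ha]
      · intro b _ hb; simp [hb]
      · simp
    · rw [TD.xm, Finset.prod_eq_zero (Finset.mem_univ s), zero_mul]
      rw [h0, zero_pow ha]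
  have h2 := h.eq_zero (c := Pi.single l c) (fun a => by
    rw [Finset.sum_eq_single l]
    · simpa using h1 a
    · intro b _ hb; simp [hb, T.lam_zero]
    · simp)
  have h3 : c = 0 := by simpa using congrFun h2 l
  obtain ⟨a, ha⟩ := T.enz s
  have h4 := hc a
  rw [h3, T.lam_zero, Finset.sum_eq_single s (by intro b _ hb; simp [hb]) (by simp)] at h4
  simp at h4
  exact ha (by exact_mod_cast h4.symm)

theorem TD.key_nt (hNT : ∀ l0 : Fin j, T.GenNT K j l0) (u : Fin j → σ → F)
    (h : T.AI K j (T.Sm u)) (l0 : Fin j) : T.NT (fun l => T.xm (u l)) l0 := by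
  classical
  obtain ⟨hLI, hδ⟩ := T.key0 u h
  have : CharZero F := charZero_of_injective_algebraMap (algebraMap K F).injective
  have hu := T.LI_ne u hLI
  have hx : ∀ l a, T.xm (u l) a ≠ 0 := fun l a =>
    Finset.prod_ne_zero_iff.2 (fun s _ => pow_ne_zero _ (hu l s))
  set t : Fin j → τ → F := fun l p => T.xm (u l) (T.e p) / T.xm (u l) T.e0 with ht
  have htn : ∀ l p, t l p ≠ 0 := fun l p => div_ne_zero (hx _ _) (hx _ _)
  have hAI : AlgebraicIndependent K (fun p : Fin j × τ => t p.1 p.2) := by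
    have : ∀ q : Fin j × τ, ∃ δ : Derivation K F F, ∀ r : Fin j × τ, 
        δ (t r.1 r.2) = if q = r then 1 else 0 := by
      intro q
      obtain ⟨δ, hd⟩ := hδ (Pi.single q.1 (Pi.single (some q.2) (t q.1 q.2)⁻¹))
      refine ⟨δ, fun r => ?_⟩
      have h0 := hd r.1 T.e0
      have h1 := hd r.1 (T.e r.2)
      have h2 : T.xm (u r.1) (T.e r.2) = t r.1 r.2 * T.xm (u r.1) T.e0 := by
        rw [ht]; field_simp [hx r.1 T.e0]
      rw [h2, Derivation.leibniz, h0] at h1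
      rw [T.lam_e0, T.lam_e] at h1
      simp only [smul_eq_mul] at h1
      have h3 : δ (t r.1 r.2) = t r.1 r.2 *
          (Pi.single q.1 (Pi.single (some q.2) (t q.1 q.2)⁻¹) : Fin j → Option τ → F) r.1 (some r.2) := by
        apply mul_left_cancel₀ (hx r.1 T.e0)
        linear_combination h1
      rw [h3]
      by_cases hqr : q = r
      · subst hqr; simp [htn]
      · rw [if_neg hqr]
        by_cases hq1 : r.1 = q.1
        · have hq2 : r.2 ≠ q.2 := fun hh => hqr (Prod.ext hq1.symm hh.symm)
          simp [hq1, hq2]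
        · simp [hq1]
    choose δ hd using this
    exact algInd_of_der _ δ hd
  have h1 := T.genNT_nm (hNT l0) t hAI
  have h2 := T.NT_scale h1 (fun l => T.xm (u l) T.e0) (fun l => hx l _)
  have h3 : (fun l a => T.xm (u l) T.e0 * T.nm (t l) a) = (fun l => T.xm (u l)) := by
    ext l a
    rw [T.xm_nm (u l) (hu l) a]
  rwa [h3] at h2

theorem TD.key_M (u : Fin j → σ → F) (h : T.AI K j (T.Sm u)) (m : I → F) :
    m ∈ T.M (fun l => T.xm (u l)) ↔ ∃ δ : Derivation K F F, ∀ a, m a = δ (T.Sm u a) := by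
  obtain ⟨hLI, hδ⟩ := T.key0 u h
  rw [T.mem_M]
  constructor
  · rintro ⟨c, hc⟩
    obtain ⟨δ, hd⟩ := hδ c
    refine ⟨δ, fun a => ?_⟩
    rw [hc, TD.Sm, map_sum]
    exact Finset.sum_congr rfl fun l _ => (hd l a).symm
  · rintro ⟨δ, hd⟩
    choose c hc using fun l => T.der_xm δ (u l)
    refine ⟨c, fun a => ?_⟩
    rw [hd, TD.Sm, map_sum]
    exact Finset.sum_congr rfl fun l _ => hc l a

theorem TD.key [Nonempty τ] (hNT : ∀ l0 : Fin j, T.GenNT K j l0) (u w : Fin j → σ → F)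
    (h : T.AI K j (T.Sm u)) (huw : T.Sm u = T.Sm w) (l1 : Fin j) :
    ∃ l' e, ∀ a, T.xm (u l1) a = e * T.xm (w l') a := by
  classical
  have h' : T.AI K j (T.Sm w) := huw ▸ h
  obtain ⟨hLI, hδ⟩ := T.key0 u h
  obtain ⟨hLI', hδ'⟩ := T.key0 w h'
  have : CharZero F := charZero_of_injective_algebraMap (algebraMap K F).injective
  have hMM : T.M (fun l => T.xm (u l)) = T.M (fun l => T.xm (w l)) := by
    ext m; rw [T.key_M u h, T.key_M w h', huw]
  have hnt := T.key_nt hNT w h'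
  -- first part
  obtain ⟨e, he⟩ : ∃ e : Fin j → F, ∀ a, T.xm (u l1) a = ∑ l, e l * T.xm (w l) a := by
    obtain ⟨δ, hd⟩ := hδ (Pi.single l1 (Pi.single none 1))
    have hd' : ∀ l a, δ (T.xm (u l) a) = if l = l1 then T.xm (u l) a else 0 := by
      intro l a
      rw [hd]
      split_ifs with hl
      · subst hl; simp [T.lam_single, TD.b]
      · simp [hl, T.lam_zero]
    have hst : ∀ m ∈ T.M (fun l => T.xm (u l)), (fun a => δ (m a)) ∈ T.M (fun l => T.xm (u l)) := by
      intro m hm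
      obtain ⟨c, hc⟩ := (T.mem_M _ _).1 hm
      refine (T.mem_M _ _).2 ⟨fun l => (if l = l1 then c l else 0) + fun g => δ (c l g), fun a => ?_⟩
      rw [hc, map_sum]
      refine Finset.sum_congr rfl fun l _ => ?_
      rw [Derivation.leibniz, hd', T.der_lam, T.lam_add]
      split_ifs <;> simp [T.lam_zero] ; ring
    choose c hc using fun l => T.der_xm δ (w l)
    have hcz : ∀ l p, c l (some p) = 0 := by
      intro l
      refine hnt l (c l) (fun g => ?_)
      have h1 := T.mul_lam_mem_M (fun l => T.xm (w l)) l (Pi.single g 1)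
      rw [← hMM] at h1
      have h2 := hst _ h1
      rw [hMM] at h2
      convert h2 using 1
      ext a
      rw [Derivation.leibniz, hc, T.lam_single]
      simp; ring
    refine ⟨fun l => c l none, fun a => ?_⟩
    have h1 : δ (T.Sm u a) = T.xm (u l1) a := by
      rw [TD.Sm, map_sum]; simp [hd']
    rw [← h1, huw, TD.Sm, map_sum]
    refine Finset.sum_congr rfl fun l _ => ?_
    rw [hc, T.lam_eq]; simp [hcz, mul_comm]
  -- second part
  have huniq : ∀ l l', e l ≠ 0 → e l' ≠ 0 → l = l' := by
    intro l l' hl hl'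
    by_contra hne
    obtain ⟨p0⟩ := ‹Nonempty τ›
    set lamb : Fin j → Option τ → F := Pi.single l (Pi.single (some p0) 1) with hlamb
    obtain ⟨δ, hd⟩ := hδ' lamb
    obtain ⟨μ, hμ⟩ := T.der_xm δ (u l1)
    have h1 : ∀ i, e i • (μ - lamb i) - (Pi.single none (δ (e i)) : Option τ → F) = 0 := by
      have := hLI'.eq_zero (c := fun i => e i • (μ - lamb i) - (Pi.single none (δ (e i)) : Option τ → F)) (fun a => by
        have h2 := hμ a
        rw [he a, map_sum, Finset.sum_mul] at h2
        rw [← sub_eq_zero, ← Finset.sum_sub_distrib, ← neg_eq_zero, ← Finset.sum_neg_distrib] at h2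
        rw [← h2]
        refine Finset.sum_congr rfl fun i _ => ?_
        have h3 : T.lam (Pi.single none (δ (e i)) : Option τ → F) a = δ (e i) := by
          rw [T.lam_eq]; simp
        rw [Derivation.leibniz, hd, T.lam_sub, T.lam_smul, T.lam_sub, h3]
        simp only [smul_eq_mul]; ring)
      exact fun i => congrFun this i
    have h2 := congrFun (h1 l) (some p0)
    have h3 := congrFun (h1 l') (some p0)
    simp [hlamb, hl, hl', Ne.symm hne] at h2 h3
    rw [h3] at h2
    simp at h2
  by_cases hex : ∃ l', e l' ≠ 0
  · obtain ⟨l', hl'⟩ := hex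
    refine ⟨l', e l', fun a => ?_⟩
    rw [he, Finset.sum_eq_single l']
    · intro b _ hb
      by_cases hb0 : e b = 0
      · simp [hb0]
      · exact absurd (huniq _ _ hb0 hl') hb
    · simp
  · push Not at hex
    refine ⟨l1, 0, fun a => ?_⟩
    rw [he]; simp [hex]

end key


section cheval
open MvPolynomial

theorem constr_generic {X : Type*} [TopologicalSpace X] (x : X) (s : Set X)
    (hs : Topology.IsConstructible s) :
    (∃ U, IsOpen U ∧ x ∈ U ∧ U ∩ closure {x} ⊆ s) ∨ (∃ U, IsOpen U ∧ x ∈ U ∧ U ∩ closure {x} ⊆ sᶜ) := by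
  induction hs using Topology.IsConstructible.empty_union_induction with
  | open_retrocompact U hU _ =>
    by_cases hx : x ∈ U
    · exact Or.inl ⟨U, hU, hx, Set.inter_subset_left⟩
    · refine Or.inr ⟨Set.univ, isOpen_univ, Set.mem_univ _, ?_⟩
      rw [Set.univ_inter]
      exact closure_minimal (by simpa using hx) hU.isClosed_compl
  | union s _ t _ h1 h2 =>
    rcases h1 with ⟨U, hU, hx, h⟩ | ⟨U, hU, hx, h⟩
    · exact Or.inl ⟨U, hU, hx, h.trans Set.subset_union_left⟩
    · rcases h2 with ⟨V, hV, hx', h'⟩ | ⟨V, hV, hx', h'⟩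
      · exact Or.inl ⟨V, hV, hx', h'.trans Set.subset_union_right⟩
      · refine Or.inr ⟨U ∩ V, hU.inter hV, ⟨hx, hx'⟩, ?_⟩
        rintro y ⟨⟨hy1, hy2⟩, hy⟩ (hs | ht)
        · exact h ⟨hy1, hy⟩ hs
        · exact h' ⟨hy2, hy⟩ ht
  | compl s _ h =>
    rcases h with h | h
    · right; simpa using h
    · left; exact h

theorem cheval {K α β : Type*} [Field K] [IsAlgClosed K] [Finite α] [Finite β]
    (φ : MvPolynomial α K →ₐ[K] MvPolynomial β K) :
    ∃ f, φ f ≠ 0 ∧ ∀ v : α → K, (∀ g, φ g = 0 → eval v g = 0) → eval v f ≠ 0 →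
      ∃ x : β → K, ∀ a, eval x (φ (X a)) = v a := by
  have hfp : φ.toRingHom.FinitePresentation := by
    have h1 : φ.toRingHom.FiniteType := by
      refine RingHom.FiniteType.of_comp_finiteType (f := algebraMap K (MvPolynomial α K)) ?_
      have : (φ.toRingHom.comp (algebraMap K (MvPolynomial α K))) = algebraMap K (MvPolynomial β K) :=
        φ.comp_algebraMap
      rw [this, RingHom.finiteType_algebraMap]
      infer_instance
    exact RingHom.FinitePresentation.of_finiteType.1 h1
  have hc := PrimeSpectrum.isConstructible_range_comap hfp
  let P0 : PrimeSpectrum (MvPolynomial α K) := PrimeSpectrum.comap φ.toRingHom ⊥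
  rcases constr_generic P0 _ hc with ⟨U, hU, hx, h⟩ | ⟨U, hU, hx, h⟩
  swap
  · exact absurd ⟨⊥, rfl⟩ (h ⟨hx, subset_closure rfl⟩)
  obtain ⟨V, ⟨f, rfl⟩, hf, hfU⟩ := PrimeSpectrum.isTopologicalBasis_basic_opens.exists_subset_of_mem_open hx hU
  refine ⟨f, fun h0 => hf (by simpa [P0] using h0), fun v hv hfv => ?_⟩
  let Q : PrimeSpectrum (MvPolynomial α K) := ⟨RingHom.ker (eval v), RingHom.ker_isPrime _⟩
  have hQ : Q ∈ Set.range (PrimeSpectrum.comap φ.toRingHom) := by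
    refine h ⟨hfU ?_, ?_⟩
    · simpa [Q] using hfv
    · rw [← specializes_iff_mem_closure, ← PrimeSpectrum.le_iff_specializes]
      intro g hg
      exact hv g (by simpa [P0] using hg)
  obtain ⟨q, hq⟩ := hQ
  obtain ⟨M, hM, hqM⟩ := Ideal.exists_le_maximal q.asIdeal q.2.ne_top
  obtain ⟨x, hx⟩ := (isMaximal_iff_eq_vanishingIdeal_singleton (K := K)).1 hM
  refine ⟨x, fun a => ?_⟩
  have h1 : X a - C (v a) ∈ Q.asIdeal := by simp [Q]
  rw [← hq] at h1
  have h2 : φ (X a - C (v a)) ∈ M := hqM h1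
  rw [hx, mem_vanishingIdeal_singleton_iff] at h2
  rw [map_sub, ← algebraMap_eq, AlgHom.commutes, map_sub, AlgHom.commutes, sub_eq_zero] at h2
  simpa using h2

theorem ev_smul {K α : Type*} [CommRing K] {f : MvPolynomial α K} {n : ℕ} (h : f.IsHomogeneous n)
    (t : K) (v : α → K) : eval (t • v) f = t ^ n * eval v f := by
  rw [eval_eq, eval_eq, Finset.mul_sum]
  refine Finset.sum_congr rfl fun d hd => ?_
  have h1 : ∑ i ∈ d.support, d i = n := by
    have := h (mem_support_iff.1 hd)
    rw [← this, Finsupp.weight_apply, Finsupp.sum]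
    simp
  simp only [Pi.smul_apply, smul_eq_mul, mul_pow, Finset.prod_mul_distrib]
  rw [Finset.prod_pow_eq_pow_sum, h1]
  ring

/-- homogeneous components vanish on a cone -/
theorem comp_vanish {K α : Type*} [Field K] [Infinite K] (Bad : Set (α → K))
    (hB : ∀ v ∈ Bad, ∀ t : K, t ≠ 0 → t • v ∈ Bad) (f : MvPolynomial α K)
    (hv : ∀ v ∈ Bad, eval v f = 0) (n : ℕ) : ∀ v ∈ Bad, eval v (homogeneousComponent n f) = 0 := by
  intro v hvB
  have h2 : ∀ t : K, t ≠ 0 → Polynomial.eval t (∑ i ∈ Finset.range (f.totalDegree + 1),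
      Polynomial.C (eval v (homogeneousComponent i f)) * Polynomial.X ^ i) = 0 := by
    intro t ht
    have := hv _ (hB v hvB t ht)
    rw [← sum_homogeneousComponent f, map_sum] at this
    rw [Polynomial.eval_finsetSum, ← this]
    refine Finset.sum_congr rfl fun i _ => ?_
    rw [ev_smul (homogeneousComponent_isHomogeneous i f), Polynomial.eval_mul, Polynomial.eval_C,
      Polynomial.eval_pow, Polynomial.eval_X, mul_comm]
  have h3 : (∑ i ∈ Finset.range (f.totalDegree + 1),
      Polynomial.C (eval v (homogeneousComponent i f)) * Polynomial.X ^ i) = 0 := by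
    refine Polynomial.eq_zero_of_infinite_isRoot _ (Set.Infinite.mono (s := {0}ᶜ) ?_ ?_)
    · intro t ht; exact h2 t ht
    · exact (Set.finite_singleton 0).infinite_compl
  by_cases hnd : n < f.totalDegree + 1
  · have := congrArg (fun P => Polynomial.coeff P n) h3
    simpa [Polynomial.finsetSum_coeff, Polynomial.coeff_X_pow, hnd, Nat.lt_succ_iff] using this
  · rw [homogeneousComponent_eq_zero _ _ (by omega), map_zero]

/-- homogeneous component vanishing on a cone -/
theorem homog_comp {K α : Type*} [Field K] [Infinite K] {B : Type*} [AddCommMonoid B]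
    (φ : MvPolynomial α K →+ B) (Bad : Set (α → K))
    (hB : ∀ v ∈ Bad, ∀ t : K, t ≠ 0 → t • v ∈ Bad) (f : MvPolynomial α K) (hf : φ f ≠ 0)
    (hv : ∀ v ∈ Bad, eval v f = 0) :
    ∃ g n, g.IsHomogeneous n ∧ φ g ≠ 0 ∧ ∀ v ∈ Bad, eval v g = 0 := by
  have h1 : ∃ n, φ (homogeneousComponent n f) ≠ 0 := by
    by_contra h
    push Not at h
    apply hf
    rw [← sum_homogeneousComponent f, map_sum]
    exact Finset.sum_eq_zero fun i _ => h i
  obtain ⟨n, hn⟩ := h1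
  exact ⟨_, n, homogeneousComponent_isHomogeneous n f, hn, comp_vanish Bad hB f hv n⟩
end cheval


section ident
open MvPolynomial
variable {σ τ I : Type} [Fintype σ] [Fintype τ] [DecidableEq τ] [Fintype I] (T : TD σ τ I) 
variable {K : Type*} [Field K] [CharZero K] {F : Type*} [Field F] [Algebra K F] {j : ℕ}

theorem TD.Sm_map {A A' : Type*} [CommRing A] [CommRing A'] (φ : A →+* A') (u : Fin j → σ → A) (a : I) :
    φ (T.Sm u a) = T.Sm (fun l s => φ (u l s)) a := by
  simp [TD.Sm, T.xm_map]

/-- universal sum -/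
def TD.Phi (K : Type*) [Field K] (j : ℕ) : MvPolynomial I K →ₐ[K] MvPolynomial (Fin j × σ) K :=
  aeval (T.Sm (fun (l : Fin j) s => X (l, s)))

theorem TD.Phi_aeval {A : Type*} [CommRing A] [Algebra K A] (u : Fin j → σ → A) (f : MvPolynomial I K) :
    aeval (fun p : Fin j × σ => u p.1 p.2) (T.Phi K j f) = aeval (T.Sm u) f := by
  have : (aeval (fun p : Fin j × σ => u p.1 p.2) : _ →ₐ[K] A).comp (T.Phi K j) = aeval (T.Sm u) := by
    apply MvPolynomial.algHom_ext
    intro a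
    simp only [TD.Phi, AlgHom.comp_apply, aeval_X]
    have := T.Sm_map (aeval (fun p : Fin j × σ => u p.1 p.2) : _ →ₐ[K] A).toRingHom
      (fun (l : Fin j) s => X (l, s)) a
    simpa using this
  rw [← this]; rfl

theorem TD.Phi_eval (u : Fin j → σ → K) (f : MvPolynomial I K) :
    eval (fun p : Fin j × σ => u p.1 p.2) (T.Phi K j f) = eval (T.Sm u) f :=
  T.Phi_aeval u f

theorem TD.AI_gu (h : T.Gen K j) : T.AI K j (T.Sm (gu K j σ)) := by
  classical
  set u := gu K j σ with hu
  have hLI := T.gen_li h u (gu_ind K j σ)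
  have hun : ∀ l s, u l s ≠ 0 := fun l s => (gu_ind K j σ).ne_zero (l, s)
  have hch : CharZero (GF K j σ) := charZero_of_injective_algebraMap (algebraMap K _).injective
  have hδ : ∀ c : Fin j → Option τ → GF K j σ, ∃ δ : Derivation K (GF K j σ) (GF K j σ),
      ∀ a, δ (T.Sm u a) = T.mu (fun l => T.xm (u l)) c a := by
    intro c
    set hh : Fin j → σ → GF K j σ := fun l s => (T.W s : GF K j σ) * (c l none / T.D) +
      ∑ p, if T.ρ p = s then c l (some p) else 0 with hhh
    obtain ⟨δ, hd⟩ := exists_der _ (gu_ind K j σ) (fun p => u p.1 p.2 * hh p.1 p.2)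
    refine ⟨δ, fun a => ?_⟩
    rw [TD.Sm, map_sum, T.mu_apply]
    refine Finset.sum_congr rfl fun l _ => ?_
    rw [T.der_xm_eq, T.lam_eq]
    congr 1
    have h1 : ∀ s, δ (u l s) / u l s = hh l s := fun s => by
      rw [div_eq_iff (hun l s)]
      have := hd (l, s)
      rw [mul_comm]; exact this
    simp only [h1, hhh, mul_add, Finset.sum_add_distrib, Finset.mul_sum]
    congr 1
    · have h2 : ∑ s, (T.W s : GF K j σ) * T.E a s = T.D := by exact_mod_cast T.hW a
      have h3 : (T.D : GF K j σ) ≠ 0 := by exact_mod_cast T.hD.ne'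
      have h4 : ∑ s, (T.E a s : GF K j σ) * (T.W s * (c l none / T.D)) =
        (∑ s, (T.W s : GF K j σ) * T.E a s) * (c l none / T.D) := by
        rw [Finset.sum_mul]; exact Finset.sum_congr rfl fun _ _ => by ring
      rw [h4, h2]; field_simp
    · rw [Finset.sum_comm]
      refine Finset.sum_congr rfl fun p _ => ?_
      simp [mul_comm]
  obtain ⟨f, hf⟩ := exists_minor _ ((T.lifam_iff _).2 hLI)
  set A := (Matrix.of fun k k' => T.lifam (fun l => T.xm (u l)) k (f k')) with hA
  refine ⟨fun r => X (f r), ?_⟩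
  simp only [aeval_X]
  have : ∀ r, ∃ δ : Derivation K (GF K j σ) (GF K j σ), ∀ r',
      δ (T.Sm u (f r')) = if r = r' then 1 else 0 := by
    intro r
    obtain ⟨δ, hd⟩ := hδ (fun l g => A⁻¹ r (l, g))
    refine ⟨δ, fun r' => ?_⟩
    rw [hd]
    have h1 : (A⁻¹ * A) r r' = if r = r' then 1 else 0 := by
      rw [Matrix.nonsing_inv_mul _ (isUnit_iff_ne_zero.2 hf), Matrix.one_apply]
    rw [← h1, Matrix.mul_apply, Fintype.sum_prod_type, T.mu_apply]
    refine Finset.sum_congr rfl fun l _ => ?_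
    rw [TD.lam, Finset.mul_sum]
    refine Finset.sum_congr rfl fun g _ => ?_
    simp only [hA, Matrix.of_apply, TD.lifam]; ring
  choose δ hd using this
  exact algInd_of_der _ δ hd

theorem TD.AI_transfer (h : T.Gen K j) (q : I → F) (hq : ∀ f : MvPolynomial I K, aeval q f = 0 → T.Phi K j f = 0) :
    T.AI K j q := by
  obtain ⟨g, hg⟩ := T.AI_gu h
  refine ⟨g, ?_⟩
  rw [algebraicIndependent_iff] at hg ⊢
  intro G hG
  apply hg
  have hc : ∀ {F : Type _} [Field F] [Algebra K F] (q : I → F), 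
      aeval (fun r => aeval q (g r)) G = aeval q (aeval g G) := by
    intro F _ _ q
    have : (aeval (fun r => aeval q (g r)) : _ →ₐ[K] F) = (aeval q).comp (aeval g) := by
      apply MvPolynomial.algHom_ext; intro i; simp
    rw [this]; rfl
  have hc' : aeval (fun r => aeval q (g r)) G = aeval q (aeval g G) := by
    have : (aeval (fun r => aeval q (g r)) : _ →ₐ[K] F) = (aeval q).comp (aeval g) := by
      apply MvPolynomial.algHom_ext; intro i; simp
    rw [this]; rfl
  rw [hc'] at hG
  rw [hc, ← T.Phi_aeval, hq _ hG, map_zero]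

/-- the good vectors -/
def TD.Good (j : ℕ) (v : I → K) : Prop :=
  (∃ u : Fin j → σ → K, T.Sm u = v) ∧ (∀ u : Fin j → σ → K, T.Sm u = v → ∀ l s, u l s ≠ 0) ∧
  ∀ u w : Fin j → σ → K, T.Sm u = v → T.Sm w = v → ∀ l, ∃ l', ∀ a b,
    T.xm (u l) a * T.xm (w l') b = T.xm (u l) b * T.xm (w l') a

theorem TD.good1 (h : T.Gen K j) (l : Fin j) (s : σ) :
    ∃ f, T.Phi K j f ≠ 0 ∧ ∀ u : Fin j → σ → K, u l s = 0 → eval (T.Sm u) f = 0 := by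
  classical
  set u' : Fin j → σ → GF K j σ := fun l' s' => if l' = l ∧ s' = s then 0 else gu K j σ l' s' with hu'
  set u0 : Fin j → σ → MvPolynomial (Fin j × σ) K := fun l' s' => if l' = l ∧ s' = s then 0 else X (l', s')
    with hu0
  by_contra hcon
  push Not at hcon
  have hAI : T.AI K j (T.Sm u') := by
    refine T.AI_transfer h _ (fun f hf => ?_)
    by_contra hne
    obtain ⟨u, hus, hu⟩ := hcon f hne
    apply hu
    have h1 : aeval (T.Sm u0) f = 0 := by
      have h2 : algebraMap _ (GF K j σ) (aeval (T.Sm u0) f) = aeval (T.Sm u') f := by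
        rw [← T.Phi_aeval, ← T.Phi_aeval, ← gu_eq]
        have : ((aeval (fun p : Fin j × σ => gu K j σ p.1 p.2) : _ →ₐ[K] GF K j σ).comp
          (aeval (fun p : Fin j × σ => u0 p.1 p.2))) = aeval (fun p : Fin j × σ => u' p.1 p.2) := by
          apply MvPolynomial.algHom_ext
          intro i
          simp only [AlgHom.comp_apply, aeval_X, hu0, hu']
          split_ifs <;> simp
        rw [← this]; rfl
      rw [hf] at h2
      exact (FaithfulSMul.algebraMap_eq_zero_iff _ _).1 h2
    have h3 : eval (T.Sm u) f = eval (fun p : Fin j × σ => u p.1 p.2) (aeval (T.Sm u0) f) := by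
      rw [← T.Phi_eval, ← T.Phi_aeval]
      have : ((aeval (fun p : Fin j × σ => u p.1 p.2) : _ →ₐ[K] K).comp
          (aeval (fun p : Fin j × σ => u0 p.1 p.2))) = aeval (fun p : Fin j × σ => u p.1 p.2) := by
        apply MvPolynomial.algHom_ext
        intro i
        simp only [AlgHom.comp_apply, aeval_X, hu0]
        split_ifs with hi
        · rw [map_zero, hi.1, hi.2, hus]
        · simp
      exact (DFunLike.congr_fun this (T.Phi K j f)).symm
    rw [h3, h1, map_zero]
  have hch : CharZero (GF K j σ) := charZero_of_injective_algebraMap (algebraMap K _).injective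
  exact T.LI_ne u' (T.key0 u' hAI).1 l s (by simp [hu'])

theorem TD.good2 [Nonempty τ] (h : T.Gen K j) (hNT : ∀ l0 : Fin j, T.GenNT K j l0) :
    ∃ f, T.Phi K j f ≠ 0 ∧ ∀ u w : Fin j → σ → K, T.Sm u = T.Sm w → eval (T.Sm u) f ≠ 0 → 
      ∀ l, ∃ l', ∀ a b, T.xm (u l) a * T.xm (w l') b = T.xm (u l) b * T.xm (w l') a := by
  classical
  let S := MvPolynomial ((Fin j × σ) ⊕ (Fin j × σ)) K
  let U : Fin j → σ → S := fun l s => X (Sum.inl (l, s))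
  let V : Fin j → σ → S := fun l s => X (Sum.inr (l, s))
  let J : Ideal S := Ideal.span (Set.range fun a => T.Sm U a - T.Sm V a)
  have eU : ∀ (u w : Fin j → σ → K) l, (fun s =>
      eval (Sum.elim (fun q : Fin j × σ => u q.1 q.2) (fun q : Fin j × σ => w q.1 q.2)) (U l s)) = u l :=
    fun u w l => funext fun s => eval_X _
  have eV : ∀ (u w : Fin j → σ → K) l, (fun s =>
      eval (Sum.elim (fun q : Fin j × σ => u q.1 q.2) (fun q : Fin j × σ => w q.1 q.2)) (V l s)) = w l :=
    fun u w l => funext fun s => eval_X _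
  have hfin : J.minimalPrimes.Finite := J.finite_minimalPrimes_of_isNoetherianRing
  have key : ∀ p ∈ J.minimalPrimes, ∃ f, T.Phi K j f ≠ 0 ∧ ∀ u w : Fin j → σ → K,
      p ≤ RingHom.ker (eval (Sum.elim (fun q : Fin j × σ => u q.1 q.2) (fun q => w q.1 q.2))) →
      eval (T.Sm u) f ≠ 0 → 
      ∀ l, ∃ l', ∀ a b, T.xm (u l) a * T.xm (w l') b = T.xm (u l) b * T.xm (w l') a := by
    intro p hp
    have hpp : p.IsPrime := hp.1.1
    let F := FractionRing (S ⧸ p)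
    let φ : S →ₐ[K] F := (IsScalarTower.toAlgHom K (S ⧸ p) F).comp (Ideal.Quotient.mkₐ K p)
    have hφ : ∀ g, φ g = 0 → g ∈ p := by
      intro g hg
      have h1 : (Ideal.Quotient.mk p g) = 0 := 
        (FaithfulSMul.algebraMap_eq_zero_iff (S ⧸ p) F).1 hg
      exact Ideal.Quotient.eq_zero_iff_mem.1 h1
    have hφ' : ∀ g ∈ p, φ g = 0 := by
      intro g hg
      have h1 : (Ideal.Quotient.mk p g) = 0 := Ideal.Quotient.eq_zero_iff_mem.2 hg
      change algebraMap (S ⧸ p) F (Ideal.Quotient.mk p g) = 0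
      rw [h1, map_zero]
    let u' : Fin j → σ → F := fun l s => φ (U l s)
    let w' : Fin j → σ → F := fun l s => φ (V l s)
    have huw : T.Sm u' = T.Sm w' := by
      ext a
      have h1 : φ (T.Sm U a - T.Sm V a) = 0 := hφ' _ (hp.1.2 (Ideal.subset_span ⟨a, rfl⟩))
      rw [map_sub, sub_eq_zero] at h1
      have h2 := T.Sm_map φ.toRingHom U a
      have h3 := T.Sm_map φ.toRingHom V a
      exact h2.symm.trans (h1.trans h3)
    by_cases hA : ∃ f, T.Phi K j f ≠ 0 ∧ aeval (T.Sm u') f = 0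
    · obtain ⟨f, hf, hf0⟩ := hA
      refine ⟨f, hf, fun u w hpk hne => absurd ?_ hne⟩
      have h1 : aeval (T.Sm U) f ∈ p := by
        apply hφ
        rw [← hf0, ← T.Phi_aeval, ← T.Phi_aeval, ← AlgHom.comp_apply]
        congr 1
        apply MvPolynomial.algHom_ext
        intro i; simp [u']
      have h2 := hpk h1
      rw [RingHom.mem_ker] at h2
      rw [← h2, ← T.Phi_aeval, ← T.Phi_eval]
      have : ((aeval (Sum.elim (fun q : Fin j × σ => u q.1 q.2) (fun q => w q.1 q.2)) : _ →ₐ[K] K).comp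
          (aeval (fun p : Fin j × σ => U p.1 p.2))) = aeval (fun p : Fin j × σ => u p.1 p.2) := by
        apply MvPolynomial.algHom_ext
        intro i
        simp [U]
      exact (DFunLike.congr_fun this (T.Phi K j f)).symm
    · push Not at hA
      have hAI : T.AI K j (T.Sm u') := T.AI_transfer h _ (fun f hf => by
        by_contra hne; exact hA f hne hf)
      refine ⟨1, by simp, fun u w hpk _ l => ?_⟩
      obtain ⟨l', e, he⟩ := T.key hNT u' w' hAI huw l
      refine ⟨l', fun a b => ?_⟩
      have h1 : T.xm (U l) a * T.xm (V l') b - T.xm (U l) b * T.xm (V l') a ∈ p := by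
        apply hφ
        have m1 : ∀ a, φ (T.xm (U l) a) = T.xm (u' l) a := fun a => T.xm_map φ.toRingHom (U l) a
        have m2 : ∀ a, φ (T.xm (V l') a) = T.xm (w' l') a := fun a => T.xm_map φ.toRingHom (V l') a
        rw [map_sub, map_mul, map_mul, m1, m1, m2, m2, he a, he b]
        ring
      have h2 := hpk h1
      rw [RingHom.mem_ker, map_sub, sub_eq_zero, map_mul, map_mul, T.xm_map, T.xm_map, T.xm_map,
        T.xm_map] at h2
      rw [eU, eV] at h2
      exact h2
  choose! f hf hf' using key
  refine ⟨∏ p ∈ hfin.toFinset, f p, ?_, ?_⟩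
  · rw [map_prod]
    exact Finset.prod_ne_zero_iff.2 fun p hp => hf p (hfin.mem_toFinset.1 hp)
  · intro u w huw hne
    have hJ : J ≤ RingHom.ker (eval (Sum.elim (fun q : Fin j × σ => u q.1 q.2) (fun q => w q.1 q.2))) := by
      rw [Ideal.span_le]
      rintro _ ⟨a, rfl⟩
      rw [SetLike.mem_coe, RingHom.mem_ker, map_sub, T.Sm_map, T.Sm_map, sub_eq_zero]
      have e1 := funext (eU u w)
      have e2 := funext (eV u w)
      exact (congrArg (fun z => T.Sm z a) e1).trans
        ((congrFun huw a).trans (congrArg (fun z => T.Sm z a) e2).symm)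
    have := RingHom.ker_isPrime (eval (Sum.elim (fun q : Fin j × σ => u q.1 q.2)
      (fun q : Fin j × σ => w q.1 q.2)))
    obtain ⟨p, hp, hpk⟩ := Ideal.exists_minimalPrimes_le hJ
    refine hf' p hp u w hpk ?_
    rw [map_prod] at hne
    exact (Finset.prod_ne_zero_iff.1 hne) p (hfin.mem_toFinset.2 hp)

theorem TD.xm_scale {A : Type*} [CommRing A] (u : σ → A) (r : A) (a : I) :
    T.xm (fun s => r ^ T.W s * u s) a = r ^ T.D * T.xm u a := by
  simp only [TD.xm, mul_pow, Finset.prod_mul_distrib, ← pow_mul]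
  rw [Finset.prod_pow_eq_pow_sum, T.hW]

theorem TD.Sm_scale {A : Type*} [CommRing A] (u : Fin j → σ → A) (r : A) (a : I) :
    T.Sm (fun l s => r ^ T.W s * u l s) a = r ^ T.D * T.Sm u a := by
  simp only [TD.Sm, T.xm_scale, Finset.mul_sum]

theorem TD.exists_good [IsAlgClosed K] [Nonempty τ] (h : T.Gen K j) (hNT : ∀ l0 : Fin j, T.GenNT K j l0) :
    ∃ (f : MvPolynomial I K) (n : ℕ), f.IsHomogeneous n ∧ T.Phi K j f ≠ 0 ∧
      ∀ v : I → K, (∀ g, T.Phi K j g = 0 → eval v g = 0) → eval v f ≠ 0 → T.Good j v := by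
  classical
  obtain ⟨f1, hf1, h1⟩ := cheval (T.Phi K j)
  choose f2 hf2 h2 using T.good1 h
  obtain ⟨f3, hf3, h3⟩ := T.good2 h hNT
  have key : ∀ v : I → K, (∀ g, T.Phi K j g = 0 → eval v g = 0) →
      eval v (f1 * (∏ l, ∏ s, f2 l s) * f3) ≠ 0 → T.Good j v := by
    intro v hv hne
    rw [map_mul, map_mul, map_prod] at hne
    have n1 := left_ne_zero_of_mul (left_ne_zero_of_mul hne)
    have n2 := right_ne_zero_of_mul (left_ne_zero_of_mul hne)
    have n3 := right_ne_zero_of_mul hne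
    refine ⟨?_, ?_, ?_⟩
    · obtain ⟨x, hx⟩ := h1 v hv n1
      refine ⟨fun l s => x (l, s), ?_⟩
      ext a
      have := T.Phi_eval (fun l s => x (l, s)) (X a)
      rw [eval_X] at this
      rw [← this, ← hx a]
    · rintro u rfl l s h0
      refine Finset.prod_ne_zero_iff.1 n2 l (Finset.mem_univ _) ?_
      rw [map_prod]
      exact Finset.prod_eq_zero (Finset.mem_univ s) (h2 l s u h0)
    · rintro u w rfl hw l
      exact h3 u w hw.symm n3 l
  obtain ⟨g, n, hg, hg0, hg1⟩ := homog_comp (T.Phi K j).toRingHom.toAddMonoidHom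
    {v : I → K | (∀ g, T.Phi K j g = 0 → eval v g = 0) ∧ ¬ T.Good j v} (by
      rintro v ⟨hv, hng⟩ t ht
      obtain ⟨r, hr⟩ := IsAlgClosed.exists_pow_nat_eq t T.hD
      have hr0 : r ≠ 0 := by rintro rfl; rw [zero_pow T.hD.ne'] at hr; exact ht hr.symm
      constructor
      · intro g hg
        have e1 : ∀ v : I → K, eval (t • v) g = eval v (aeval (fun a => C t * X a) g) := by
          intro v
          have : (aeval (t • v) : _ →ₐ[K] K) = (aeval v).comp (aeval (fun a => C t * X a)) := by
            apply MvPolynomial.algHom_ext; intro i; simp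
          exact DFunLike.congr_fun this g
        rw [e1]
        apply hv
        have : (T.Phi K j).comp (aeval (fun a => C t * X a)) =
          (aeval (fun p : Fin j × σ => C (r ^ T.W p.2) * X p)).comp (T.Phi K j) := by
          apply MvPolynomial.algHom_ext; intro i
          rw [AlgHom.comp_apply, AlgHom.comp_apply,
            T.Phi_aeval (fun (l : Fin j) s => C (r ^ T.W s) * X (l, s))]
          simp only [aeval_X, map_mul]
          have := T.Sm_scale (fun (l : Fin j) s => (X (l, s) : MvPolynomial (Fin j × σ) K)) (C r) i
          simp only [← C_pow] at this
          rw [this, hr]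
          congr 1
          · rw [← algebraMap_eq, AlgHom.commutes]; rfl
          · simp [TD.Phi]
        have := DFunLike.congr_fun this g
        rw [AlgHom.comp_apply, AlgHom.comp_apply, hg, map_zero] at this
        exact this
      · intro hgood
        apply hng
        have hsc : ∀ (u : Fin j → σ → K), T.Sm u = v → T.Sm (fun l s => r ^ T.W s * u l s) = t • v := by
          rintro u rfl
          ext a
          rw [T.Sm_scale, hr]; rfl
        refine ⟨?_, ?_, ?_⟩
        · obtain ⟨u, hu⟩ := hgood.1
          refine ⟨fun l s => r⁻¹ ^ T.W s * u l s, ?_⟩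
          ext a
          rw [T.Sm_scale, hu, inv_pow, hr]
          simp [ht]
        · intro u hu l s h0
          exact hgood.2.1 _ (hsc u hu) l s (by rw [h0, mul_zero])
        · intro u w hu hw l
          obtain ⟨l', hl'⟩ := hgood.2.2 _ _ (hsc u hu) (hsc w hw) l
          refine ⟨l', fun a b => ?_⟩
          have := hl' a b
          rw [T.xm_scale, T.xm_scale, T.xm_scale, T.xm_scale] at this
          have hp : r ^ T.D * r ^ T.D ≠ 0 := by rw [hr]; exact mul_ne_zero ht ht
          apply mul_left_cancel₀ hp
          linear_combination this) (f1 * (∏ l, ∏ s, f2 l s) * f3) (by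
      change T.Phi K j _ ≠ 0
      rw [map_mul, map_mul, map_prod]
      refine mul_ne_zero (mul_ne_zero hf1 (Finset.prod_ne_zero_iff.2 fun l _ => ?_)) hf3
      rw [map_prod]
      exact Finset.prod_ne_zero_iff.2 fun s _ => hf2 l s) (by
      rintro v ⟨hv, hng⟩
      by_contra hne
      exact hng (key v hv hne))
  refine ⟨g, n, hg, hg0, fun v hv hne => ?_⟩
  by_contra hng
  exact hne (hg1 v ⟨hv, hng⟩)

end ident


section geo
open MvPolynomial
variable {K : Type*} [Field K] {ι : Type*} [Fintype ι]

theorem mem_sub_rep (x : PP K ι) (v : ι → K) : v ∈ x.submodule ↔ ∃ t : K, t • x.rep = v := by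
  rw [Projectivization.submodule_eq, Submodule.mem_span_singleton]

theorem rep_mem (x : PP K ι) : x.rep ∈ x.submodule := by
  rw [mem_sub_rep]; exact ⟨1, one_smul _ _⟩

theorem mem_sub_of_ne (x : PP K ι) {v : ι → K} (hv : v ∈ x.submodule) (h0 : v ≠ 0) :
    ∃ t : K, t ≠ 0 ∧ t • v = x.rep := by
  obtain ⟨t, rfl⟩ := (mem_sub_rep x v).1 hv
  have ht : t ≠ 0 := by rintro rfl; simp at h0
  exact ⟨t⁻¹, inv_ne_zero ht, by rw [smul_smul, inv_mul_cancel₀ ht, one_smul]⟩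

theorem eq_of_mem_sub (x y : PP K ι) {v : ι → K} (hv : v ∈ x.submodule) (hv' : v ∈ y.submodule)
    (h0 : v ≠ 0) : x = y := by
  obtain ⟨t, ht, h⟩ := mem_sub_of_ne x hv h0
  obtain ⟨t', ht', h'⟩ := mem_sub_of_ne y hv' h0
  apply Projectivization.submodule_injective
  rw [Projectivization.submodule_eq, Projectivization.submodule_eq, ← h, ← h',
    Submodule.span_singleton_smul_eq (isUnit_iff_ne_zero.2 ht),
    Submodule.span_singleton_smul_eq (isUnit_iff_ne_zero.2 ht')]

theorem homog_all {f : MvPolynomial ι K} {n : ℕ} (hf : f.IsHomogeneous n) (x : PP K ι) {v : ι → K}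
    (hv : v ∈ x.submodule) (h0 : v ≠ 0) (h : eval v f = 0) : ∀ w ∈ x.submodule, eval w f = 0 := by
  intro w hw
  obtain ⟨t, -, ht⟩ := mem_sub_of_ne x hv h0
  obtain ⟨t', rfl⟩ := (mem_sub_rep x w).1 hw
  rw [← ht, ev_smul hf, ev_smul hf, h]; simp

theorem isZClosed_one {f : MvPolynomial ι K} {n : ℕ} (hf : f.IsHomogeneous n) :
    IsZClosed (zeroLocus {f} : Set (PP K ι)) :=
  ⟨{f}, by rintro _ rfl; exact ⟨n, hf⟩, rfl⟩

theorem zclosure_le {S Y : Set (PP K ι)} (hY : IsZClosed Y) (h : S ⊆ Y) : zclosure S ⊆ Y :=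
  Set.sInter_subset_of_mem ⟨hY, h⟩

theorem sub_zclosure (S : Set (PP K ι)) : S ⊆ zclosure S :=
  Set.subset_sInter fun _ h => h.2

/-- ideal of the cone -/
def PI (Y : Set (PP K ι)) : Ideal (MvPolynomial ι K) where
  carrier := {f | ∀ x ∈ Y, ∀ v ∈ x.submodule, eval v f = 0}
  add_mem' := by
    intro a b ha hb x hx v hv
    rw [map_add, ha x hx v hv, hb x hx v hv, add_zero]
  zero_mem' := by intro x _ v _; simp
  smul_mem' := by
    intro c a ha x hx v hv
    rw [smul_eq_mul, map_mul, ha x hx v hv, mul_zero]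

theorem mem_PI {Y : Set (PP K ι)} {f : MvPolynomial ι K} :
    f ∈ PI Y ↔ ∀ x ∈ Y, ∀ v ∈ x.submodule, eval v f = 0 := Iff.rfl

theorem PI_comp [Infinite K] {Y : Set (PP K ι)} {f : MvPolynomial ι K} (h : f ∈ PI Y) (n : ℕ) :
    homogeneousComponent n f ∈ PI Y := by
  intro x hx v hv
  exact comp_vanish (x.submodule : Set (ι → K)) (fun w hw t _ => x.submodule.smul_mem t hw) f
    (fun w hw => h x hx w hw) n v hv

theorem PI_homog_mul {Y : Set (PP K ι)} (hY : IsZIrreducible Y) {f g : MvPolynomial ι K} {m n : ℕ}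
    (hf : f.IsHomogeneous m) (hg : g.IsHomogeneous n) (h : f * g ∈ PI Y) : f ∈ PI Y ∨ g ∈ PI Y := by
  have := hY.2 (zeroLocus {f}) (zeroLocus {g}) (isZClosed_one hf) (isZClosed_one hg) (by
    intro x hx
    have h1 := h x hx x.rep (rep_mem x)
    rw [map_mul, mul_eq_zero] at h1
    rcases h1 with h1 | h1
    · left; rintro _ rfl; exact homog_all hf x (rep_mem x) x.rep_nonzero h1
    · right; rintro _ rfl; exact homog_all hg x (rep_mem x) x.rep_nonzero h1)
  rcases this with h1 | h1
  · left; intro x hx v hv; exact h1 hx f rfl v hv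
  · right; intro x hx v hv; exact h1 hx g rfl v hv

theorem PI_le_ker {Y : Set (PP K ι)} (hY : Y.Nonempty) : PI Y < RingHom.ker (eval (0 : ι → K)) := by
  obtain ⟨x, hx⟩ := hY
  refine lt_of_le_of_ne (fun f hf => hf x hx 0 (Submodule.zero_mem _)) (fun h => ?_)
  apply x.rep_nonzero
  ext a
  have : (X a : MvPolynomial ι K) ∈ PI Y := by rw [h, RingHom.mem_ker]; simp
  simpa using this x hx _ (rep_mem x)

theorem PI_prime [Infinite K] {Y : Set (PP K ι)} (hY : IsZIrreducible Y) : (PI Y).IsPrime := by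
  classical
  letI : GradedAlgebra (homogeneousSubmodule ι K) := MvPolynomial.gradedAlgebra
  have hI : (PI Y).IsHomogeneous (homogeneousSubmodule ι K) := by
    intro n f hf
    have := PI_comp hf n
    rwa [← MvPolynomial.decomposition.decompose'_apply] at this
  refine hI.isPrime_of_homogeneous_mem_or_mem ?_ ?_
  · intro h
    exact absurd (h ▸ PI_le_ker hY.1) (by simp)
  · rintro f g ⟨m, hf⟩ ⟨n, hg⟩ h
    exact PI_homog_mul hY hf hg h

theorem zero_PI {Y : Set (PP K ι)} (hY : IsZClosed Y) (x : PP K ι) (h : ∀ f ∈ PI Y, ∀ v ∈ x.submodule, eval v f = 0) :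
    x ∈ Y := by
  obtain ⟨S, hS, rfl⟩ := hY
  intro f hf v hv
  exact h f (fun y hy w hw => hy f hf w hw) v hv

theorem PI_lt {Y Z : Set (PP K ι)} (hY : IsZClosed Y) (h : Y < Z) : PI Z < PI Y := by
  refine lt_of_le_of_ne (fun f hf x hx => hf x (h.le hx)) (fun he => ?_)
  apply h.not_ge
  intro x hx
  apply zero_PI hY
  intro f hf v hv
  rw [← he] at hf
  exact hf x hx v hv
end geo

section geo2
open MvPolynomial
variable {σ τ I : Type} [Fintype σ] [Fintype τ] [DecidableEq τ] [Fintype I] (T : TD σ τ I)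
variable {K : Type*} [Field K] [CharZero K] [IsAlgClosed K]

def TD.XX (K : Type*) [Field K] : Set (PP K I) :=
  {x | ∃ u : σ → K, x.submodule = Submodule.span K {T.xm u}}

theorem TD.xm_smul (u : σ → K) (t : K) : ∃ w, T.xm w = t • T.xm u := by
  obtain ⟨r, hr⟩ := IsAlgClosed.exists_pow_nat_eq t T.hD
  refine ⟨fun s => r ^ T.W s * u s, ?_⟩
  ext a
  rw [T.xm_scale, hr]; rfl

theorem TD.xm_zero : T.xm (0 : σ → K) = 0 := by
  ext a
  have h := T.hW a
  have : ∃ s, T.E a s ≠ 0 := by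
    by_contra hc
    push Not at hc
    simp only [hc, mul_zero, Finset.sum_const_zero] at h
    exact T.hD.ne h
  obtain ⟨s, hs⟩ := this
  exact Finset.prod_eq_zero (Finset.mem_univ s) (by simp [hs])

theorem TD.XX_xm {x : PP K I} (hx : x ∈ T.XX K) {v : I → K} (hv : v ∈ x.submodule) : ∃ u, T.xm u = v := by
  obtain ⟨u, hu⟩ := hx
  rw [hu, Submodule.mem_span_singleton] at hv
  obtain ⟨t, rfl⟩ := hv
  exact T.xm_smul u t

theorem TD.mk_XX (u : σ → K) (h : T.xm u ≠ 0) : (Projectivization.mk K (T.xm u) h) ∈ T.XX K :=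
  ⟨u, Projectivization.submodule_mk _ _⟩

theorem TD.vspan_dec {m : ℕ} (S : Finset (PP K I)) (hS : (S : Set (PP K I)) ⊆ T.XX K) (hc : S.card = m)
    {v : I → K} (hv : v ∈ vspan (S : Set (PP K I))) : ∃ u : Fin m → σ → K, T.Sm u = v ∧
      ∃ e : Fin m ≃ S, ∀ l, T.xm (u l) ∈ (e l).1.submodule := by
  classical
  have h1 : vspan (S : Set (PP K I)) ≤ ⨆ x ∈ S, x.submodule := by
    refine Submodule.span_le.2 ?_
    refine Set.iUnion₂_subset fun x hx => ?_
    exact le_iSup₂_of_le (f := fun (x : PP K I) (_ : x ∈ S) => x.submodule) x hx le_rfl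
  obtain ⟨μ, hμ⟩ := (Submodule.mem_iSup_finset_iff_exists_sum _ _).1 (h1 hv)
  let e : Fin m ≃ S := (Fintype.equivFinOfCardEq (by simpa using hc)).symm
  have h2 : ∀ l, ∃ u, T.xm u = (μ (e l).1 : I → K) := fun l => T.XX_xm (hS (e l).2) (μ (e l).1).2
  choose u hu using h2
  refine ⟨u, ?_, e, fun l => ?_⟩
  · rw [← hμ, ← Finset.sum_coe_sort S (fun x => (μ x : I → K)), ← e.sum_comp]
    ext a
    simp only [TD.Sm, hu, Finset.sum_apply]
  · rw [hu]; exact (μ _).2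

theorem TD.secant_van {m : ℕ} (f : MvPolynomial I K) (hf : T.Phi K m f = 0) :
    ∀ x ∈ zclosure (secant m (T.XX K)), ∀ v ∈ x.submodule, eval v f = 0 := by
  have h1 : ∀ n, ∀ v ∈ Set.range (T.Sm (A := K) (j := m)), eval v (homogeneousComponent n f) = 0 := by
    intro n
    apply comp_vanish
    · rintro _ ⟨u, rfl⟩ t _
      obtain ⟨r, hr⟩ := IsAlgClosed.exists_pow_nat_eq t T.hD
      refine ⟨fun l s => r ^ T.W s * u l s, ?_⟩
      ext a
      rw [T.Sm_scale, hr]; rfl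
    · rintro _ ⟨u, rfl⟩
      rw [← T.Phi_eval, hf, map_zero]
  have h2 : ∀ n, zclosure (secant m (T.XX K)) ⊆ zeroLocus {homogeneousComponent n f} := by
    intro n
    have hcl := isZClosed_one (K := K) (homogeneousComponent_isHomogeneous n f)
    refine zclosure_le hcl (zclosure_le hcl ?_)
    rintro q ⟨S, hS, hc, hq⟩ _ rfl v hv
    obtain ⟨u, hu, -⟩ := T.vspan_dec S hS hc (hq hv)
    exact h1 n v ⟨u, hu⟩
  intro x hx v hv
  rw [← sum_homogeneousComponent f, map_sum]
  exact Finset.sum_eq_zero fun n _ => h2 n hx _ rfl v hv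

theorem TD.gen_of_dim {m : ℕ} (hm : 1 ≤ m)
    (h : (((m * (Fintype.card τ + 1) - 1 : ℕ) : ℕ∞) : WithBot ℕ∞) ≤ zdim (secant m (T.XX K))) :
    T.Gen K m := by
  classical
  obtain ⟨R, hR⟩ : ∃ R, m * (Fintype.card τ + 1) = R + 1 :=
    ⟨m * (Fintype.card τ + 1) - 1, (Nat.sub_add_cancel (Nat.mul_pos hm (Nat.succ_pos _))).symm⟩
  rw [hR, Nat.add_sub_cancel] at h
  have h' : ((R : ℕ) : WithBot ℕ∞) ≤ zdim (secant m (T.XX K)) := h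
  rw [zdim, Order.le_krullDim_iff] at h'
  obtain ⟨l, hl⟩ := h'
  let Y : ℕ → Set (PP K I) := fun i => (l ⟨min i R, by omega⟩).1
  have hY : ∀ i, IsZClosed (Y i) ∧ IsZIrreducible (Y i) ∧ Y i ⊆ zclosure (secant m (T.XX K)) := fun i =>
    (l ⟨min i R, by omega⟩).2
  have hlt : ∀ i < R, Y i < Y (i + 1) := by
    intro i hi
    have : l ⟨min i R, by omega⟩ < l ⟨min (i+1) R, by omega⟩ := l.strictMono (by
      rw [Fin.lt_def]; simp; omega)
    exact this
  let p : ℕ → Ideal (MvPolynomial I K) := fun i =>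
    match i with
    | 0 => RingHom.ker (eval (0 : I → K))
    | i + 1 => PI (Y i)
  obtain ⟨f, hf⟩ := chain_indep (K := K) p (R + 1) (by
    rintro (_ | i) _
    · exact RingHom.ker_isPrime _
    · exact PI_prime (hY i).2.1) (by
    rintro (_ | i) hi
    · exact PI_le_ker (hY 0).2.1.1
    · exact PI_lt (hY i).1 (hlt i (by omega)))
  have hcard : Fintype.card (Fin m × Option τ) = R + 1 := by
    rw [Fintype.card_prod, Fintype.card_fin, Fintype.card_option, hR]
  let e : Fin m × Option τ ≃ Fin (R + 1) := Fintype.equivFinOfCardEq hcard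
  have hAI : T.AI K m (T.Sm (gu K m σ)) := by
    refine ⟨fun r => f (e r), ?_⟩
    rw [algebraicIndependent_iff]
    intro G hG
    have h1 : aeval (fun r => aeval (T.Sm (gu K m σ)) (f (e r))) G =
        aeval (T.Sm (gu K m σ)) (aeval f (rename e G)) := by
      have : (aeval (fun r => aeval (T.Sm (gu K m σ)) (f (e r))) : _ →ₐ[K] GF K m σ) = 
        (aeval (T.Sm (gu K m σ))).comp ((aeval f).comp (rename e)) := by
        apply MvPolynomial.algHom_ext; intro i; simp
      rw [this]; rfl
    rw [h1, ← T.Phi_aeval, gu_eq] at hG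
    have h2 := (FaithfulSMul.algebraMap_eq_zero_iff _ (GF K m σ)).1 hG
    have h3 := hf (rename e G) (fun x hx => T.secant_van _ h2 x ((hY R).2.2 hx))
    exact rename_injective e e.injective (by rw [h3, map_zero])
  have hch : CharZero (GF K m σ) := charZero_of_injective_algebraMap (algebraMap K _).injective
  exact T.gen_of (K := K) _ (T.key0 _ hAI).1
end geo2


section identif
open MvPolynomial
variable {σ τ I : Type} [Fintype σ] [Fintype τ] [DecidableEq τ] [Fintype I] (T : TD σ τ I)
variable {K : Type*} [Field K] [CharZero K] [IsAlgClosed K]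

theorem TD.good_short [Nonempty τ] {j m : ℕ} (hm : m < j) {v : I → K} (hv : T.Good j v)
    (w : Fin m → σ → K) (hw : T.Sm w = v) : False := by
  obtain ⟨d, rfl⟩ : ∃ d, j = m + (d + 1) := ⟨j - m - 1, by omega⟩
  refine hv.2.1 (Fin.append w (fun _ => 0)) ?_ (Fin.natAdd m 0) (T.ρ (Classical.arbitrary τ)) ?_
  · ext a
    rw [← hw, TD.Sm, Fin.sum_univ_add]
    simp [Fin.append_left, Fin.append_right, T.xm_zero, TD.Sm]
  · rw [Fin.append_right]; rfl

theorem mem_vspan {S : Set (PP K I)} {x : PP K I} (hx : x ∈ S) {v : I → K} (hv : v ∈ x.submodule) :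
    v ∈ vspan S :=
  Submodule.subset_span (Set.mem_biUnion hx hv)

theorem TD.xm_ne (u : σ → K) (hu : ∀ s, u s ≠ 0) (a : I) : T.xm u a ≠ 0 :=
  Finset.prod_ne_zero_iff.2 fun s _ => pow_ne_zero _ (hu s)

theorem TD.good_min [Nonempty τ] {j : ℕ} {v : I → K} (hv : T.Good j v) (S : Finset (PP K I))
    (hS : (S : Set (PP K I)) ⊆ T.XX K) (h : v ∈ vspan (S : Set (PP K I))) : j ≤ S.card := by
  by_contra hlt
  obtain ⟨u, hu, -⟩ := T.vspan_dec S hS rfl h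
  exact T.good_short (not_le.1 hlt) hv u hu

theorem TD.good_S0 [Nonempty τ] {j : ℕ} {v : I → K} (hv : T.Good j v) :
    ∃ S0 : Finset (PP K I), (S0 : Set (PP K I)) ⊆ T.XX K ∧ S0.card = j ∧ v ∈ vspan (S0 : Set (PP K I)) ∧
      ∀ S : Finset (PP K I), (S : Set (PP K I)) ⊆ T.XX K → S.card = j →
        v ∈ vspan (S : Set (PP K I)) → S = S0 := by
  classical
  obtain ⟨u, hu⟩ := hv.1
  have hun := hv.2.1 u hu
  have hne : ∀ l, T.xm (u l) ≠ 0 := fun l h => T.xm_ne (u l) (hun l) T.e0 (congrFun h _)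
  let pt : Fin j → PP K I := fun l => Projectivization.mk K (T.xm (u l)) (hne l)
  have hpt : ∀ l, T.xm (u l) ∈ (pt l).submodule := fun l => by
    simp only [pt, Projectivization.submodule_mk]
    exact Submodule.mem_span_singleton_self _
  let S0 : Finset (PP K I) := Finset.univ.image pt
  have h1 : (S0 : Set (PP K I)) ⊆ T.XX K := by
    intro x hx
    obtain ⟨l, -, rfl⟩ := Finset.mem_image.1 hx
    exact T.mk_XX _ _
  have h2 : v ∈ vspan (S0 : Set (PP K I)) := by
    have : v = ∑ l, T.xm (u l) := by
      rw [← hu]; ext a; simp [TD.Sm]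
    rw [this]
    refine Submodule.sum_mem _ fun l _ => mem_vspan (x := pt l) ?_ (hpt l)
    exact Finset.mem_image_of_mem _ (Finset.mem_univ _)
  have h3 : S0.card = j := le_antisymm (by
    simpa using (Finset.card_image_le (s := Finset.univ) (f := pt))) (T.good_min hv S0 h1 h2)
  refine ⟨S0, h1, h3, h2, fun S hS hc hvS => ?_⟩
  obtain ⟨w, hw, e, he⟩ := T.vspan_dec S hS hc hvS
  symm
  apply Finset.eq_of_subset_of_card_le
  · intro x hx
    obtain ⟨l, -, rfl⟩ := Finset.mem_image.1 hx
    obtain ⟨l', hl'⟩ := hv.2.2 u w hu hw l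
    have hw0 := T.xm_ne (w l') (hv.2.1 w hw l') T.e0
    have : T.xm (u l) ∈ (e l').1.submodule := by
      have h5 : T.xm (u l) = (T.xm (u l) T.e0 / T.xm (w l') T.e0) • T.xm (w l') := by
        ext a
        rw [Pi.smul_apply, smul_eq_mul, div_mul_eq_mul_div, eq_div_iff hw0, hl']
      rw [h5]
      exact Submodule.smul_mem _ _ (he l')
    rw [eq_of_mem_sub _ _ (hpt l) this (hne l)]
    exact (e l').2
  · rw [hc, h3]

theorem sub_le_iff (q : PP K I) {v : I → K} (hv : v ∈ q.submodule) (h0 : v ≠ 0) (S : Set (PP K I)) :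
    q ∈ projSpan S ↔ v ∈ vspan S := by
  constructor
  · intro h; exact h hv
  · intro h w hw
    obtain ⟨t, -, ht⟩ := mem_sub_of_ne q hv h0
    obtain ⟨t', rfl⟩ := (mem_sub_rep q w).1 hw
    rw [← ht]
    exact Submodule.smul_mem _ _ (Submodule.smul_mem _ _ h)

theorem TD.ident [Nonempty τ] {j : ℕ} (hj : 1 ≤ j) (h : T.Gen K j) (hNT : ∀ l0 : Fin j, T.GenNT K j l0) :
    Identifiable (T.XX K) j := by
  classical
  obtain ⟨f, n, hf, hPf, hgood⟩ := T.exists_good h hNT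
  refine ⟨zeroLocus {f}, isZClosed_one hf, ?_, ?_⟩
  · have : ∃ x : Fin j × σ → K, eval x (T.Phi K j f) ≠ 0 := by
      by_contra hc
      push Not at hc
      exact hPf (MvPolynomial.funext fun x => by rw [hc x, map_zero])
    obtain ⟨x, hx⟩ := this
    have hx' : eval (T.Sm (fun l s => x (l, s))) f ≠ 0 := by
      rw [← T.Phi_eval]; exact hx
    set v := T.Sm (fun l s => x (l, s)) with hv
    have hg : T.Good j v := hgood v (fun g hg => by rw [hv, ← T.Phi_eval, hg, map_zero]) hx'
    have hv0 : v ≠ 0 := by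
      intro h0
      refine hg.2.1 (fun _ => 0) ?_ ⟨0, hj⟩ (T.ρ (Classical.arbitrary τ)) rfl
      rw [h0]; ext a; simp [TD.Sm, T.xm_zero]
    obtain ⟨S0, h1, h2, h3, -⟩ := T.good_S0 hg
    let q : PP K I := Projectivization.mk K v hv0
    have hq : v ∈ q.submodule := by
      simp only [q, Projectivization.submodule_mk]
      exact Submodule.mem_span_singleton_self _
    intro hsub
    apply hx'
    refine hsub (sub_zclosure _ ?_ : q ∈ secant j (T.XX K)) f rfl v hq
    exact ⟨S0, h1, h2, (sub_le_iff q hq hv0 _).2 h3⟩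
  · rintro q ⟨hq, hqf⟩
    have hg : T.Good j q.rep := hgood _ (fun g hg => T.secant_van g hg q (sub_zclosure _ hq) _ (rep_mem q)) (by
      intro h0
      apply hqf
      rintro _ rfl
      exact homog_all hf q (rep_mem q) q.rep_nonzero h0)
    have hiff := sub_le_iff q (rep_mem q) q.rep_nonzero
    obtain ⟨S0, h1, h2, h3, h4⟩ := T.good_S0 hg
    have hx : xrank (T.XX K) q = j := by
      have hmem : j ∈ {k | ∃ S : Finset (PP K I), ↑S ⊆ T.XX K ∧ S.card = k ∧
          q ∈ projSpan (S : Set (PP K I))} := ⟨S0, h1, h2, (hiff _).2 h3⟩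
      apply le_antisymm
      · exact Nat.sInf_le hmem
      · obtain ⟨S, hS, hc, hqS⟩ := Nat.sInf_mem ⟨j, hmem⟩
        rw [xrank, ← hc]
        exact T.good_min hg S hS ((hiff _).1 hqS)
    refine ⟨S0, ⟨h1, h2.trans hx.symm, (hiff _).2 h3⟩, ?_⟩
    rintro S ⟨hS, hc, hqS⟩
    exact h4 S hS (hc.trans hx) ((hiff _).1 hqS)
end identif


section iso
open MvPolynomial
variable {K : Type*} [Field K] {ι : Type*} [Fintype ι]

theorem taylor1 (x : ι → K) (f : MvPolynomial ι K) :
    f - C (eval x f) - ∑ a, C (eval x (pderiv a f)) * (X a - C (x a)) ∈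
      RingHom.ker (eval x) • RingHom.ker (eval x) := by
  classical
  have hk : ∀ g : MvPolynomial ι K, g - C (eval x g) ∈ RingHom.ker (eval x) := by
    intro g; rw [RingHom.mem_ker]; simp
  induction f using MvPolynomial.induction_on with
  | C c => simp
  | add p q hp hq =>
    convert add_mem hp hq using 1
    simp only [map_add, add_mul, Finset.sum_add_distrib]
    ring
  | mul_X p i hp =>
    have h1 := Submodule.smul_mem_smul (hk p) (hk (X i))
    have h2 := Ideal.mul_mem_left _ (C (x i)) hp
    convert add_mem h2 h1 using 1
    have h3 : ∀ a, C (eval x (pderiv a (p * X i))) * (X a - C (x a)) =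
        C (x i) * (C (eval x (pderiv a p)) * (X a - C (x a))) + 
        (if a = i then C (eval x p) * (X i - C (x i)) else 0) := by
      intro a
      rw [Derivation.leibniz, pderiv_X]
      by_cases h : a = i
      · subst h; simp; ring
      · simp [h]; ring
    simp only [h3, Finset.sum_add_distrib, ← Finset.mul_sum, Finset.sum_ite_eq', Finset.mem_univ,
      if_true, map_mul, eval_X, smul_eq_mul]
    ring

theorem grad_all [DecidableEq ι] (x : ι → K) (P : Ideal (MvPolynomial ι K)) (i0 : ι)
    (h : ∀ y : ι → K, (∀ f ∈ P, ∑ a, y a * eval x (pderiv a f) = 0) → y i0 = 0 → y = 0) (a : ι) :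
    ∃ f ∈ P, ∃ s : K, ∀ b, eval x (pderiv b f) + s * (if i0 = b then 1 else 0) = if a = b then 1 else 0 := by
  classical
  let L : (P × K) →ₗ[K] (ι → K) :=
    { toFun := fun z b => eval x (pderiv b z.1.1) + z.2 * (if i0 = b then 1 else 0)
      map_add' := by
        intro z z'; ext b
        simp only [Prod.fst_add, Prod.snd_add, Submodule.coe_add, map_add, Pi.add_apply]; ring
      map_smul' := by
        intro c z; ext b
        simp only [Prod.smul_fst, Prod.smul_snd, Submodule.coe_smul_of_tower, Derivation.map_smul, smul_eval, Pi.smul_apply, smul_eq_mul, RingHom.id_apply]; ring }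
  by_contra hcon
  have hn : (fun b => if a = b then (1 : K) else 0) ∉ LinearMap.range L := by
    rintro ⟨⟨f, s⟩, hz⟩
    exact hcon ⟨f.1, f.2, s, fun b => congrFun hz b⟩
  obtain ⟨φ, hφ, hle⟩ := Submodule.exists_le_ker_of_notMem hn
  have hφs : ∀ w : ι → K, φ w = ∑ b, (φ fun j => if b = j then 1 else 0) * w b := by
    intro w
    rw [LinearMap.pi_apply_eq_sum_univ]
    exact Finset.sum_congr rfl fun b _ => mul_comm _ _
  have hy := h (fun b => φ fun j => if b = j then 1 else 0) (by
    intro f hf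
    have h1 : φ (L (⟨f, hf⟩, 0)) = 0 := hle ⟨_, rfl⟩
    rw [hφs] at h1
    simpa [L] using h1) (by
    have h1 : φ (L (0, 1)) = 0 := hle ⟨_, rfl⟩
    simpa [L] using h1)
  exact hφ (congrFun hy a)

theorem nak_iso (x : ι → K) (P : Ideal (MvPolynomial ι K)) (hP : P ≤ RingHom.ker (eval x)) (i0 : ι)
    (h : ∀ y : ι → K, (∀ f ∈ P, ∑ a, y a * eval x (pderiv a f) = 0) → y i0 = 0 → y = 0) :
    ∃ r : MvPolynomial ι K, eval x r = 1 ∧ ∀ g ∈ RingHom.ker (eval x), ∃ h, r * g - h * (X i0 - C (x i0)) ∈ P := by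
  classical
  set m := RingHom.ker (eval x) with hm
  set Q := P ⊔ Ideal.span {X i0 - C (x i0)} with hQ
  have h1 : ∀ a, X a - C (x a) ∈ Q ⊔ m • m := by
    intro a
    obtain ⟨f, hf, s, hs⟩ := grad_all x P i0 h a
    have h2 := taylor1 x f
    have h3 : eval x f = 0 := hP hf
    have h4 : ∀ b, C (eval x (pderiv b f)) * (X b - C (x b)) = (if a = b then X a - C (x a) else 0) -
        (if i0 = b then C s * (X i0 - C (x i0)) else 0) := by
      intro b
      have : eval x (pderiv b f) = (if a = b then 1 else 0) - s * (if i0 = b then 1 else 0) := by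
        rw [← hs b]; ring
      rw [this]
      by_cases h1 : a = b <;> by_cases h2 : i0 = b
      · subst h1; subst h2; simp; ring
      · subst h1; simp [h2]
      · subst h2; simp [h1]
      · simp [h1, h2]
    rw [h3] at h2
    simp only [h4, Finset.sum_sub_distrib, Finset.sum_ite_eq, Finset.mem_univ, if_true] at h2
    have h5 : X a - C (x a) = (f + C s * (X i0 - C (x i0))) - 
      (f - C 0 - (X a - C (x a) - C s * (X i0 - C (x i0)))) := by simp
    rw [h5]
    refine sub_mem (Submodule.mem_sup_left ?_) (Submodule.mem_sup_right h2)
    exact add_mem (Submodule.mem_sup_left hf) (Submodule.mem_sup_right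
      (Ideal.mul_mem_left _ _ (Ideal.mem_span_singleton_self _)))
  have h2 : m ≤ Q ⊔ m • m := by
    intro f hf
    have h3 := taylor1 x f
    have h4 : eval x f = 0 := hf
    rw [h4] at h3
    have h5 : f = (f - C 0 - ∑ a, C (eval x (pderiv a f)) * (X a - C (x a))) + 
      ∑ a, C (eval x (pderiv a f)) * (X a - C (x a)) := by simp
    rw [h5]
    exact add_mem (Submodule.mem_sup_right h3) (sum_mem fun a _ => Ideal.mul_mem_left _ _ (h1 a))
  obtain ⟨r, hr, hrm⟩ := Submodule.exists_sub_one_mem_and_smul_le_of_fg_of_le_sup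
    (IsNoetherian.noetherian m) le_rfl h2
  refine ⟨r, ?_, fun g hg => ?_⟩
  · rw [hm, RingHom.mem_ker, map_sub, map_one, sub_eq_zero] at hr
    exact hr
  · have h3 : r * g ∈ Q := hrm (Submodule.smul_mem_pointwise_smul _ r _ hg)
    obtain ⟨p, hp, q, hq, hpq⟩ := Submodule.mem_sup.1 h3
    obtain ⟨t, rfl⟩ := Ideal.mem_span_singleton'.1 hq
    exact ⟨t, by rw [← hpq]; simpa using hp⟩

theorem homogenize [Infinite K] (r : MvPolynomial ι K) (i0 : ι) (c : K) (hc : c ≠ 0) :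
    ∃ (H : MvPolynomial ι K) (n : ℕ), H.IsHomogeneous n ∧ ∀ v : ι → K, v i0 = c → eval v H = eval v r := by
  refine ⟨∑ k ∈ Finset.range (r.totalDegree + 1), homogeneousComponent k r * (C c⁻¹ * X i0) ^ (r.totalDegree - k),
    r.totalDegree, ?_, ?_⟩
  · refine IsHomogeneous.sum _ _ _ fun k hk => ?_
    have h1 : (C c⁻¹ * X i0 : MvPolynomial ι K).IsHomogeneous (0 + 1) :=
      (isHomogeneous_C _ _).mul (isHomogeneous_X _ _)
    have h2 := (homogeneousComponent_isHomogeneous k r).mul (h1.pow (r.totalDegree - k))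
    have h3 : k + (0 + 1) * (r.totalDegree - k) = r.totalDegree := by
      have := Finset.mem_range.1 hk
      omega
    rwa [h3] at h2
  · intro v hv
    conv_rhs => rw [← sum_homogeneousComponent r]
    rw [map_sum, map_sum]
    refine Finset.sum_congr rfl fun k _ => ?_
    rw [map_mul, map_pow, map_mul, eval_C, eval_X, hv, inv_mul_cancel₀ hc, one_pow, mul_one]

theorem point_iso [Infinite K] {Y : Set (PP K ι)} (hY : IsZIrreducible Y) (x0 : PP K ι) (hx0 : x0 ∈ Y)
    (i0 : ι) (hi0 : x0.rep i0 ≠ 0)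
    (h : ∀ y : ι → K, (∀ f ∈ PI Y, ∑ a, y a * eval x0.rep (pderiv a f) = 0) → y i0 = 0 → y = 0) :
    Y ⊆ {x0} := by
  set x := x0.rep with hx
  obtain ⟨r, hr1, hr⟩ := nak_iso x (PI Y) (fun f hf => hf x0 hx0 _ (rep_mem x0)) i0 h
  obtain ⟨H, n, hH, hHr⟩ := homogenize r i0 (x i0) hi0
  have hlin : ∀ a, (C (x i0) * X a - C (x a) * X i0 : MvPolynomial ι K).IsHomogeneous 1 := by
    intro a
    have h1 : ∀ (c : K) (b : ι), (C c * X b : MvPolynomial ι K).IsHomogeneous 1 := by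
      intro c b
      have := (isHomogeneous_C ι c).mul (isHomogeneous_X K b)
      rwa [zero_add] at this
    exact (h1 _ _).sub (h1 _ _)
  have hHX : (H * X i0).IsHomogeneous (n + 1) := hH.mul (isHomogeneous_X _ _)
  have key : ∀ a, (C (x i0) * X a - C (x a) * X i0 : MvPolynomial ι K) ∈ PI Y := by
    intro a
    have h1 : (H * X i0) * (C (x i0) * X a - C (x a) * X i0) ∈ PI Y := by
      intro y hy v hv
      by_cases hv0 : v i0 = 0
      · simp [hv0]
      · obtain ⟨t, ht⟩ := hr (C (x i0) * X a - C (x a) * X i0) (by rw [RingHom.mem_ker]; simp; ring)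
        have hv' : (x i0 / v i0) • v ∈ y.submodule := Submodule.smul_mem _ _ hv
        have h2 := ht y hy _ hv'
        have h3 : ((x i0 / v i0) • v) i0 = x i0 := by
          simp [hv0]
        have hne : (x i0 / v i0) ≠ 0 := div_ne_zero hi0 hv0
        have h6 : eval ((x i0 / v i0) • v) (X i0 - C (x i0)) = 0 := by
          rw [map_sub, eval_X, eval_C, h3, sub_self]
        rw [map_sub, map_mul, map_mul, ← hHr _ h3, h6, mul_zero, sub_zero,
          ev_smul hH, ev_smul (hlin a)] at h2
        have h4 : eval v H * eval v (C (x i0) * X a - C (x a) * X i0) = 0 := by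
          have h5 : (x i0 / v i0) ^ n * (x i0 / v i0) ^ 1 ≠ 0 := mul_ne_zero (pow_ne_zero _ hne) (pow_ne_zero _ hne)
          apply (mul_eq_zero.1 _).resolve_left h5
          rw [← h2]; ring
        rw [map_mul, map_mul, mul_right_comm, h4, zero_mul]
    rcases PI_homog_mul hY hHX (hlin a) h1 with h2 | h2
    · exfalso
      have := h2 x0 hx0 _ (rep_mem x0)
      rw [map_mul, ← hx, hHr x rfl, hr1, eval_X, one_mul] at this
      exact hi0 this
    · exact h2
  intro y hy
  have h1 : y.rep ∈ x0.submodule := by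
    rw [mem_sub_rep]
    refine ⟨y.rep i0 / x i0, ?_⟩
    ext a
    have := key a y hy _ (rep_mem y)
    simp only [map_sub, map_mul, eval_C, eval_X] at this
    rw [← hx, Pi.smul_apply, smul_eq_mul, div_mul_eq_mul_div, div_eq_iff hi0]
    linear_combination -this
  exact eq_of_mem_sub _ _ (rep_mem y) h1 y.rep_nonzero
end iso


section fin
open MvPolynomial
variable {K : Type*} [Field K] {ι : Type*} [Fintype ι]

theorem isZClosed_empty : IsZClosed (∅ : Set (PP K ι)) := by
  refine ⟨{1}, ?_, ?_⟩
  · rintro _ rfl; exact ⟨0, isHomogeneous_one _ _⟩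
  · symm; rw [Set.eq_empty_iff_forall_notMem]
    intro x hx
    have := hx 1 rfl _ (rep_mem x)
    simp at this

theorem isZClosed_singleton (x0 : PP K ι) : IsZClosed ({x0} : Set (PP K ι)) := by
  refine ⟨Set.range fun q : ι × ι => C (x0.rep q.1) * X q.2 - C (x0.rep q.2) * X q.1, ?_, ?_⟩
  · rintro _ ⟨q, rfl⟩
    refine ⟨0 + 1, ?_⟩
    exact ((isHomogeneous_C _ _).mul (isHomogeneous_X _ _)).sub ((isHomogeneous_C _ _).mul (isHomogeneous_X _ _))
  · ext y
    constructor
    · rintro rfl _ ⟨q, rfl⟩ v hv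
      obtain ⟨t, rfl⟩ := (mem_sub_rep _ _).1 hv
      simp; ring
    · intro hy
      obtain ⟨i0, hi0⟩ : ∃ i, x0.rep i ≠ 0 := by
        by_contra hc
        push Not at hc
        exact x0.rep_nonzero (_root_.funext hc)
      have h1 : y.rep ∈ x0.submodule := by
        rw [mem_sub_rep]
        refine ⟨y.rep i0 / x0.rep i0, ?_⟩
        ext a
        have := hy _ ⟨(i0, a), rfl⟩ _ (rep_mem y)
        simp only [map_sub, map_mul, eval_C, eval_X] at this
        rw [Pi.smul_apply, smul_eq_mul, div_mul_eq_mul_div, div_eq_iff hi0]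
        linear_combination -this
      exact eq_of_mem_sub _ _ (rep_mem y) h1 y.rep_nonzero

theorem isZClosed_union {Y Z : Set (PP K ι)} (hY : IsZClosed Y) (hZ : IsZClosed Z) : IsZClosed (Y ∪ Z) := by
  obtain ⟨S, hS, rfl⟩ := hY
  obtain ⟨S', hS', rfl⟩ := hZ
  refine ⟨Set.image2 (· * ·) S S', ?_, ?_⟩
  · rintro _ ⟨f, hf, g, hg, rfl⟩
    obtain ⟨m, hm⟩ := hS f hf
    obtain ⟨n, hn⟩ := hS' g hg
    exact ⟨m + n, hm.mul hn⟩
  · ext x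
    constructor
    · rintro (h | h) _ ⟨f, hf, g, hg, rfl⟩ v hv
      · simp only [map_mul]; rw [h f hf v hv, zero_mul]
      · simp only [map_mul]; rw [h g hg v hv, mul_zero]
    · intro h
      by_contra hc
      rw [Set.mem_union, not_or] at hc
      obtain ⟨h1, h2⟩ := hc
      simp only [zeroLocus, Set.mem_setOf_eq] at h1 h2
      push Not at h1 h2
      obtain ⟨f, hf, v, hv, h1⟩ := h1
      obtain ⟨g, hg, w, hw, h2⟩ := h2
      obtain ⟨m, hm⟩ := hS f hf
      obtain ⟨n, hn⟩ := hS' g hg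
      have h3 := h _ ⟨f, hf, g, hg, rfl⟩ _ (rep_mem x)
      simp only [map_mul, mul_eq_zero] at h3
      rcases h3 with h3 | h3
      · exact h1 (homog_all hm x (rep_mem x) x.rep_nonzero h3 v hv)
      · exact h2 (homog_all hn x (rep_mem x) x.rep_nonzero h3 w hw)

theorem isZClosed_finset (s : Finset (PP K ι)) : IsZClosed (s : Set (PP K ι)) := by
  classical
  induction s using Finset.induction_on with
  | empty => simpa using isZClosed_empty
  | insert a s _ ih =>
    rw [Finset.coe_insert, Set.insert_eq]
    exact isZClosed_union (isZClosed_singleton a) ih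

theorem irr_fin (s : Finset (PP K ι)) (Y : Set (PP K ι)) (hY : IsZIrreducible Y) (h : Y ⊆ s) :
    ∃ x, Y = {x} := by
  classical
  induction s using Finset.induction_on with
  | empty =>
    obtain ⟨x, hx⟩ := hY.1
    exact absurd (h hx) (by simp)
  | insert a s _ ih =>
    rw [Finset.coe_insert, Set.insert_eq] at h
    rcases hY.2 _ _ (isZClosed_singleton a) (isZClosed_finset s) h with h1 | h1
    · exact ⟨a, (Set.subset_singleton_iff_eq.1 h1).resolve_left hY.1.ne_empty⟩
    · exact ih h1

theorem zdim_fin {S : Set (PP K ι)} (s : Finset (PP K ι)) (h : S ⊆ s) : ¬ 0 < zdim S := by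
  intro h0
  rw [zdim, Order.krullDim_pos_iff] at h0
  obtain ⟨l0, l1, hlt⟩ := h0
  have hs : zclosure S ⊆ s := zclosure_le (isZClosed_finset s) h
  obtain ⟨a, ha⟩ := irr_fin s _ l0.2.2.1 (l0.2.2.2.trans hs)
  obtain ⟨b, hb⟩ := irr_fin s _ l1.2.2.1 (l1.2.2.2.trans hs)
  have h2 : l0.1 ⊂ l1.1 := hlt
  rw [ha, hb] at h2
  have := h2.1
  rw [Set.singleton_subset_singleton] at this
  exact h2.2 (by rw [this])
end fin

section tang
open MvPolynomial
variable {σ τ I : Type} [Fintype σ] [Fintype τ] [DecidableEq τ] [Fintype I] (T : TD σ τ I)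
variable {K : Type*} [Field K] [CharZero K] [IsAlgClosed K]

theorem TD.quad_mem (a p a') (h : ∀ s, T.E a s + T.E T.e0 s = T.E a' s + T.E (T.e p) s) :
    (X a * X T.e0 - X a' * X (T.e p) : MvPolynomial I K) ∈ homogVanishingIdeal (T.XX K) := by
  refine ⟨⟨1 + 1, ((isHomogeneous_X _ _).mul (isHomogeneous_X _ _)).sub
    ((isHomogeneous_X _ _).mul (isHomogeneous_X _ _))⟩, fun x hx v hv => ?_⟩
  obtain ⟨u, rfl⟩ := T.XX_xm hx hv
  rw [map_sub, map_mul, map_mul, eval_X, eval_X, eval_X, eval_X, T.xm_rel u _ _ _ _ h, sub_self]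

theorem TD.tan1 (u : σ → K) (hu : ∀ s, u s ≠ 0) (y : I → K)
    (hy : ∀ f ∈ homogVanishingIdeal (T.XX K), ∑ i, y i * eval (T.xm u) (pderiv i f) = 0) :
    ∃ c, ∀ a, y a = T.xm u a * T.lam c a := by
  classical
  have hx := T.xm_ne u hu
  set η : I → K := fun a => y a / T.xm u a with hη
  have hηy : ∀ a, y a = T.xm u a * η a := fun a => by
    rw [hη]; field_simp [hx a]
  have hrel : ∀ a p a', (∀ s, T.E a s + T.E T.e0 s = T.E a' s + T.E (T.e p) s) →
      η a + η T.e0 = η a' + η (T.e p) := by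
    intro a p a' h
    have h1 := hy _ (T.quad_mem a p a' h)
    have h2 : ∀ i, y i * eval (T.xm u) (pderiv i (X a * X T.e0 - X a' * X (T.e p) : MvPolynomial I K)) =
        (if a = i then y i * T.xm u T.e0 else 0) + (if T.e0 = i then y i * T.xm u a else 0) - 
        ((if a' = i then y i * T.xm u (T.e p) else 0) + (if T.e p = i then y i * T.xm u a' else 0)) := by
      intro i
      simp only [map_sub, Derivation.leibniz, pderiv_X, smul_eq_mul, map_add, map_mul, eval_X,
        Pi.single_apply, apply_ite (eval (T.xm u)), map_one, map_zero, eq_comm (a := i)]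
      split_ifs <;> ring
    simp only [h2, Finset.sum_sub_distrib, Finset.sum_add_distrib, Finset.sum_ite_eq, Finset.mem_univ,
      if_true] at h1
    have h3 := T.xm_rel u _ _ _ _ h
    rw [hηy a, hηy T.e0, hηy a', hηy (T.e p)] at h1
    have h4 : (T.xm u a * T.xm u T.e0) * ((η a + η T.e0) - (η a' + η (T.e p))) = 0 := by
      linear_combination h1 - (η a' + η (T.e p)) * h3
    exact sub_eq_zero.1 ((mul_eq_zero.1 h4).resolve_left (mul_ne_zero (hx _) (hx _)))
  set c : Option τ → K := fun g => match g with
    | none => η T.e0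
    | some p => η (T.e p) - η T.e0 with hc
  refine ⟨c, fun a => ?_⟩
  rw [hηy]
  congr 1
  have key : ∀ n a, ∑ p, T.E a (T.ρ p) = n → η a = T.lam c a := by
    intro n
    induction n with
    | zero =>
      intro a ha
      have h1 : ∀ p, T.E a (T.ρ p) = 0 := by simpa using ha
      rcases T.ind a with rfl | ⟨p, a', hp⟩
      · rw [T.lam_e0]
      · have := hp (T.ρ p)
        rw [h1, T.he0, T.he, if_pos rfl] at this
        omega
    | succ n ih =>
      intro a ha
      rcases T.ind a with rfl | ⟨p, a', hp⟩
      · simp [T.he0] at ha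
      · have h1 : ∀ r, T.E a (T.ρ r) = T.E a' (T.ρ r) + if p = r then 1 else 0 := by
          intro r
          have := hp (T.ρ r)
          rwa [T.he0, T.he, add_zero] at this
        have h2 := ih a' (by
          have : ∑ r, T.E a (T.ρ r) = ∑ r, T.E a' (T.ρ r) + 1 := by
            simp [h1, Finset.sum_add_distrib]
          omega)
        have h3 : T.lam c a = T.lam c a' + c (some p) := by
          rw [T.lam_eq, T.lam_eq]
          simp only [h1]
          push_cast
          simp only [mul_add, Finset.sum_add_distrib]
          simp [add_assoc]
        rw [h3, ← h2]
        have := hrel a p a' hp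
        rw [hc]
        linear_combination this
  exact key _ a rfl

theorem der_prod_ring {A : Type*} [CommRing A] [Algebra K A] (δ : Derivation K A A) (u h : σ → A)
    (hd : ∀ s, δ (u s) = h s * u s) (E : σ → ℕ) (S : Finset σ) :
    δ (∏ s ∈ S, u s ^ E s) = (∏ s ∈ S, u s ^ E s) * ∑ s ∈ S, (E s : A) * h s := by
  classical
  have hp : ∀ s (n : ℕ), δ (u s ^ n) = u s ^ n * (n * h s) := by
    intro s n
    induction n with
    | zero => simp
    | succ n ih => rw [pow_succ, Derivation.leibniz, ih, hd]; simp only [smul_eq_mul]; push_cast; ring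
  induction S using Finset.induction_on with
  | empty => simp
  | insert a S ha ih =>
    rw [Finset.prod_insert ha, Finset.sum_insert ha, Derivation.leibniz, ih, hp]
    simp only [smul_eq_mul]; ring

theorem TD.exists_h (c : Option τ → K) : ∃ h : σ → K, ∀ a, ∑ s, (T.E a s : K) * h s = T.lam c a := by
  classical
  refine ⟨fun s => (T.W s : K) * (c none / T.D) + ∑ p, if T.ρ p = s then c (some p) else 0, fun a => ?_⟩
  rw [T.lam_eq]
  simp only [mul_add, Finset.sum_add_distrib, Finset.mul_sum]
  congr 1
  · have h2 : ∑ s, (T.W s : K) * T.E a s = T.D := by exact_mod_cast T.hW a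
    have h3 : (T.D : K) ≠ 0 := by exact_mod_cast T.hD.ne'
    have h4 : ∑ s, (T.E a s : K) * (T.W s * (c none / T.D)) =
      (∑ s, (T.W s : K) * T.E a s) * (c none / T.D) := by
      rw [Finset.sum_mul]; exact Finset.sum_congr rfl fun _ _ => by ring
    rw [h4, h2]; field_simp
  · rw [Finset.sum_comm]
    refine Finset.sum_congr rfl fun p _ => ?_
    simp [mul_comm]

theorem TD.van_xm (f : MvPolynomial I K) (hf : f ∈ homogVanishingIdeal (T.XX K)) (w : σ → K) :
    eval (T.xm w) f = 0 := by
  by_cases h0 : T.xm w = 0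
  · have h1 : T.xm (1 : σ → K) ≠ 0 := fun h => T.xm_ne (1 : σ → K) (by simp) T.e0 (congrFun h _)
    rw [h0]
    exact hf.2 _ (T.mk_XX _ h1) 0 (Submodule.zero_mem _)
  · refine hf.2 _ (T.mk_XX _ h0) _ ?_
    rw [Projectivization.submodule_mk]
    exact Submodule.mem_span_singleton_self _

theorem TD.tan2 (w : σ → K) (c : Option τ → K) (f : MvPolynomial I K)
    (hf : f ∈ homogVanishingIdeal (T.XX K)) :
    ∑ i, (T.xm w i * T.lam c i) * eval (T.xm w) (pderiv i f) = 0 := by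
  obtain ⟨h, hh⟩ := T.exists_h c
  let u : σ → MvPolynomial σ K := fun s => X s
  have ev : ∀ (w : σ → K) (g : MvPolynomial I K), eval w (aeval (T.xm u) g) = eval (T.xm w) g := by
    intro w g
    have : (aeval w : _ →ₐ[K] K).comp (aeval (T.xm u)) = aeval (T.xm w) := by
      apply MvPolynomial.algHom_ext
      intro a
      simp only [AlgHom.comp_apply, aeval_X]
      have := T.xm_map (aeval w : _ →ₐ[K] K).toRingHom u a
      simpa [u] using this
    exact DFunLike.congr_fun this g
  have hG : aeval (T.xm u) f = 0 := MvPolynomial.funext fun w => by rw [ev, T.van_xm f hf, map_zero]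
  let δ := mkDerivation K (fun s => C (h s) * X s : σ → MvPolynomial σ K)
  have h1 := der_aeval (T.xm u) δ f
  rw [hG, map_zero] at h1
  have h2 := congrArg (eval w) h1
  rw [map_zero, map_sum] at h2
  rw [h2]
  refine Finset.sum_congr rfl fun i _ => ?_
  have h3 : δ (T.xm u i) = T.xm u i * ∑ s, (T.E i s : MvPolynomial σ K) * C (h s) :=
    der_prod_ring δ u (fun s => C (h s)) (fun s => mkDerivation_X _ _ _) _ _
  have h4 : eval w (T.xm u i) = T.xm w i := by
    have := T.xm_map (eval w) u i
    simpa [u] using this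
  rw [map_mul, ev, h3, map_mul, h4, map_sum, ← hh]
  simp only [map_mul, map_natCast, eval_C]
  ring
end tang


section weak
open MvPolynomial
variable {σ τ I : Type} [Fintype σ] [Fintype τ] [DecidableEq τ] [Fintype I] (T : TD σ τ I)
variable {K : Type*} [Field K] [CharZero K] [IsAlgClosed K]

theorem TD.tspan_le {j : ℕ} (a : Fin j → PP K I) (w : Fin j → σ → K) (hw : ∀ l s, w l s ≠ 0)
    (h : ∀ l, T.xm (w l) = (a l).rep) {q : PP K I} (hq : q ∈ tangentSpan (T.XX K) (Set.range a))
    {v : I → K} (hv : v ∈ q.submodule) : v ∈ T.M (fun l => (a l).rep) := by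
  classical
  have h1 : vspan (⋃ b ∈ Set.range a, embTangentSpace (T.XX K) b) ≤ T.M (fun l => (a l).rep) := by
    refine Submodule.span_le.2 ?_
    intro v hv
    simp only [coneOf, Set.mem_iUnion] at hv
    obtain ⟨y, ⟨b, ⟨l, rfl⟩, hy⟩, hv⟩ := hv
    obtain ⟨t, rfl⟩ := (mem_sub_rep y v).1 (by simpa using hv)
    obtain ⟨c, hc⟩ := T.tan1 (w l) (hw l) y.rep (fun f hf => by rw [h l]; exact hy f hf)
    have h2 : y.rep = fun i => (fun l => (a l).rep) l i * T.lam c i := by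
      ext i; rw [hc i, h l]
    refine Submodule.smul_mem _ _ ?_
    rw [h2]
    exact T.mul_lam_mem_M _ l c
  exact h1 (hq hv)

theorem TD.tloc {j : ℕ} (a : Fin j → PP K I) (w : Fin j → σ → K) (hw : ∀ l s, w l s ≠ 0)
    (h : ∀ l, T.xm (w l) = (a l).rep) {q : PP K I} (hq : q ∈ tangencyLocus (T.XX K) (Set.range a))
    (g : Option τ) : (fun i => q.rep i * (T.b g i : K)) ∈ T.M (fun l => (a l).rep) := by
  classical
  obtain ⟨hs, ht⟩ := hq
  obtain ⟨w', hw'⟩ := T.XX_xm hs.1 (rep_mem q)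
  by_cases h0 : (fun i => q.rep i * (T.b g i : K)) = 0
  · rw [h0]; exact Submodule.zero_mem _
  · let y : PP K I := Projectivization.mk K _ h0
    have hy : (fun i => q.rep i * (T.b g i : K)) ∈ y.submodule := by
      simp only [y, Projectivization.submodule_mk]
      exact Submodule.mem_span_singleton_self _
    suffices hy' : y ∈ embTangentSpace (T.XX K) q from T.tspan_le a w hw h (ht hy') hy
    intro f hf
    obtain ⟨t, -, hty⟩ := mem_sub_of_ne y hy h0
    have := T.tan2 w' (Pi.single g 1) f hf
    simp only [T.lam_single, hw'] at this
    rw [← hty]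
    simp only [Pi.smul_apply, smul_eq_mul, mul_assoc]
    rw [← Finset.mul_sum]
    simp only [mul_assoc] at this
    rw [this, mul_zero]

theorem TD.comp_pt {j : ℕ} (a : Fin j → PP K I) (w : Fin j → σ → K) (hw : ∀ l s, w l s ≠ 0)
    (h : ∀ l, T.xm (w l) = (a l).rep) (hNT : ∀ l, T.NT (fun l => (a l).rep) l)
    {C : Set (PP K I)} (hC : IsZIrreducible C) (hCs : C ⊆ tangencyLocus (T.XX K) (Set.range a))
    (l : Fin j) (hl : a l ∈ C) : C ⊆ {a l} := by
  classical
  have hne : ∀ i, (a l).rep i ≠ 0 := fun i => by rw [← h l]; exact T.xm_ne _ (hw l) i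
  refine point_iso hC (a l) hl T.e0 (hne _) ?_
  intro y hy hy0
  obtain ⟨c, hc⟩ := T.tan1 (w l) (hw l) y (fun f hf => by
    rw [h l]; exact hy f (fun x hx => hf.2 x (hCs hx).1.1))
  have hb : ∀ g, (fun i => (a l).rep i * T.lam c i * (T.b g i : K)) ∈ T.M (fun l => (a l).rep) := by
    intro g
    by_contra hn
    obtain ⟨ψ, hψ, hψM⟩ := Submodule.exists_le_ker_of_notMem hn
    apply hψ
    have hm : (∑ i, MvPolynomial.C (ψ (Pi.single i 1) * (T.b g i : K)) * X i : MvPolynomial I K) ∈ PI C := by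
      intro x hx v hv
      obtain ⟨t, rfl⟩ := (mem_sub_rep x v).1 hv
      have h1 := hψM (T.tloc a w hw h (hCs hx) g)
      rw [LinearMap.mem_ker, LinearMap.pi_apply_eq_sum_univ] at h1
      simp only [map_sum, map_mul, eval_C, eval_X, Pi.smul_apply, smul_eq_mul]
      calc _ = t * ∑ i, (x.rep i * (T.b g i : K)) • ψ (fun j => if i = j then 1 else 0) := by
            rw [Finset.mul_sum]
            refine Finset.sum_congr rfl fun i _ => ?_
            have : (Pi.single i 1 : I → K) = fun j => if i = j then 1 else 0 := by
              ext j; simp [Pi.single_apply, eq_comm]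
            rw [this, smul_eq_mul]; ring
        _ = 0 := by rw [h1, mul_zero]
    have h2 := hy _ hm
    rw [LinearMap.pi_apply_eq_sum_univ]
    refine Eq.trans ?_ h2
    refine Finset.sum_congr rfl fun i _ => ?_
    have : (Pi.single i 1 : I → K) = fun j => if i = j then 1 else 0 := by
      ext j; simp [Pi.single_apply, eq_comm]
    have h3 : eval (a l).rep (pderiv i (∑ i, MvPolynomial.C (ψ (Pi.single i 1) * (T.b g i : K)) * X i))
        = ψ (Pi.single i 1) * (T.b g i : K) := by
      rw [map_sum, map_sum, Finset.sum_eq_single i]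
      · simp [pderiv_C]
      · intro b _ hb
        simp [pderiv_C, pderiv_X_of_ne hb]
      · simp
    rw [h3, this, smul_eq_mul, hc i, h l]; ring
  have hp := hNT l c hb
  have h0 : c none = 0 := by
    have := hc T.e0
    rw [hy0, T.lam_e0, h l] at this
    exact (mul_eq_zero.1 this.symm).resolve_left (hne _)
  have hc0 : c = 0 := by
    ext (_ | p)
    · exact h0
    · exact hp p
  ext i
  rw [hc i, hc0, T.lam_zero, mul_zero]; rfl

theorem TD.pt_ne {j : ℕ} (hNT : ∀ l0 : Fin j, T.GenNT K j l0) (A : MvPolynomial (Fin j × σ) K)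
    (hA : A ≠ 0) : ∃ z : Fin j → σ → K, eval (fun p => z p.1 p.2) A ≠ 0 ∧ (∀ l s, z l s ≠ 0) ∧
      ∀ l, T.NT (fun l => T.xm (z l)) l := by
  classical
  choose f hf using hNT
  have hP : A * (∏ p : Fin j × σ, X p) *
      ∏ l, (Matrix.of fun k k' => T.ntfam (T.ux K (Fin j)) l k (f l k')).det ≠ 0 := by
    refine mul_ne_zero (mul_ne_zero hA ?_) ?_
    · exact Finset.prod_ne_zero_iff.2 fun p _ => X_ne_zero p
    · exact Finset.prod_ne_zero_iff.2 fun p _ => hf p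
  have : ∃ z : Fin j × σ → K, eval z (A * (∏ p : Fin j × σ, X p) *
      ∏ l, (Matrix.of fun k k' => T.ntfam (T.ux K (Fin j)) l k (f l k')).det) ≠ 0 := by
    by_contra hc
    push Not at hc
    exact hP (MvPolynomial.funext fun x => by rw [hc x, map_zero])
  obtain ⟨z, hz⟩ := this
  rw [map_mul, map_mul, map_prod, map_prod] at hz
  have h1 := left_ne_zero_of_mul (left_ne_zero_of_mul hz)
  have h2 := Finset.prod_ne_zero_iff.1 (right_ne_zero_of_mul (left_ne_zero_of_mul hz))
  have h3 := Finset.prod_ne_zero_iff.1 (right_ne_zero_of_mul hz)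
  refine ⟨fun l s => z (l, s), h1, fun l s => by simpa using h2 (l, s) (Finset.mem_univ _), fun l => ?_⟩
  have h4 := tr2 (aeval (fun q : Fin j × σ => z (q.1, q.2)) : _ →ₐ[K] K).toRingHom
    (T.ntfam (T.ux K (Fin j)) l) (f l) (by
      have := h3 l (Finset.mem_univ _)
      simpa [MvPolynomial.aeval_eq_eval] using this)
  rw [T.ntfam_map] at h4
  have h5 : (fun (l : Fin j) (a : I) => (aeval (fun q : Fin j × σ => z (q.1, q.2)) : _ →ₐ[K] K).toRingHom (T.ux K (Fin j) l a))
      = fun l => T.xm (fun s => z (l, s)) := by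
    ext l a
    exact T.ux_map (fun l s => z (l, s)) l a
  rw [h5] at h4
  exact ((T.ntfam_iff _ _).1 h4).2

theorem TD.not_weak {j : ℕ} (hNT : ∀ l0 : Fin j, T.GenNT K j l0) : ¬ WeaklyDefective (T.XX K) j := by
  classical
  rintro ⟨T0, ⟨S, hS, rfl⟩, ⟨u0, hu0X, hu0⟩, hall⟩
  simp only [multiZeroLocus, Set.mem_setOf_eq] at hu0
  push Not at hu0
  obtain ⟨f, hf, v, hv, hfv⟩ := hu0
  choose u' hu' using fun i => T.XX_xm (hu0X i) (hv i)
  let A : MvPolynomial (Fin j × σ) K :=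
    aeval (fun p : Fin j × I => T.xm (fun s => (X (p.1, s) : MvPolynomial (Fin j × σ) K)) p.2) f
  have hAe : ∀ z : Fin j → σ → K, eval (fun p => z p.1 p.2) A =
      eval (fun p : Fin j × I => T.xm (z p.1) p.2) f := by
    intro z
    simp only [A]
    rw [← MvPolynomial.coe_aeval_eq_eval, ← MvPolynomial.coe_aeval_eq_eval]
    change (aeval _) (aeval _ f) = aeval _ f
    rw [MvPolynomial.comp_aeval_apply]
    congr 2
    ext p
    change (aeval (fun p : Fin j × σ => z p.1 p.2)).toRingHom _ = _
    rw [T.xm_map]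
    simp
  have hA : A ≠ 0 := by
    intro h0
    apply hfv
    have := hAe u'
    rw [h0, map_zero] at this
    simp only [hu'] at this
    exact this.symm
  obtain ⟨z, hz1, hz2, hz3⟩ := T.pt_ne hNT A hA
  have hx0 : ∀ l, T.xm (z l) ≠ 0 := fun l h0 => T.xm_ne (z l) (hz2 l) T.e0 (by rw [h0]; rfl)
  let a : Fin j → PP K I := fun l => Projectivization.mk K (T.xm (z l)) (hx0 l)
  have haX : ∀ l, a l ∈ T.XX K := fun l => T.mk_XX _ _
  have hmem : ∀ l, T.xm (z l) ∈ (a l).submodule := by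
    intro l
    simp only [a, Projectivization.submodule_mk]
    exact Submodule.mem_span_singleton_self _
  choose t ht0 ht using fun l => mem_sub_of_ne (a l) (hmem l) (hx0 l)
  choose w hw using fun l => T.XX_xm (haX l) (rep_mem (a l))
  have hwne : ∀ l s, w l s ≠ 0 := by
    intro l s h0
    obtain ⟨i, hi⟩ := T.enz s
    have h1 : T.xm (w l) i ≠ 0 := by
      rw [hw l, ← ht l]
      exact mul_ne_zero (ht0 l) (T.xm_ne _ (hz2 l) i)
    exact Finset.prod_ne_zero_iff.1 h1 s (Finset.mem_univ _) (by rw [h0, zero_pow hi])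
  have hNT' : ∀ l, T.NT (fun l => (a l).rep) l := by
    intro l
    have := T.NT_scale (hz3 l) t ht0
    have h2 : (fun l i => t l * T.xm (z l) i) = fun l => (a l).rep := by
      ext l i; rw [← ht l]; rfl
    rwa [h2] at this
  have hna : a ∉ multiZeroLocus S := by
    intro h
    apply hz1
    rw [hAe]
    exact h f hf (fun l => T.xm (z l)) hmem
  refine zdim_fin (Finset.univ.image a) ?_ (hall a haX hna)
  refine zclosure_le (isZClosed_finset _) ?_
  refine Set.iUnion₂_subset ?_
  rintro C ⟨hC, ⟨_, hC1, ⟨l, rfl⟩⟩⟩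
  refine (T.comp_pt a w hwne hw hNT' hC.1 hC.2.1 l hC1).trans ?_
  simp
end weak


section inst
theorem card_sv1 (m d : ℕ) :
    Fintype.card {w : Fin (m + 1) → Fin (d + 1) // ∑ j, (w j : ℕ) = d} = Nat.choose (d + m) d := by
  have h := Finset.card_finsuppAntidiag_nat_eq_choose (s := (Finset.univ : Finset (Fin (m + 1)))) d
  rw [Finset.card_univ, Fintype.card_fin] at h
  have h2 : m + 1 + d - 1 = d + m := by omega
  rw [h2] at h
  rw [← h, ← Finset.card_univ]
  refine Finset.card_bij (fun w _ => Finsupp.equivFunOnFinite.symm (fun j => (w.1 j : ℕ))) ?_ ?_ ?_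
  · intro w _
    rw [Finset.mem_finsuppAntidiag]
    exact ⟨by simpa using w.2, Finset.subset_univ _⟩
  · intro w _ w' _ hw
    have := Finsupp.equivFunOnFinite.symm.injective hw
    exact Subtype.ext (funext fun j => Fin.ext (congrFun this j))
  · intro g hg
    rw [Finset.mem_finsuppAntidiag] at hg
    have hg1 : ∑ j, g j = d := hg.1
    refine ⟨⟨fun j => ⟨g j, Nat.lt_succ_of_le ?_⟩, hg1⟩, Finset.mem_univ _, ?_⟩
    · rw [← hg1]; exact Finset.single_le_sum (f := fun j => g j) (fun _ _ => Nat.zero_le _) (Finset.mem_univ j)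
    · ext j; rfl

theorem card_sv (s : ℕ) (n d : Fin s → ℕ) :
    Fintype.card (svIndex s n d) = ∏ i, Nat.choose (d i + n i) (d i) := by
  rw [Fintype.card_pi]
  exact Finset.prod_congr rfl fun i _ => card_sv1 _ _

variable {s : ℕ} {n d : Fin s → ℕ}

abbrev svS (n : Fin s → ℕ) : Type := Σ i : Fin s, Fin (n i + 1)
abbrev svT (n : Fin s → ℕ) : Type := Σ i : Fin s, Fin (n i)

def svE (a : svIndex s n d) (q : svS n) : ℕ := ((a q.1).1 q.2 : ℕ)

def svrho (p : svT n) : svS n := ⟨p.1, p.2.succ⟩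

theorem svE_sum (a : svIndex s n d) (i : Fin s) :
    svE a ⟨i, 0⟩ + ∑ j, svE a (svrho ⟨i, j⟩) = d i := by
  have := (a i).2
  rw [Fin.sum_univ_succ] at this
  exact this

def svf (d : Fin s → ℕ) (g : svT n → ℕ) (i : Fin s) : Fin (n i + 1) → ℕ :=
  Fin.cases (motive := fun _ => ℕ) (d i - ∑ j, g ⟨i, j⟩) (fun j => g ⟨i, j⟩)

theorem svf_sum (g : svT n → ℕ) (hg : ∀ i, ∑ j, g ⟨i, j⟩ ≤ d i) (i : Fin s) :
    ∑ j, svf d g i j = d i := by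
  rw [Fin.sum_univ_succ]
  simp only [svf, Fin.cases_zero, Fin.cases_succ]
  have := hg i
  omega

theorem svf_lt (g : svT n → ℕ) (hg : ∀ i, ∑ j, g ⟨i, j⟩ ≤ d i) (i : Fin s) (j : Fin (n i + 1)) :
    svf d g i j < d i + 1 := by
  have h := Finset.single_le_sum (f := fun j => svf d g i j) (fun _ _ => Nat.zero_le _)
    (Finset.mem_univ j)
  rw [svf_sum g hg i] at h
  exact Nat.lt_succ_of_le h

/-- index with given tails -/
def svtl (g : svT n → ℕ) (hg : ∀ i, ∑ j, g ⟨i, j⟩ ≤ d i) : svIndex s n d := fun i =>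
  ⟨fun j => ⟨svf d g i j, svf_lt g hg i j⟩, svf_sum g hg i⟩

theorem svtl_E (g : svT n → ℕ) (hg : ∀ i, ∑ j, g ⟨i, j⟩ ≤ d i) (p : svT n) :
    svE (svtl g hg) (svrho p) = g p := rfl

theorem svE_inj {a a' : svIndex s n d} (h : ∀ p, svE a (svrho p) = svE a' (svrho p)) : a = a' := by
  funext i
  refine Subtype.ext (funext fun j => Fin.ext ?_)
  refine Fin.cases ?_ (fun j => h ⟨i, j⟩) j
  have h1 := svE_sum a i
  have h2 := svE_sum a' i
  rw [Finset.sum_congr rfl fun j _ => h ⟨i, j⟩] at h1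
  have : svE a ⟨i, 0⟩ = svE a' ⟨i, 0⟩ := by omega
  exact this

theorem svE_rel {a b c e : svIndex s n d}
    (h : ∀ p, svE a (svrho p) + svE b (svrho p) = svE c (svrho p) + svE e (svrho p)) (q : svS n) :
    svE a q + svE b q = svE c q + svE e q := by
  obtain ⟨i, j⟩ := q
  refine Fin.cases ?_ (fun j => h ⟨i, j⟩) j
  have h1 := svE_sum a i
  have h2 := svE_sum b i
  have h3 := svE_sum c i
  have h4 := svE_sum e i
  have h5 := Finset.sum_congr (s₁ := Finset.univ) rfl fun j _ => h ⟨i, j⟩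
  rw [Finset.sum_add_distrib, Finset.sum_add_distrib] at h5
  omega

def svi (p r : svT n) : ℕ := if p = r then 1 else 0

theorem svi_sum (p : svT n) (i : Fin s) : ∑ j, svi p ⟨i, j⟩ = if p.1 = i then 1 else 0 := by
  obtain ⟨i', j'⟩ := p
  by_cases h : i' = i
  · subst h
    simp [svi]
  · rw [if_neg h]
    refine Finset.sum_eq_zero fun j _ => ?_
    rw [svi, if_neg]
    intro h'
    exact h (congrArg Sigma.fst h')

theorem svi_le (hd : ∀ i, 0 < d i) (p : svT n) (i : Fin s) : ∑ j, svi p ⟨i, j⟩ ≤ d i := by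
  rw [svi_sum]
  have := hd i
  split_ifs <;> omega

def svTD (hs : 2 ≤ s) (hn : ∀ i, 0 < n i) (hd : ∀ i, 0 < d i) : TD (svS n) (svT n) (svIndex s n d) where
  E := svE
  ρ := svrho
  Z := fun q => Fin.cases (motive := fun _ => Option (svT n) → ℤ)
    (fun o => o.elim (d q.1 : ℤ) (fun p => if p.1 = q.1 then -1 else 0))
    (fun j o => o.elim 0 (fun p => if p = ⟨q.1, j⟩ then 1 else 0)) q.2
  hZ := by
    rintro a ⟨i, j⟩
    refine Fin.cases ?_ (fun j => ?_) j
    · simp only [Fin.cases_zero, Option.elim]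
      have h := svE_sum a i
      rw [Fintype.sum_sigma, Finset.sum_eq_single i]
      · simp only [if_true]
        rw [← h]
        push_cast
        rw [← Finset.mul_sum]
        ring
      · intro b _ hb
        simp [hb]
      · simp
    · simp only [Fin.cases_succ, Option.elim]
      rw [Finset.sum_eq_single (⟨i, j⟩ : svT n)]
      · simp [svrho]
      · intro b _ hb
        simp [hb]
      · simp
  e0 := svtl (fun _ => 0) (fun i => by simp)
  e := fun p => svtl (svi p) (svi_le hd p)
  he0 := fun p => rfl
  he := fun p r => rfl
  emix := by
    intro p
    obtain ⟨i', hi'⟩ : ∃ i' : Fin s, p.1 ≠ i' := by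
      haveI : Nontrivial (Fin s) := Fin.nontrivial_iff_two_le.2 hs
      obtain ⟨i', h⟩ := exists_ne p.1
      exact ⟨i', h.symm⟩
    let p' : svT n := ⟨i', ⟨0, hn i'⟩⟩
    refine ⟨p', svtl (fun r => svi p r + svi p' r) ?_, ?_, fun r => rfl⟩
    · intro i
      rw [Finset.sum_add_distrib, svi_sum, svi_sum]
      have := hd i
      by_cases h1 : p.1 = i
      · have h2 : ¬ p'.1 = i := fun h2 => hi' (h1.trans h2.symm)
        rw [if_pos h1, if_neg h2]; omega
      · rw [if_neg h1]; split_ifs <;> omega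
    · intro h
      exact hi' (congrArg Sigma.fst h)
  ind := by
    intro a
    by_cases h : ∀ p, svE a (svrho p) = 0
    · left
      exact svE_inj h
    · right
      push Not at h
      obtain ⟨p, hp⟩ := h
      have hle : ∀ r, svi p r ≤ svE a (svrho r) := by
        intro r
        unfold svi
        split_ifs with h
        · subst h; omega
        · omega
      refine ⟨p, svtl (fun r => svE a (svrho r) - svi p r) (fun i => ?_), fun q => svE_rel (fun r => ?_) q⟩
      · have h1 := svE_sum a i
        refine le_trans (Finset.sum_le_sum fun j _ => Nat.sub_le _ _) (by omega)
      · rw [svtl_E, svtl_E, svtl_E]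
        have := hle r
        omega
  W := fun q => if q.1 = ⟨0, by omega⟩ then 1 else 0
  D := d ⟨0, by omega⟩
  hD := hd _
  hW := by
    intro a
    rw [Fintype.sum_sigma, Finset.sum_eq_single ⟨0, by omega⟩]
    · simp only [if_true, one_mul]
      exact (a _).2
    · intro b _ hb
      simp [hb]
    · simp
  enz := by
    rintro ⟨i, j⟩
    refine Fin.cases ?_ (fun j => ?_) j
    · refine ⟨svtl (fun _ => 0) (fun i => by simp), ?_⟩
      have h := svE_sum (svtl (d := d) (fun _ => 0) (fun i => by simp) : svIndex s n d) i
      simp only [svtl_E, Finset.sum_const_zero, add_zero] at h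
      rw [h]
      exact (hd i).ne'
    · refine ⟨svtl (svi ⟨i, j⟩) (svi_le hd _), ?_⟩
      have : svE (svtl (svi ⟨i, j⟩) (svi_le hd _) : svIndex s n d) (svrho ⟨i, j⟩) = 1 := by
        rw [svtl_E]; simp [svi]
      change svE (svtl (svi ⟨i, j⟩) (svi_le hd _) : svIndex s n d) (svrho ⟨i, j⟩) ≠ 0
      rw [this]; exact one_ne_zero
  inj := fun a a' h => svE_inj fun p => congrFun h _

theorem svXX (K : Type*) [Field K] (hs : 2 ≤ s) (hn : ∀ i, 0 < n i) (hd : ∀ i, 0 < d i) :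
    (svTD hs hn hd).XX K = segreVeroneseVariety K s n d := by
  have key : ∀ u : svS n → K, (svTD hs hn hd).xm u =
      fun t : svIndex s n d => ∏ i, ∏ j, u ⟨i, j⟩ ^ ((t i).1 j : ℕ) := by
    intro u
    ext t
    rw [TD.xm, Fintype.prod_sigma]
    rfl
  ext x
  constructor
  · rintro ⟨u, hu⟩
    exact ⟨fun i j => u ⟨i, j⟩, by rw [hu, key]⟩
  · rintro ⟨u, hu⟩
    exact ⟨fun q => u q.1 q.2, by rw [hu, key]⟩

theorem main {K : Type*} [Field K] [IsAlgClosed K] [CharZero K]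
    (s : ℕ) (hs : 2 ≤ s) (n d : Fin s → ℕ) (hn : ∀ i, 0 < n i) (hd : ∀ i, 0 < d i)
    (N r k : ℕ) (hN : N = ∑ i, n i)
    (hr : r + 1 = ∏ i, Nat.choose (d i + n i) (d i))
    (hk : 1 ≤ k)
    (hsec : zdim (secant (k + N - 1) (segreVeroneseVariety K s n d)) =
      ((((k + N - 1) * (N + 1) - 1 : ℕ) : ℕ∞) : WithBot ℕ∞))
    (hlt : (k + N - 1) * (N + 1) - 1 < r) :
    ∀ j : ℕ, 1 ≤ j → j ≤ k →
      ¬WeaklyDefective (segreVeroneseVariety K s n d) j ∧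
        Identifiable (segreVeroneseVariety K s n d) j := by
  intro j hj hjk
  have hcτ : Fintype.card (svT n) = N := by rw [Fintype.card_sigma, hN]; simp
  have hcI : Fintype.card (svIndex s n d) = r + 1 := by rw [card_sv, hr]
  haveI : Nonempty (svT n) := ⟨⟨⟨0, by omega⟩, ⟨0, hn _⟩⟩⟩
  have hNpos : 0 < N := by rw [← hcτ]; exact Fintype.card_pos
  rw [← svXX K hs hn hd] at hsec ⊢
  have hG : (svTD hs hn hd).Gen K (k + N - 1) := by
    apply (svTD hs hn hd).gen_of_dim (by omega)
    rw [hcτ]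
    exact hsec.ge
  have hNT : ∀ l0 : Fin j, (svTD hs hn hd).GenNT K j l0 := by
    intro l0
    refine (svTD hs hn hd).genNT (m := j + N - 1) ((svTD hs hn hd).gen_mono (by omega) hG) hj ?_ ?_ ?_ l0
    · rw [hcτ]; omega
    · rw [hcτ]; exact hNpos
    · rw [hcτ, hcI]
      have : (j + N - 1) * (N + 1) ≤ (k + N - 1) * (N + 1) := Nat.mul_le_mul_right _ (by omega)
      omega
  exact ⟨(svTD hs hn hd).not_weak hNT,
    (svTD hs hn hd).ident hj ((svTD hs hn hd).gen_mono (by omega) hG) hNT⟩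
end inst

end SVP

/-- **Theorem (ip5).**  Fix `s ≥ 2`, `n i > 0`, `d i > 0`; set `N = ∑ n i` and
`r = -1 + ∏ C(d i + n i, d i)`.  Let `X ⊆ ℙ^r` be the Segre–Veronese embedding of
`ℙ^{n 1} × ⋯ × ℙ^{n s}` of multidegree `d` (char `0`).  Assume
`dim σ_{k+N-1}(X) = (k+N-1)(N+1) - 1 < r` and that either `d i > 1` for all `i`, or
for all `i` with `d i = 1` there is `j ≠ i` with `d j = 1` and `n i = n j`.  Then
`X` is not weakly `j`-defective (hence it is `j`-identifiable) for every `j ≤ k`. -/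
theorem statement14 {K : Type*} [Field K] [IsAlgClosed K] [CharZero K]
    (s : ℕ) (hs : 2 ≤ s) (n d : Fin s → ℕ) (hn : ∀ i, 0 < n i) (hd : ∀ i, 0 < d i)
    (N r k : ℕ) (hN : N = ∑ i, n i)
    (hr : r + 1 = ∏ i, Nat.choose (d i + n i) (d i))
    (hk : 1 ≤ k)
    (hsec : zdim (secant (k + N - 1) (segreVeroneseVariety K s n d)) =
      ((((k + N - 1) * (N + 1) - 1 : ℕ) : ℕ∞) : WithBot ℕ∞))
    (hlt : (k + N - 1) * (N + 1) - 1 < r)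
    (hcase : (∀ i, 1 < d i) ∨
      ∀ i, d i = 1 → ∃ j : Fin s, j ≠ i ∧ d j = 1 ∧ n i = n j) :
    ∀ j : ℕ, 1 ≤ j → j ≤ k →
      ¬WeaklyDefective (segreVeroneseVariety K s n d) j ∧
        Identifiable (segreVeroneseVariety K s n d) j := by
  exact SVP.main s hs n d hn hd N r k hN hr hk hsec hlt

end ContactLoci
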